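/- Assume the nondegeneracy and curvature conditions, the main hypothesis, and the auxiliary hypothesis. Then for any ϱ > 0 there exist ρ, c, C ∈ (0,∞) with the following property. Let δ > 0 and let f = (f₁,f₂,f₃) be a triple of functions f_j : ℝ → ℝ such that each f_j is affine on intervals of length δ with slopes satisfying |f_j'| ≤ δ^{−ρ}, such that ‖f_j‖_{L∞} ≤ 2 for each j, and such that |f₃(y)| ≥ 1 for every y ∈ φ₃(B). Then |S(f, δ^{1+ϱ})| ≤ C·δ^c. -/

import Mathlib

open MeasureTheory Set
open scoped ENNReal

noncomputable section

/-- `g` is affine, with slope bounded by `M` in absolute value, on the intervals of a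
partition of `ℝ` into intervals of length `δ`. -/
def AffineOnIntervals (g : ℝ → ℝ) (δ M : ℝ) : Prop :=
  ∃ b : ℝ, ∀ n : ℤ, ∃ m q : ℝ, |m| ≤ M ∧
    ∀ y ∈ Set.Ico (b + (n : ℝ) * δ) (b + ((n : ℝ) + 1) * δ), g y = m * y + q

namespace Macro

lemma vol_local_diam {A : Set ℝ} {a b s d : ℝ} (hab : a ≤ b) (hs : 0 < s) (hd : 0 ≤ d)
    (hA : A ⊆ Icc a b) (h : ∀ x ∈ A, ∀ y ∈ A, |x - y| ≤ s → |x - y| ≤ d) :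
    volume A ≤ ENNReal.ofReal (((b - a) / s + 1) * d) := by
  set N : ℕ := ⌊(b - a) / s⌋₊ + 1 with hN
  have hcov : A ⊆ ⋃ i ∈ Finset.range N, A ∩ Icc (a + i * s) (a + (i + 1) * s) := by
    intro x hx
    have hx' := hA hx
    have h0 : 0 ≤ (x - a) / s := div_nonneg (by linarith [hx'.1]) hs.le
    simp only [mem_iUnion, Finset.mem_range]
    refine ⟨⌊(x - a) / s⌋₊, ?_, hx, ?_, ?_⟩
    · rw [hN]
      apply Nat.lt_succ_of_le
      apply Nat.floor_le_floor
      gcongr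
      exact hx'.2
    · have := Nat.floor_le h0
      rw [le_div_iff₀ hs] at this
      linarith
    · have := (Nat.lt_floor_add_one ((x - a) / s)).le
      rw [div_le_iff₀ hs] at this
      linarith
  have hone : ∀ i : ℕ, volume (A ∩ Icc (a + i * s) (a + (i + 1) * s)) ≤ ENNReal.ofReal d := by
    intro i
    refine (Real.volume_le_diam _).trans ?_
    apply Metric.ediam_le
    intro x hx y hy
    rw [edist_dist]
    apply ENNReal.ofReal_le_ofReal
    rw [Real.dist_eq]
    apply h x hx.1 y hy.1
    rw [abs_le]
    constructor <;> nlinarith [hx.2.1, hx.2.2, hy.2.1, hy.2.2]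
  calc volume A ≤ volume (⋃ i ∈ Finset.range N, A ∩ Icc (a + i * s) (a + (i + 1) * s)) :=
        measure_mono hcov
    _ ≤ ∑ i ∈ Finset.range N, volume (A ∩ Icc (a + i * s) (a + (i + 1) * s)) :=
        measure_biUnion_finset_le _ _
    _ ≤ ∑ i ∈ Finset.range N, ENNReal.ofReal d := Finset.sum_le_sum fun i _ => hone i
    _ = ENNReal.ofReal (N * d) := by
        rw [Finset.sum_const, Finset.card_range, nsmul_eq_mul, ENNReal.ofReal_mul (by positivity)]
        simp
    _ ≤ _ := by
        apply ENNReal.ofReal_le_ofReal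
        apply mul_le_mul_of_nonneg_right _ hd
        rw [hN]
        push_cast
        have := Nat.floor_le (show 0 ≤ (b - a) / s from div_nonneg (by linarith) hs.le)
        linarith

/-- Two points at distance at most `s` of a sublevel set with large derivative are very close. -/
lemma close_of_deriv {g g' : ℝ → ℝ} {I : Set ℝ} (hI : Convex ℝ I) {M η ε s x y : ℝ}
    (hg : ∀ t ∈ I, HasDerivWithinAt g (g' t) I t)
    (hL : ∀ t ∈ I, ∀ t' ∈ I, |g' t - g' t'| ≤ M * |t - t'|)
    (hη : 0 < η) (hM : 0 ≤ M) (hs : M * s ≤ η / 2)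
    (hx : x ∈ I) (hy : y ∈ I) (hxy : |x - y| ≤ s) (hgx : |g x| ≤ ε) (hgy : |g y| ≤ ε)
    (hgx' : η ≤ |g' x|) : |x - y| ≤ 4 * ε / η := by
  -- mean value comparison
  have key : |(g y - g' x * y) - (g x - g' x * x)| ≤ (η / 2) * |y - x| := by
    have hseg : segment ℝ x y ⊆ I := hI.segment_subset hx hy
    have := (convex_segment x y).norm_image_sub_le_of_norm_hasDerivWithin_le
      (f := fun t => g t - g' x * t) (f' := fun t => g' t - g' x) (C := η / 2)
      (s := segment ℝ x y) (x := x) (y := y)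
      (fun t ht => by
        have h1 := (hg t (hseg ht)).mono hseg
        have h2 : HasDerivWithinAt (fun t => g' x * t) (g' x) (segment ℝ x y) t := by
          simpa using ((hasDerivAt_id t).const_mul (g' x)).hasDerivWithinAt
        exact h1.sub h2)
      (fun t ht => by
        rw [Real.norm_eq_abs]
        refine (hL t (hseg ht) x hx).trans (le_trans ?_ hs)
        apply mul_le_mul_of_nonneg_left _ hM
        refine le_trans ?_ hxy
        rw [segment_eq_uIcc] at ht
        rw [abs_sub_comm x y]
        exact abs_sub_left_of_mem_uIcc ht)
      (left_mem_segment ℝ x y) (right_mem_segment ℝ x y)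
    simpa [Real.norm_eq_abs] using this
  have h2 : |g' x| * |x - y| ≤ 2 * ε + η / 2 * |x - y| := by
    rw [← abs_mul, abs_sub_comm y x] at *
    have : g' x * (x - y) = ((g y - g' x * y) - (g x - g' x * x)) - g y + g x := by ring
    rw [this]
    calc _ ≤ |(g y - g' x * y) - (g x - g' x * x)| + |g y| + |g x| := by
          refine (abs_add_le _ _).trans ?_
          gcongr
          exact abs_sub _ _
      _ ≤ _ := by linarith
  rw [le_div_iff₀ hη]
  nlinarith [abs_nonneg (x - y)]

/-- One dimensional sublevel set bound. -/
lemma sublevel_one (k : ℕ) : ∀ (M c h : ℝ), 0 < M → 0 < c → 0 < h → ∃ C α : ℝ, 0 < C ∧ 0 < α ∧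
    ∀ G : ℕ → ℝ → ℝ, (∀ i ≤ k, ∀ t ∈ Icc (-h) h, HasDerivAt (G i) (G (i + 1) t) t) →
    (∀ i ≤ k + 1, ∀ t ∈ Icc (-h) h, |G i t| ≤ M) → (∀ t ∈ Icc (-h) h, c ≤ |G k t|) →
    ∀ η : ℝ, 0 < η → η ≤ 1 →
      volume {t ∈ Icc (-h) h | |G 0 t| < η} ≤ ENNReal.ofReal (C * η ^ α) := by
  induction k with
  | zero =>
    intro M c h hM hc hh
    refine ⟨2 * h / c, 1, by positivity, one_pos, ?_⟩
    intro G _ _ hG η hη _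
    by_cases hηc : η ≤ c
    · have : {t ∈ Icc (-h) h | |G 0 t| < η} = ∅ := by
        ext t
        simp only [mem_setOf_eq, mem_empty_iff_false, iff_false, not_and, not_lt]
        intro ht
        exact hηc.trans (hG t ht)
      rw [this]; simp
    · push Not at hηc
      calc volume {t ∈ Icc (-h) h | |G 0 t| < η} ≤ volume (Icc (-h) h) :=
            measure_mono (fun t ht => ht.1)
        _ = ENNReal.ofReal (h - -h) := Real.volume_Icc
        _ ≤ _ := by
          apply ENNReal.ofReal_le_ofReal
          rw [Real.rpow_one, div_mul_eq_mul_div, le_div_iff₀ hc]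
          nlinarith
  | succ k ih =>
    intro M c h hM hc hh
    obtain ⟨C, α, hC, hα, H⟩ := ih M c h hM hc hh
    refine ⟨C + (4 * h * M + 1) * 4, min (α / 4) (1 / 2), by positivity, by positivity, ?_⟩
    intro G hd hb hk η hη hη1
    have h1 := H (fun i => G (i + 1)) (fun i hi => hd (i + 1) (by omega))
      (fun i hi => hb (i + 1) (by omega)) hk (η ^ (1 / 4 : ℝ)) (by positivity)
      (Real.rpow_le_one hη.le hη1 (by norm_num))
    have h2 : volume {t ∈ Icc (-h) h | |G 0 t| < η ∧ η ^ (1 / 4 : ℝ) ≤ |G 1 t|} ≤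
        ENNReal.ofReal ((((h - -h) / (η ^ (1 / 4 : ℝ) / (2 * M))) + 1) *
          (4 * η / η ^ (1 / 4 : ℝ))) := by
      apply vol_local_diam (by linarith) (by positivity) (by positivity)
      · exact fun t ht => ht.1
      · intro x hx y hy hxy
        refine close_of_deriv (g := G 0) (g' := G 1) (I := Icc (-h) h) (convex_Icc _ _) (M := M)
          (fun t ht => (hd 0 (by omega) t ht).hasDerivWithinAt) ?_ (by positivity) hM.le ?_
          hx.1 hy.1 hxy hx.2.1.le hy.2.1.le hx.2.2
        · intro t ht t' ht'
          have := (convex_Icc (-h) h).norm_image_sub_le_of_norm_hasDerivWithin_le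
            (f := G 1) (f' := G 2) (C := M) (x := t') (y := t)
            (fun t ht => (hd 1 (by omega) t ht).hasDerivWithinAt)
            (fun t ht => hb 2 (by omega) t ht) ht' ht
          simpa [Real.norm_eq_abs] using this
        · field_simp; rfl
    have hsub : {t ∈ Icc (-h) h | |G 0 t| < η} ⊆
        {t ∈ Icc (-h) h | |G 1 t| < η ^ (1 / 4 : ℝ)} ∪
        {t ∈ Icc (-h) h | |G 0 t| < η ∧ η ^ (1 / 4 : ℝ) ≤ |G 1 t|} := by
      intro t ht
      by_cases hc : |G 1 t| < η ^ (1 / 4 : ℝ)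
      · exact Or.inl ⟨ht.1, hc⟩
      · exact Or.inr ⟨ht.1, ht.2, not_lt.1 hc⟩
    refine (measure_mono hsub).trans ((measure_union_le _ _).trans ((add_le_add h1 h2).trans ?_))
    rw [← ENNReal.ofReal_add (by positivity)
      (mul_nonneg (add_nonneg (div_nonneg (by linarith) (by positivity)) zero_le_one)
        (by positivity))]
    apply ENNReal.ofReal_le_ofReal
    rw [add_mul]
    have e1 : (η ^ (1 / 4 : ℝ)) ^ α ≤ η ^ min (α / 4) (1 / 2) := by
      rw [← Real.rpow_mul hη.le]
      apply Real.rpow_le_rpow_of_exponent_ge hη hη1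
      refine (min_le_left _ _).trans (by linarith)
    have e2 : η ^ (1 / 2 : ℝ) ≤ η ^ min (α / 4) (1 / 2) :=
      Real.rpow_le_rpow_of_exponent_ge hη hη1 (min_le_right _ _)
    set q := η ^ (1 / 4 : ℝ) with hq
    have hq0 : 0 < q := by positivity
    have hq1 : q ≤ 1 := Real.rpow_le_one hη.le hη1 (by norm_num)
    have hq4 : η = q ^ 4 := by
      rw [hq, ← Real.rpow_natCast, ← Real.rpow_mul hη.le]; norm_num
    have hq2 : η ^ (1 / 2 : ℝ) = q ^ 2 := by
      rw [hq, ← Real.rpow_natCast, ← Real.rpow_mul hη.le]; norm_num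
    rw [hq2] at e2
    have e3 : ((h - -h) / (q / (2 * M)) + 1) * (4 * η / q) ≤ (4 * h * M + 1) * 4 * q ^ 2 := by
      rw [hq4]
      have : ((h - -h) / (q / (2 * M)) + 1) * (4 * q ^ 4 / q) = (4 * h * M + q) * 4 * q ^ 2 := by
        field_simp; ring
      rw [this]; gcongr
    have e4 : (4 * h * M + 1) * 4 * q ^ 2 ≤ (4 * h * M + 1) * 4 * η ^ min (α / 4) (1 / 2) := by
      gcongr
    have e5 := mul_le_mul_of_nonneg_left e1 hC.le
    linarith

end Macro

namespace Macro

section SL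
open Topology Filter
variable {V : Type*} [NormedAddCommGroup V] [NormedSpace ℝ V]

/-- Iterated directional derivatives. -/
def dirD (G : V → ℝ) (v : V) : ℕ → V → ℝ
  | 0 => G
  | (i + 1) => fun x => fderiv ℝ (dirD G v i) x v

lemma dirD_analytic {G : V → ℝ} {s : Set V} (hG : AnalyticOnNhd ℝ G s) (v : V) (i : ℕ) :
    AnalyticOnNhd ℝ (dirD G v i) s := by
  induction i with
  | zero => exact hG
  | succ i ih =>
    intro x hx
    exact ((ContinuousLinearMap.apply ℝ ℝ v).analyticAt _).comp (ih x hx).fderiv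

lemma dirD_eq {G : V → ℝ} {s : Set V} (hs : IsOpen s) (hG : AnalyticOnNhd ℝ G s) (v : V)
    (i : ℕ) : ∀ x ∈ s, iteratedFDeriv ℝ i G x (fun _ => v) = dirD G v i x := by
  induction i with
  | zero => intro x _; simp [dirD]
  | succ i ih =>
    intro x hx
    rw [iteratedFDeriv_succ_apply_left]
    have hev : (fun y => iteratedFDeriv ℝ i G y (fun _ => v)) =ᶠ[𝓝 x] dirD G v i := by
      filter_upwards [hs.mem_nhds hx] with y hy using ih y hy
    have hdiff : DifferentiableAt ℝ (iteratedFDeriv ℝ i G) x :=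
      (hG.iteratedFDeriv i x hx).differentiableAt
    have h2 := hdiff.hasFDerivAt.continuousMultilinear_apply_const (fun _ : Fin i => v)
    show _ = fderiv ℝ (dirD G v i) x v
    rw [← hev.fderiv_eq, h2.fderiv]
    simp [Fin.tail_def]

lemma exists_dirD_ne {G : V → ℝ} {x0 : V} (hG : AnalyticAt ℝ G x0)
    (hne : ¬ ∀ᶠ x in 𝓝 x0, G x = 0) : ∃ v k, dirD G v k x0 ≠ 0 := by
  by_contra! hcon
  apply hne
  obtain ⟨s, hs, hsG⟩ := hG.exists_mem_nhds_analyticOnNhd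
  obtain ⟨p, R, hp⟩ := hG
  obtain ⟨R', hR', hball⟩ : ∃ R' > 0, Metric.ball x0 R' ⊆ s := Metric.mem_nhds_iff.1 hs
  have hzero : ∀ v n, p n (fun _ => v) = 0 := by
    intro v n
    have := hp.factorial_smul v n
    rw [dirD_eq Metric.isOpen_ball (hsG.mono hball) v n x0 (Metric.mem_ball_self hR'),
      hcon] at this
    simpa [Nat.factorial_ne_zero] using this
  filter_upwards [Metric.eball_mem_nhds x0 hp.r_pos] with x hx
  have hx' : x - x0 ∈ Metric.eball (0 : V) R := by
    simpa [edist_eq_enorm_sub] using hx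
  have := hp.hasSum hx'
  simp only [hzero, add_sub_cancel] at this
  exact this.unique hasSum_zero

variable [FiniteDimensional ℝ V] [MeasurableSpace V] [BorelSpace V]

lemma sublevel_local (μ : Measure V) [μ.IsAddHaarMeasure] {G : V → ℝ} {x0 : V}
    (hG : AnalyticAt ℝ G x0) (hne : ¬ ∀ᶠ x in 𝓝 x0, G x = 0) :
    ∃ C α : ℝ, 0 < C ∧ 0 < α ∧ ∃ U ∈ 𝓝 x0, ∀ η : ℝ, 0 < η → η ≤ 1 →
      μ {x ∈ U | |G x| < η} ≤ ENNReal.ofReal (C * η ^ α) := by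
  obtain ⟨v, k, hk⟩ := exists_dirD_ne hG hne
  obtain ⟨s, hs, hsG⟩ := hG.exists_mem_nhds_analyticOnNhd
  have hcont : ∀ i, ContinuousAt (dirD G v i) x0 := fun i =>
    (dirD_analytic hsG v i x0 (mem_of_mem_nhds hs)).continuousAt
  set c := |dirD G v k x0| / 2 with hc
  have hc0 : 0 < c := by positivity
  have hev1 : ∀ᶠ x in 𝓝 x0, c < |dirD G v k x| :=
    (hcont k).abs.eventually_const_lt (by rw [hc]; linarith [abs_pos.2 hk])
  set M : ℝ := ∑ i ∈ Finset.range (k + 2), |dirD G v i x0| + 1 with hM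
  have hM0 : 0 < M := by positivity
  have hev2 : ∀ᶠ x in 𝓝 x0, ∀ i ∈ Finset.range (k + 2), |dirD G v i x| < M := by
    rw [Filter.eventually_all_finset]
    intro i hi
    apply (hcont i).abs.eventually_lt_const
    rw [hM]
    have := Finset.single_le_sum (f := fun i => |dirD G v i x0|) (fun _ _ => abs_nonneg _) hi
    linarith
  obtain ⟨R, hR, hball⟩ := Metric.eventually_nhds_iff_ball.1
    ((hev1.and hev2).and (Filter.eventually_mem_set.2 hs))
  set h : ℝ := R / 4 / (‖v‖ + 1) with hh
  have hv1 : 0 < ‖v‖ + 1 := by positivity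
  have hh0 : 0 < h := by positivity
  have hhv : ∀ t ∈ Icc (-h) h, ‖t • v‖ ≤ R / 4 := by
    intro t ht
    rw [norm_smul, Real.norm_eq_abs]
    calc |t| * ‖v‖ ≤ h * (‖v‖ + 1) := by
          gcongr
          · exact abs_le.2 ht
          · linarith
      _ = R / 4 := by rw [hh]; field_simp
  obtain ⟨C, α, hC, hα, H⟩ := sublevel_one k M c h hM0 hc0 hh0
  set m : ℝ := (μ (Metric.ball x0 R)).toReal with hm
  have hmfin : μ (Metric.ball x0 R) ≠ ⊤ := measure_ball_lt_top.ne
  refine ⟨(m + 1) * C / (2 * h), α, by positivity, hα, Metric.ball x0 (R / 4),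
    Metric.ball_mem_nhds _ (by positivity), ?_⟩
  intro η hη hη1
  set A := {x ∈ Metric.ball x0 (R / 4) | |G x| < η} with hA
  have hGc : ContinuousOn G (Metric.ball x0 (R / 4)) := fun x hx =>
    (hsG x (hball x (Metric.ball_subset_ball (by linarith) hx)).2).continuousAt.continuousWithinAt
  have hAo : IsOpen A := hGc.abs.isOpen_inter_preimage Metric.isOpen_ball isOpen_Iio
  -- product set
  set T : Set (V × ℝ) := {q | q.2 ∈ Icc (-h) h ∧ q.1 + q.2 • v ∈ A} with hT
  have hTm : MeasurableSet T := by
    apply MeasurableSet.inter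
    · exact measurable_snd measurableSet_Icc
    · exact (by fun_prop : Continuous fun q : V × ℝ => q.1 + q.2 • v).measurable hAo.measurableSet
  have e1 : (μ.prod volume) T = μ A * ENNReal.ofReal (2 * h) := by
    rw [Measure.prod_apply_symm hTm]
    have : ∀ t : ℝ, μ ((fun x => (x, t)) ⁻¹' T) = (Icc (-h) h).indicator (fun _ => μ A) t := by
      intro t
      by_cases ht : t ∈ Icc (-h) h
      · rw [indicator_of_mem ht, ← measure_preimage_add_right μ (t • v) A]
        congr 1
        ext x
        simp only [hT, mem_preimage, mem_ofPred_eq]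
        exact ⟨fun q => q.2, fun q => ⟨ht, q⟩⟩
      · rw [indicator_of_notMem ht]
        convert measure_empty (μ := μ)
        ext x
        simp only [hT, mem_preimage, mem_ofPred_eq, mem_empty_iff_false, iff_false]
        exact fun q => ht q.1
    simp_rw [this]
    rw [lintegral_indicator measurableSet_Icc, setLIntegral_const, Real.volume_Icc]
    congr 2; ring
  have e2 : (μ.prod volume) T ≤ ENNReal.ofReal (C * η ^ α) * μ (Metric.ball x0 R) := by
    rw [Measure.prod_apply hTm]
    have : ∀ x, volume (Prod.mk x ⁻¹' T) ≤
        (Metric.ball x0 R).indicator (fun _ => ENNReal.ofReal (C * η ^ α)) x := by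
      intro x
      rcases (Prod.mk x ⁻¹' T).eq_empty_or_nonempty with hemp | ⟨t1, ht1⟩
      · rw [hemp]; simp
      have hx : ‖x - x0‖ < R / 2 := by
        have := ht1.2.1
        rw [mem_ball_iff_norm] at this
        calc ‖x - x0‖ = ‖(x + t1 • v - x0) - t1 • v‖ := by congr 1; abel
          _ ≤ ‖x + t1 • v - x0‖ + ‖t1 • v‖ := norm_sub_le _ _
          _ < _ := by
            have := hhv t1 ht1.1
            simp only at *
            linarith
      have hmem : ∀ t ∈ Icc (-h) h, x + t • v ∈ Metric.ball x0 R := by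
        intro t ht
        rw [mem_ball_iff_norm]
        calc ‖x + t • v - x0‖ = ‖(x - x0) + t • v‖ := by congr 1; abel
          _ ≤ ‖x - x0‖ + ‖t • v‖ := norm_add_le _ _
          _ < _ := by linarith [hhv t ht]
      have hxb : x ∈ Metric.ball x0 R := by rw [mem_ball_iff_norm]; linarith
      rw [indicator_of_mem hxb]
      refine le_trans (measure_mono ?_) (H (fun i t => dirD G v i (x + t • v)) ?_ ?_ ?_ η hη hη1)
      · intro t ht
        exact ⟨ht.1, ht.2.2⟩
      · intro i _ t ht
        have hd : HasFDerivAt (dirD G v i) (fderiv ℝ (dirD G v i) (x + t • v)) (x + t • v) :=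
          (dirD_analytic hsG v i _ (hball _ (hmem t ht)).2).differentiableAt.hasFDerivAt
        have hl : HasDerivAt (fun t : ℝ => x + t • v) v t := by
          simpa using ((hasDerivAt_id t).smul_const v).const_add x
        exact hd.comp_hasDerivAt t hl
      · intro i hi t ht
        exact ((hball _ (hmem t ht)).1.2 i (Finset.mem_range.2 (by omega))).le
      · intro t ht
        exact (hball _ (hmem t ht)).1.1.le
    refine (lintegral_mono this).trans ?_
    rw [lintegral_indicator Metric.isOpen_ball.measurableSet, setLIntegral_const]
  rw [e1] at e2
  have hmE : μ (Metric.ball x0 R) = ENNReal.ofReal m := by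
    rw [hm, ENNReal.ofReal_toReal hmfin]
  have hm0 : 0 ≤ m := ENNReal.toReal_nonneg
  rw [hmE, ← ENNReal.ofReal_mul (by positivity)] at e2
  rw [← ENNReal.le_div_iff_mul_le (by left; simpa using hh0) (by left; exact ENNReal.ofReal_ne_top),
    ← ENNReal.ofReal_div_of_pos (by positivity)] at e2
  refine e2.trans (ENNReal.ofReal_le_ofReal ?_)
  have hp : 0 ≤ C * η ^ α := by positivity
  rw [div_mul_eq_mul_div]
  gcongr ?_ / _
  nlinarith

lemma sublevel_compact (μ : Measure V) [μ.IsAddHaarMeasure] {G : V → ℝ} {K : Set V}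
    (hK : IsCompact K) (hKc : IsPreconnected K) (hG : AnalyticOnNhd ℝ G K)
    (hne : ∃ x ∈ K, G x ≠ 0) :
    ∃ C α : ℝ, 0 < C ∧ 0 < α ∧ ∀ η : ℝ, 0 < η → η ≤ 1 →
      μ {x ∈ K | |G x| < η} ≤ ENNReal.ofReal (C * η ^ α) := by
  obtain ⟨x1, hx1, hGx1⟩ := hne
  have hloc : ∀ x ∈ K, ¬ ∀ᶠ y in 𝓝 x, G y = 0 := by
    intro x hx hcon
    exact hGx1 (hG.eqOn_zero_of_preconnected_of_eventuallyEq_zero hKc hx hcon hx1)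
  have hP := hK.induction_on (p := fun s => ∃ C α : ℝ, 0 < C ∧ 0 < α ∧ ∀ η : ℝ, 0 < η → η ≤ 1 →
      μ {x ∈ s | |G x| < η} ≤ ENNReal.ofReal (C * η ^ α))
    ⟨1, 1, one_pos, one_pos, by simp⟩
    (by
      rintro s t hst ⟨C, α, hC, hα, H⟩
      exact ⟨C, α, hC, hα, fun η h0 h1 =>
        (measure_mono (show {x ∈ s | |G x| < η} ⊆ {x ∈ t | |G x| < η} from
          fun x hx => ⟨hst hx.1, hx.2⟩)).trans (H η h0 h1)⟩)
    (by
      rintro s t ⟨C, α, hC, hα, H⟩ ⟨C', α', hC', hα', H'⟩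
      refine ⟨C + C', min α α', by positivity, by positivity, fun η h0 h1 => ?_⟩
      have : {x ∈ s ∪ t | |G x| < η} ⊆ {x ∈ s | |G x| < η} ∪ {x ∈ t | |G x| < η} := by
        rintro x ⟨hx | hx, h⟩
        · exact Or.inl ⟨hx, h⟩
        · exact Or.inr ⟨hx, h⟩
      refine (measure_mono this).trans ((measure_union_le _ _).trans
        ((add_le_add (H η h0 h1) (H' η h0 h1)).trans ?_))
      rw [← ENNReal.ofReal_add (by positivity) (by positivity)]
      apply ENNReal.ofReal_le_ofReal
      rw [add_mul]
      gcongr ?_ * ?_ + ?_ * ?_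
      · exact Real.rpow_le_rpow_of_exponent_ge h0 h1 (min_le_left _ _)
      · exact Real.rpow_le_rpow_of_exponent_ge h0 h1 (min_le_right _ _))
    (by
      intro x hx
      obtain ⟨C, α, hC, hα, U, hU, H⟩ := sublevel_local μ (hG x hx) (hloc x hx)
      exact ⟨U, mem_nhdsWithin_of_mem_nhds hU, C, α, hC, hα, H⟩)
  exact hP

end SL
end Macro

namespace Macro

lemma fiber_cheb {P Q : Type*} [MeasurableSpace P] [MeasurableSpace Q] (μ : Measure P)
    (ν : Measure Q) [SFinite ν] {KP : Set P} {KQ : Set Q} {A lam : ℝ} (hA : 0 < A) (hlam : 0 < lam)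
    (hKPm : MeasurableSet KP)
    (hKP : μ KP ≤ ENNReal.ofReal A) (hKQ : ν KQ ≤ ENNReal.ofReal A) {E : Set (P × Q)}
    (hE : MeasurableSet E) (hEsub : E ⊆ KP ×ˢ KQ)
    (hEl : ENNReal.ofReal lam ≤ (μ.prod ν) E) :
    ENNReal.ofReal (lam / (2 * A)) ≤
      μ {p | ENNReal.ofReal (lam / (2 * A)) ≤ ν (Prod.mk p ⁻¹' E)} := by
  set P0 := {p | ENNReal.ofReal (lam / (2 * A)) ≤ ν (Prod.mk p ⁻¹' E)} with hP0
  have hP0m : MeasurableSet P0 := measurableSet_le measurable_const (measurable_measure_prodMk_left hE)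
  have hpt : ∀ p, ν (Prod.mk p ⁻¹' E) ≤ P0.indicator (fun _ => ENNReal.ofReal A) p +
      KP.indicator (fun _ => ENNReal.ofReal (lam / (2 * A))) p := by
    intro p
    by_cases hp : p ∈ P0
    · rw [indicator_of_mem hp]
      refine le_trans ?_ le_self_add
      exact (measure_mono (show Prod.mk p ⁻¹' E ⊆ KQ from fun s hs => (hEsub hs).2)).trans hKQ
    · by_cases hpK : p ∈ KP
      · rw [indicator_of_mem hpK]
        refine le_trans ?_ le_add_self
        exact (not_le.1 hp).le
      · have : Prod.mk p ⁻¹' E = ∅ := by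
          ext s
          simp only [mem_preimage, mem_empty_iff_false, iff_false]
          exact fun h => hpK (hEsub h).1
        rw [this]; simp
  rw [Measure.prod_apply hE] at hEl
  have h1 := hEl.trans (lintegral_mono hpt)
  rw [lintegral_add_left (measurable_const.indicator hP0m), lintegral_indicator hP0m,
    lintegral_indicator hKPm, setLIntegral_const, setLIntegral_const] at h1
  have h2 : ENNReal.ofReal (lam / (2 * A)) * μ KP ≤ ENNReal.ofReal (lam / 2) := by
    calc _ ≤ ENNReal.ofReal (lam / (2 * A)) * ENNReal.ofReal A := by gcongr
      _ = ENNReal.ofReal (lam / 2) := by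
        rw [← ENNReal.ofReal_mul (by positivity)]; congr 1; field_simp
  have h3 : ENNReal.ofReal (lam / 2) + ENNReal.ofReal (lam / 2) ≤
      ENNReal.ofReal A * μ P0 + ENNReal.ofReal (lam / 2) := by
    rw [← ENNReal.ofReal_add (by positivity) (by positivity)]
    refine le_trans (by simp) (h1.trans (by gcongr))
  have h4 := (ENNReal.add_le_add_iff_right ENNReal.ofReal_ne_top).1 h3
  rw [show lam / (2 * A) = (lam / 2) / A by field_simp, ENNReal.ofReal_div_of_pos hA]
  exact ENNReal.div_le_of_le_mul (by rwa [mul_comm])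

/-- Gram matrix of a family of vectors. -/
def gramM {d r : ℕ} (ℓ : Fin r → Fin d → ℝ) : Matrix (Fin r) (Fin r) ℝ :=
  Matrix.of fun i j => ℓ i ⬝ᵥ ℓ j

lemma gramM_mulVec {d r : ℕ} (ℓ : Fin r → Fin d → ℝ) (c : Fin r → ℝ) (i : Fin r) :
    (gramM ℓ).mulVec c i = ℓ i ⬝ᵥ ∑ j, c j • ℓ j := by
  rw [dotProduct_sum]
  simp only [gramM, Matrix.mulVec, dotProduct_smul, smul_eq_mul]
  show ∑ j, (ℓ i ⬝ᵥ ℓ j) * c j = _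
  exact Finset.sum_congr rfl fun j _ => mul_comm _ _

lemma gramM_det_ne {d r : ℕ} (ℓ : Fin r → Fin d → ℝ) :
    (gramM ℓ).det ≠ 0 ↔ LinearIndependent ℝ ℓ := by
  constructor
  · intro h
    rw [Fintype.linearIndependent_iff]
    intro c hc
    have : (gramM ℓ).mulVec c = 0 := by
      ext i; rw [gramM_mulVec, hc]; simp
    exact fun i => congrFun (Matrix.eq_zero_of_mulVec_eq_zero h this) i
  · intro h hdet
    obtain ⟨c, hc0, hc⟩ := Matrix.exists_mulVec_eq_zero_iff.2 hdet
    apply hc0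
    have h0 : (∑ j, c j • ℓ j) ⬝ᵥ (∑ j, c j • ℓ j) = 0 := by
      conv_lhs => rw [sum_dotProduct]
      apply Finset.sum_eq_zero
      intro i _
      rw [smul_dotProduct, ← gramM_mulVec, hc]; simp
    rw [dotProduct_self_eq_zero] at h0
    ext i
    exact (Fintype.linearIndependent_iff.1 h) c h0 i

lemma gramM_solve {d r : ℕ} (ℓ : Fin r → Fin d → ℝ) (m θ : Fin d → ℝ)
    (hdet : (gramM ℓ).det ≠ 0)
    (hann : ∀ θ, (∀ i, ℓ i ⬝ᵥ θ = 0) → m ⬝ᵥ θ = 0) :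
    (gramM ℓ).det * (m ⬝ᵥ θ) =
      ∑ i, ((gramM ℓ).adjugate.mulVec (fun i => ℓ i ⬝ᵥ m)) i * (ℓ i ⬝ᵥ θ) := by
  set c := (gramM ℓ).adjugate.mulVec (fun i => ℓ i ⬝ᵥ m) with hc
  set w := (gramM ℓ).det • m - ∑ i, c i • ℓ i with hw
  have h1 : ∀ i, ℓ i ⬝ᵥ w = 0 := by
    intro i
    rw [hw, dotProduct_sub, ← gramM_mulVec, hc, Matrix.mulVec_mulVec, Matrix.mul_adjugate,
      Matrix.smul_mulVec, Matrix.one_mulVec]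
    simp
  have h2 : w ⬝ᵥ w = 0 := by
    conv_lhs => rw [hw, sub_dotProduct, smul_dotProduct, ← hw, hann w h1, sum_dotProduct]
    simp [smul_dotProduct, h1]
  rw [dotProduct_self_eq_zero] at h2
  have h3 : (gramM ℓ).det • m = ∑ i, c i • ℓ i := sub_eq_zero.1 h2
  rw [← smul_eq_mul, ← smul_dotProduct, h3, sum_dotProduct]
  simp [smul_dotProduct]

variable {P Q : Type*} [NormedAddCommGroup P] [NormedSpace ℝ P] [FiniteDimensional ℝ P]
  [MeasurableSpace P] [BorelSpace P] [NormedAddCommGroup Q] [NormedSpace ℝ Q]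
  [FiniteDimensional ℝ Q] [MeasurableSpace Q] [BorelSpace Q]

lemma gen_rank (μ : Measure P) [μ.IsAddHaarMeasure] (ν : Measure Q) [ν.IsAddHaarMeasure]
    {d : ℕ} {KP : Set P} {KQ : Set Q} (hKP : IsCompact KP) (hKPc : IsPreconnected KP)
    (hKQ : IsCompact KQ) (hKQc : IsPreconnected KQ) (ℓ m : P → Q → Fin d → ℝ)
    (hℓ : ∀ k, AnalyticOnNhd ℝ (fun w : P × Q => ℓ w.1 w.2 k) (KP ×ˢ KQ))
    (hm : ∀ k, AnalyticOnNhd ℝ (fun w : P × Q => m w.1 w.2 k) (KP ×ˢ KQ))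
    (hann : ∀ p ∈ KP, ∀ θ : Fin d → ℝ, (∀ s ∈ KQ, ℓ p s ⬝ᵥ θ = 0) → ∀ s ∈ KQ, m p s ⬝ᵥ θ = 0) :
    ∃ C N : ℝ, 0 < C ∧ 0 < N ∧ ∀ lam : ℝ, 0 < lam → lam ≤ 1 → ∀ E : Set (P × Q), MeasurableSet E →
      E ⊆ KP ×ˢ KQ → ENNReal.ofReal lam ≤ (μ.prod ν) E → ∀ θ : P → Fin d → ℝ, ∀ η : ℝ, 0 ≤ η →
      (∀ w ∈ E, |ℓ w.1 w.2 ⬝ᵥ θ w.1| ≤ η) →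
      ∃ w ∈ E, |m w.1 w.2 ⬝ᵥ θ w.1| ≤ C * η * lam ^ (-N) := by
  have : SecondCountableTopology P := secondCountable_of_proper
  have : SecondCountableTopology Q := secondCountable_of_proper
  rcases KP.eq_empty_or_nonempty with hemp | ⟨pe, hpe⟩
  · refine ⟨1, 1, one_pos, one_pos, ?_⟩
    intro lam hl _ E _ hE hEl
    have : E = ∅ := by
      rw [hemp, empty_prod] at hE; exact subset_empty_iff.1 hE
    rw [this] at hEl
    simp at hEl
    linarith
  -- maximal rank
  let R : ℕ → Prop := fun n => ∃ p ∈ KP, ∃ s : Fin n → Q, (∀ i, s i ∈ KQ) ∧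
    LinearIndependent ℝ (fun i => ℓ p (s i))
  have hR0 : R 0 := ⟨pe, hpe, Fin.elim0, fun i => i.elim0, linearIndependent_empty_type⟩
  have hRb : ∀ n, R n → n ≤ d := by
    rintro n ⟨p, _, s, _, h⟩
    have := h.fintype_card_le_finrank
    simpa using this
  classical
  set r := Nat.findGreatest R d with hr
  have hRr : R r := Nat.findGreatest_spec (Nat.zero_le d) hR0
  have hRmax : ¬ R (r + 1) := fun h =>
    Nat.findGreatest_is_greatest (P := R) (Nat.lt_succ_self r) (hRb _ h) h
  set G : P × (Fin r → Q) → ℝ := fun w => (gramM fun i => ℓ w.1 (w.2 i)).det with hG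
  set KK : Set (P × (Fin r → Q)) := KP ×ˢ (Set.pi univ fun _ => KQ) with hKK
  have hKKcomp : IsCompact KK := hKP.prod (isCompact_univ_pi fun _ => hKQ)
  have hKKc : IsPreconnected KK := hKPc.prod (isPreconnected_univ_pi fun _ => hKQc)
  have hcoord : ∀ i k, AnalyticOnNhd ℝ (fun w : P × (Fin r → Q) => ℓ w.1 (w.2 i) k) KK := by
    intro i k w hw
    have h1 := hℓ k (w.1, w.2 i) ⟨hw.1, hw.2 i (mem_univ _)⟩
    have h2 : AnalyticAt ℝ (fun w : P × (Fin r → Q) => (w.1, w.2 i)) w :=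
      analyticAt_fst.prod (((ContinuousLinearMap.proj (R := ℝ) (φ := fun _ : Fin r => Q) i).analyticAt _).comp
        analyticAt_snd)
    exact h1.comp_of_eq h2 rfl
  have hGan : AnalyticOnNhd ℝ G KK := by
    intro w hw
    simp only [hG, Matrix.det_apply, gramM, Matrix.of_apply, dotProduct]
    apply Finset.analyticAt_fun_sum
    intro σ _
    apply AnalyticAt.const_smul
    apply Finset.analyticAt_fun_prod
    intro i _
    apply Finset.analyticAt_fun_sum
    intro k _
    exact (hcoord _ k w hw).mul (hcoord _ k w hw)
  have hGne : ∃ w ∈ KK, G w ≠ 0 := by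
    obtain ⟨p, hp, s, hs, hli⟩ := hRr
    exact ⟨(p, s), ⟨hp, fun i _ => hs i⟩, (gramM_det_ne _).2 hli⟩
  have hpiH : (Measure.pi fun _ : Fin r => ν).IsAddHaarMeasure := Measure.pi.isAddHaarMeasure _
  have hprH : (μ.prod (Measure.pi fun _ : Fin r => ν)).IsAddHaarMeasure :=
    Measure.prod.instIsAddHaarMeasure _ _
  obtain ⟨C0, α, hC0, hα, hsub⟩ :=
    sublevel_compact (μ.prod (Measure.pi fun _ : Fin r => ν)) hKKcomp hKKc hGan hGne
  -- bound on coefficients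
  have hbd : ∃ B : ℝ, 0 < B ∧ ∀ w ∈ KK, ∀ s ∈ KQ, ∀ i,
      |((gramM fun i => ℓ w.1 (w.2 i)).adjugate.mulVec (fun i => ℓ w.1 (w.2 i) ⬝ᵥ m w.1 s)) i|
        ≤ B := by
    have hc : ContinuousOn (fun q : (P × (Fin r → Q)) × Q =>
        ((gramM fun i => ℓ q.1.1 (q.1.2 i)).adjugate.mulVec
          (fun i => ℓ q.1.1 (q.1.2 i) ⬝ᵥ m q.1.1 q.2))) (KK ×ˢ KQ) := by
      have hcl : ∀ i k, ContinuousOn (fun q : (P × (Fin r → Q)) × Q => ℓ q.1.1 (q.1.2 i) k)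
          (KK ×ˢ KQ) := fun i k =>
        (hcoord i k).continuousOn.comp continuousOn_fst (fun q hq => hq.1)
      have hcm : ∀ k, ContinuousOn (fun q : (P × (Fin r → Q)) × Q => m q.1.1 q.2 k)
          (KK ×ˢ KQ) := fun k =>
        (hm k).continuousOn.comp (f := fun q : (P × (Fin r → Q)) × Q => (q.1.1, q.2))
          (by fun_prop) (fun q hq => ⟨hq.1.1, hq.2⟩)
      have hg : ContinuousOn (fun q : (P × (Fin r → Q)) × Q => gramM fun i => ℓ q.1.1 (q.1.2 i))
          (KK ×ˢ KQ) := by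
        apply continuousOn_pi.2
        intro i
        apply continuousOn_pi.2
        intro j
        simp only [gramM, Matrix.of_apply, dotProduct]
        exact continuousOn_finsetSum _ fun k _ => (hcl i k).fun_mul (hcl j k)
      have ha : ContinuousOn (fun q : (P × (Fin r → Q)) × Q =>
          (gramM fun i => ℓ q.1.1 (q.1.2 i)).adjugate) (KK ×ˢ KQ) :=
        (Continuous.matrix_adjugate continuous_id).comp_continuousOn hg
      apply continuousOn_pi.2
      intro i
      simp only [Matrix.mulVec, dotProduct]
      apply continuousOn_finsetSum
      intro j _
      apply ContinuousOn.fun_mul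
      · exact continuousOn_pi.1 (continuousOn_pi.1 ha i) j
      · exact continuousOn_finsetSum _ fun k _ => (hcl j k).fun_mul (hcm k)
    obtain ⟨B, hB⟩ := (hKKcomp.prod hKQ).exists_bound_of_continuousOn hc
    refine ⟨max B 1, by positivity, fun w hw s hs i => ?_⟩
    have := hB (w, s) ⟨hw, hs⟩
    exact ((norm_le_pi_norm _ i).trans this).trans (le_max_left _ _)
  obtain ⟨B, hB0, hB⟩ := hbd
  obtain ⟨A, hA0, hAP, hAQ⟩ : ∃ A : ℝ, 1 ≤ A ∧ μ KP ≤ ENNReal.ofReal A ∧ ν KQ ≤ ENNReal.ofReal A := by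
    refine ⟨(μ KP).toReal + (ν KQ).toReal + 1, ?_, ?_, ?_⟩
    · linarith [ENNReal.toReal_nonneg (a := μ KP), ENNReal.toReal_nonneg (a := ν KQ)]
    · rw [← ENNReal.ofReal_toReal hKP.measure_lt_top.ne]
      apply ENNReal.ofReal_le_ofReal
      rw [ENNReal.toReal_ofReal ENNReal.toReal_nonneg]
      linarith [ENNReal.toReal_nonneg (a := μ KP), ENNReal.toReal_nonneg (a := ν KQ)]
    · rw [← ENNReal.ofReal_toReal hKQ.measure_lt_top.ne]
      apply ENNReal.ofReal_le_ofReal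
      rw [ENNReal.toReal_ofReal ENNReal.toReal_nonneg]
      linarith [ENNReal.toReal_nonneg (a := μ KP), ENNReal.toReal_nonneg (a := ν KQ)]
  set C1 := C0 + 1 with hC1
  -- the threshold
  refine ⟨(r + 1) * B * ((1 / (2 * A)) ^ (r + 1) / (2 * C1)) ^ (-(1 / α)), (r + 1) / α,
    by positivity, by positivity, ?_⟩
  intro lam hlam hlam1 E hE hEsub hEl θ η hη hEη
  set lp := lam / (2 * A) with hlp
  have hlp0 : 0 < lp := by positivity
  have hlp1 : lp ≤ 1 := by
    rw [hlp, div_le_one (by positivity)]; linarith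
  set μ0 := (lp ^ (r + 1) / (2 * C1)) ^ (1 / α) with hμ0
  have hbase : 0 < lp ^ (r + 1) / (2 * C1) := by positivity
  have hbase1 : lp ^ (r + 1) / (2 * C1) ≤ 1 := by
    rw [div_le_one (by positivity)]
    have := pow_le_one₀ hlp0.le hlp1 (n := r + 1)
    linarith
  have hμ00 : 0 < μ0 := by positivity
  have hμ01 : μ0 ≤ 1 := Real.rpow_le_one hbase.le hbase1 (by positivity)
  have hbad := hsub μ0 hμ00 hμ01
  have hbad2 : C0 * μ0 ^ α < lp ^ (r + 1) := by
    rw [hμ0, ← Real.rpow_mul hbase.le, one_div_mul_cancel hα.ne', Real.rpow_one]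
    have : 0 < lp ^ (r + 1) := by positivity
    rw [mul_div_assoc', div_lt_iff₀ (by positivity)]
    nlinarith
  have hcheb := fiber_cheb μ ν (by linarith) hlam hKP.measurableSet hAP hAQ hE hEsub hEl
  rw [← hlp] at hcheb
  set P0 := {p | ENNReal.ofReal lp ≤ ν (Prod.mk p ⁻¹' E)} with hP0
  have hP0m : MeasurableSet P0 := measurableSet_le measurable_const (measurable_measure_prodMk_left hE)
  set Er : Set (P × (Fin r → Q)) := {w | w.1 ∈ P0 ∧ ∀ i, (w.1, w.2 i) ∈ E} with hEr
  have hErm : MeasurableSet Er := by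
    have : Er = (Prod.fst ⁻¹' P0) ∩ ⋂ i, (fun w : P × (Fin r → Q) => (w.1, w.2 i)) ⁻¹' E := by
      ext w; simp [hEr]
    rw [this]
    refine (measurable_fst hP0m).inter (MeasurableSet.iInter fun i => ?_)
    exact (measurable_fst.prodMk ((measurable_pi_apply i).comp measurable_snd)) hE
  have hErl : ENNReal.ofReal (lp ^ (r + 1)) ≤ (μ.prod (Measure.pi fun _ : Fin r => ν)) Er := by
    rw [Measure.prod_apply hErm]
    have : ∀ p, P0.indicator (fun _ => ENNReal.ofReal lp ^ r) p ≤
        (Measure.pi fun _ : Fin r => ν) (Prod.mk p ⁻¹' Er) := by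
      intro p
      by_cases hp : p ∈ P0
      · rw [indicator_of_mem hp]
        have : Prod.mk p ⁻¹' Er = Set.pi univ fun _ => Prod.mk p ⁻¹' E := by
          ext s; simp [hEr, hp]
        rw [this, Measure.pi_pi, Finset.prod_const, Finset.card_univ, Fintype.card_fin]
        exact pow_le_pow_left₀ (zero_le) hp r
      · rw [indicator_of_notMem hp]; exact zero_le
    refine le_trans ?_ (lintegral_mono this)
    rw [lintegral_indicator hP0m, setLIntegral_const, ENNReal.ofReal_pow hlp0.le, pow_succ]
    gcongr
  -- find a good point
  obtain ⟨w, hwE, hwG⟩ : ∃ w ∈ Er, w ∉ {x ∈ KK | |G x| < μ0} := by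
    by_contra! hcon
    have := (hErl.trans (measure_mono hcon)).trans hbad
    rw [ENNReal.ofReal_le_ofReal_iff (by positivity)] at this
    linarith
  obtain ⟨s0, hs0⟩ : (Prod.mk w.1 ⁻¹' E).Nonempty := by
    rw [nonempty_iff_ne_empty]
    intro h
    have := hwE.1
    simp only [hP0, mem_ofPred_eq, h, measure_empty] at this
    simp at this
    linarith
  have hwK : w ∈ KK := ⟨(hEsub hs0).1, fun i _ => (hEsub (hwE.2 i)).2⟩
  have hwG' : μ0 ≤ |G w| := by
    by_contra! h
    exact hwG ⟨hwK, h⟩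
  have hdet : (gramM fun i => ℓ w.1 (w.2 i)).det ≠ 0 := by
    intro h
    have : G w = 0 := h
    rw [this, abs_zero] at hwG'
    linarith
  have hli := (gramM_det_ne _).1 hdet
  refine ⟨(w.1, s0), hs0, ?_⟩
  have hsolve := gramM_solve (fun i => ℓ w.1 (w.2 i)) (m w.1 s0) (θ w.1) hdet (by
    intro ϑ hϑ
    apply hann w.1 hwK.1 ϑ _ s0 (hEsub hs0).2
    intro s hs
    have hmem : ℓ w.1 s ∈ Submodule.span ℝ (range fun i => ℓ w.1 (w.2 i)) := by
      by_contra hnot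
      apply hRmax
      refine ⟨w.1, hwK.1, Fin.cons s w.2, ?_, ?_⟩
      · intro i
        refine Fin.cases ?_ (fun j => ?_) i
        · simpa using hs
        · simpa using hwK.2 j (mem_univ _)
      · have h9 := linearIndependent_finCons.2 ⟨hli, hnot⟩
        have h8 : (fun i => ℓ w.1 ((Fin.cons s w.2 : Fin (r + 1) → Q) i)) =
            (Fin.cons (ℓ w.1 s) (fun i => ℓ w.1 (w.2 i)) : Fin (r + 1) → Fin d → ℝ) := by
          ext i : 1
          refine Fin.cases ?_ (fun j => ?_) i <;> simp
        rw [h8]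
        exact h9
    refine Submodule.span_induction ?_ ?_ ?_ ?_ hmem
    · rintro x ⟨i, rfl⟩; exact hϑ i
    · simp
    · intro x y _ _ hx hy; rw [add_dotProduct, hx, hy, add_zero]
    · intro a x _ hx; rw [smul_dotProduct, hx, smul_zero])
  have hsum : |G w| * |m w.1 s0 ⬝ᵥ θ w.1| ≤ (r + 1) * B * η := by
    rw [← abs_mul]
    show |(gramM fun i => ℓ w.1 (w.2 i)).det * _| ≤ _
    rw [hsolve]
    refine (Finset.abs_sum_le_sum_abs _ _).trans ?_
    calc _ ≤ ∑ _i : Fin r, B * η := by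
          apply Finset.sum_le_sum
          intro i _
          rw [abs_mul]
          exact mul_le_mul (hB w hwK s0 (hEsub hs0).2 i) (hEη _ (hwE.2 i)) (abs_nonneg _) hB0.le
      _ = r * (B * η) := by simp
      _ ≤ _ := by nlinarith [mul_nonneg hB0.le hη]
  have h1 : |m w.1 s0 ⬝ᵥ θ w.1| ≤ (r + 1) * B * η / μ0 := by
    rw [le_div_iff₀ hμ00]
    refine le_trans ?_ hsum
    rw [mul_comm]
    gcongr
  refine h1.trans (le_of_eq ?_)
  have h2 : lp ^ (r + 1) / (2 * C1) = ((1 / (2 * A)) ^ (r + 1) / (2 * C1)) * lam ^ (r + 1) := by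
    rw [hlp, div_pow, div_pow, one_pow]; field_simp
  rw [hμ0, h2, Real.mul_rpow (by positivity) (by positivity), ← Real.rpow_natCast lam,
    ← Real.rpow_mul hlam.le, Real.rpow_neg (by positivity), Real.rpow_neg hlam.le]
  have : ((r + 1 : ℕ) : ℝ) * (1 / α) = (r + 1) / α := by push_cast; ring
  rw [this]
  field_simp

end Macro

namespace Macro

lemma meas_inter_preimage {X Y : Type*} [TopologicalSpace X] [MeasurableSpace X]
    [OpensMeasurableSpace X] [TopologicalSpace Y] [MeasurableSpace Y] [BorelSpace Y]
    {f : X → Y} {s : Set X} {A : Set Y} (hs : MeasurableSet s) (hf : ContinuousOn f s)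
    (hA : MeasurableSet A) : MeasurableSet {x | x ∈ s ∧ f x ∈ A} := by
  have h1 : Measurable (s.domRestrict f) := (continuousOn_iff_continuous_domRestrict.1 hf).measurable
  have h2 := (MeasurableEmbedding.subtype_coe hs).measurableSet_image.2 (h1 hA)
  convert h2 using 1
  ext x
  constructor
  · rintro ⟨h1, h2⟩
    exact ⟨⟨x, h1⟩, h2, rfl⟩
  · rintro ⟨⟨y, hy⟩, h2, rfl⟩
    exact ⟨hy, h2⟩

lemma thin_part {S : Set (ℝ × ℝ)} (hS : MeasurableSet S) {I : Set ℝ}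
    (hI1 : volume I ≤ 1) (hSI : ∀ z ∈ S, z.1 ∈ I) (c : ℝ≥0∞) (hI : MeasurableSet I) :
    volume (S ∩ {z | volume (Prod.mk z.1 ⁻¹' S) < c}) ≤ c := by
  have hm : MeasurableSet {z : ℝ × ℝ | volume (Prod.mk z.1 ⁻¹' S) < c} :=
    measurableSet_lt ((measurable_measure_prodMk_left hS).comp measurable_fst) measurable_const
  rw [Measure.volume_eq_prod, Measure.prod_apply (hS.inter hm)]
  have : ∀ x, volume (Prod.mk x ⁻¹' (S ∩ {z | volume (Prod.mk z.1 ⁻¹' S) < c})) ≤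
      I.indicator (fun _ => c) x := by
    intro x
    by_cases hx : x ∈ I
    · rw [indicator_of_mem hx]
      by_cases hc : volume (Prod.mk x ⁻¹' S) < c
      · exact (measure_mono (show Prod.mk x ⁻¹' (S ∩ {z | volume (Prod.mk z.1 ⁻¹' S) < c}) ⊆
          Prod.mk x ⁻¹' S from fun y hy => hy.1)).trans hc.le
      · have : Prod.mk x ⁻¹' (S ∩ {z | volume (Prod.mk z.1 ⁻¹' S) < c}) = ∅ := by
          ext y; simp only [mem_preimage, mem_inter_iff, mem_ofPred_eq, mem_empty_iff_false,
            iff_false, not_and]; exact fun _ => hc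
        rw [this]; simp
    · have : Prod.mk x ⁻¹' (S ∩ {z | volume (Prod.mk z.1 ⁻¹' S) < c}) = ∅ := by
        ext y; simp only [mem_preimage, mem_inter_iff, mem_empty_iff_false, iff_false]
        exact fun h => hx (hSI _ h.1)
      rw [this]; simp
  refine (lintegral_mono this).trans ?_
  rw [lintegral_indicator hI, setLIntegral_const]
  calc c * volume I ≤ c * 1 := by gcongr
    _ = c := mul_one c

def Tset (K I : Set ℝ) (ψ : ℝ × ℝ → ℝ) (S : Set (ℝ × ℝ)) : Set ((ℝ × ℝ × ℝ × ℝ) × (ℝ × ℝ)) :=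
  {w | w.2 ∈ K ×ˢ I ∧ (w.2.2, ψ w.2) ∈ S ∧ (w.1.1, ψ w.2) ∈ S ∧ (w.1.2.1, ψ w.2) ∈ S ∧
    (w.2.2, w.1.2.2.1) ∈ S ∧ (w.2.2, w.1.2.2.2) ∈ S}

lemma Tset_meas {K I : Set ℝ} {ψ : ℝ × ℝ → ℝ} {S : Set (ℝ × ℝ)} (hK : MeasurableSet K)
    (hI : MeasurableSet I) (hψ : ContinuousOn ψ (K ×ˢ I)) (hS : MeasurableSet S) :
    MeasurableSet (Tset K I ψ S) := by
  have hm : MeasurableSet ((univ : Set (ℝ × ℝ × ℝ × ℝ)) ×ˢ (K ×ˢ I)) :=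
    MeasurableSet.univ.prod (hK.prod hI)
  have hψ2 : ContinuousOn (fun w : (ℝ × ℝ × ℝ × ℝ) × (ℝ × ℝ) => ψ w.2) (univ ×ˢ (K ×ˢ I)) :=
    hψ.comp continuousOn_snd fun w hw => hw.2
  have h1 := meas_inter_preimage (f := fun w : (ℝ × ℝ × ℝ × ℝ) × (ℝ × ℝ) => (w.2.2, ψ w.2)) hm
    (by fun_prop) hS
  have h2 := meas_inter_preimage (f := fun w : (ℝ × ℝ × ℝ × ℝ) × (ℝ × ℝ) => (w.1.1, ψ w.2)) hm
    (by fun_prop) hS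
  have h3 := meas_inter_preimage (f := fun w : (ℝ × ℝ × ℝ × ℝ) × (ℝ × ℝ) => (w.1.2.1, ψ w.2)) hm
    (by fun_prop) hS
  have h4 := meas_inter_preimage
    (f := fun w : (ℝ × ℝ × ℝ × ℝ) × (ℝ × ℝ) => (w.2.2, w.1.2.2.1)) hm (by fun_prop) hS
  have h5 := meas_inter_preimage
    (f := fun w : (ℝ × ℝ × ℝ × ℝ) × (ℝ × ℝ) => (w.2.2, w.1.2.2.2)) hm (by fun_prop) hS
  convert h1.inter (h2.inter (h3.inter (h4.inter h5))) using 1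
  ext w
  simp only [Tset, mem_ofPred_eq, mem_inter_iff, mem_prod, mem_univ, true_and]
  tauto

lemma T_lower {I J K : Set ℝ} {ψ : ℝ × ℝ → ℝ} {S : Set (ℝ × ℝ)} (hI : MeasurableSet I)
    (hJ : MeasurableSet J) (hK : MeasurableSet K) (hI1 : volume I ≤ 1) (hJ1 : volume J ≤ 1)
    (hψ : ContinuousOn ψ (K ×ˢ I)) (hS : MeasurableSet S) (hSIJ : S ⊆ I ×ˢ J) {L lam : ℝ}
    (hL : 0 < L) (hlam : 0 < lam)
    (hCV : ∀ A : Set (ℝ × ℝ), MeasurableSet A → A ⊆ I ×ˢ J →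
      volume A ≤ ENNReal.ofReal L * volume {z : ℝ × ℝ | z ∈ K ×ˢ I ∧ (z.2, ψ z) ∈ A})
    (hlS : ENNReal.ofReal lam ≤ volume S) :
    ENNReal.ofReal ((lam / 4) ^ 4 * (lam / (2 * L))) ≤ volume (Tset K I ψ S) := by
  set c := ENNReal.ofReal (lam / 4) with hc
  set S1 := {z : ℝ × ℝ | volume (Prod.mk z.1 ⁻¹' S) < c} with hS1
  set S2 := {z : ℝ × ℝ | volume ((fun x => (x, z.2)) ⁻¹' S) < c} with hS2
  have hm1 : MeasurableSet S1 :=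
    measurableSet_lt ((measurable_measure_prodMk_left hS).comp measurable_fst) measurable_const
  have hm2 : MeasurableSet S2 :=
    measurableSet_lt ((measurable_measure_prodMk_right hS).comp measurable_snd) measurable_const
  have hb1 : volume (S ∩ S1) ≤ c := thin_part hS hI1 (fun z hz => (hSIJ hz).1) c hI
  have hb2 : volume (S ∩ S2) ≤ c := by
    have hsw : MeasurePreserving (Prod.swap : ℝ × ℝ → ℝ × ℝ) volume volume :=
      Measure.measurePreserving_swap
    have := thin_part (S := Prod.swap ⁻¹' S) (measurable_swap hS) hJ1
      (fun z hz => (hSIJ hz).2) c hJ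
    have h2 : Prod.swap ⁻¹' S ∩ {z : ℝ × ℝ | volume (Prod.mk z.1 ⁻¹' (Prod.swap ⁻¹' S)) < c} =
      Prod.swap ⁻¹' (S ∩ S2) := by
      ext z; rfl
    rw [h2, hsw.measure_preimage (hS.inter hm2).nullMeasurableSet] at this
    exact this
  set S3 := S \ (S1 ∪ S2) with hS3
  have hS3m : MeasurableSet S3 := hS.diff (hm1.union hm2)
  have hS3l : ENNReal.ofReal (lam / 2) ≤ volume S3 := by
    have h1 : volume S ≤ volume S3 + (c + c) := by
      have : S ⊆ S3 ∪ ((S ∩ S1) ∪ (S ∩ S2)) := by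
        intro z hz
        by_cases h1 : z ∈ S1
        · exact Or.inr (Or.inl ⟨hz, h1⟩)
        by_cases h2 : z ∈ S2
        · exact Or.inr (Or.inr ⟨hz, h2⟩)
        exact Or.inl ⟨hz, fun h => h.elim h1 h2⟩
      refine (measure_mono this).trans ((measure_union_le _ _).trans ?_)
      gcongr
      exact (measure_union_le _ _).trans (add_le_add hb1 hb2)
    have h2 : ENNReal.ofReal lam = ENNReal.ofReal (lam / 2) + (c + c) := by
      rw [hc, ← ENNReal.ofReal_add (by positivity) (by positivity),
        ← ENNReal.ofReal_add (by positivity) (by positivity)]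
      congr 1; ring
    rw [h2] at hlS
    exact (ENNReal.add_le_add_iff_right (by simp [hc])).1 (hlS.trans h1)
  have hS3s : S3 ⊆ I ×ˢ J := fun z hz => hSIJ hz.1
  set R := {z : ℝ × ℝ | z ∈ K ×ˢ I ∧ (z.2, ψ z) ∈ S3} with hR
  have hRm : MeasurableSet R := meas_inter_preimage (f := fun z : ℝ × ℝ => (z.2, ψ z))
    (hK.prod hI) (by fun_prop) hS3m
  have hRl : ENNReal.ofReal (lam / (2 * L)) ≤ volume R := by
    have h1 := hS3l.trans (hCV S3 hS3m hS3s)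
    have h2 : ENNReal.ofReal (lam / 2) = ENNReal.ofReal L * ENNReal.ofReal (lam / (2 * L)) := by
      rw [← ENNReal.ofReal_mul hL.le]; congr 1; field_simp
    rw [h2] at h1
    exact (ENNReal.mul_le_mul_iff_right (by simpa using hL) (by simp)).1 h1
  have hTm := Tset_meas hK hI hψ hS
  rw [Measure.volume_eq_prod, Measure.prod_apply_symm hTm]
  have key : ∀ z, R.indicator (fun _ => c ^ 4) z ≤
      volume ((fun p : ℝ × ℝ × ℝ × ℝ => (p, z)) ⁻¹' (Tset K I ψ S)) := by
    intro z
    by_cases hz : z ∈ R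
    · rw [indicator_of_mem hz]
      have h1 : (fun p : ℝ × ℝ × ℝ × ℝ => (p, z)) ⁻¹' (Tset K I ψ S) =
          ((fun x => (x, ψ z)) ⁻¹' S) ×ˢ (((fun x => (x, ψ z)) ⁻¹' S) ×ˢ
            ((Prod.mk z.2 ⁻¹' S) ×ˢ (Prod.mk z.2 ⁻¹' S))) := by
        ext p
        simp only [Tset, mem_preimage, mem_ofPred_eq, mem_prod]
        have := hz.1; have := hz.2.1
        simp only [mem_prod] at *
        tauto
      have h2 : c ≤ volume ((fun x => (x, ψ z)) ⁻¹' S) := by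
        have := hz.2.2
        by_contra h
        exact this (Or.inr (not_le.1 h))
      have h3 : c ≤ volume (Prod.mk z.2 ⁻¹' S) := by
        have := hz.2.2
        by_contra h
        exact this (Or.inl (not_le.1 h))
      rw [h1, Measure.volume_eq_prod, Measure.prod_prod, Measure.volume_eq_prod, Measure.prod_prod,
        Measure.volume_eq_prod, Measure.prod_prod]
      calc c ^ 4 = c * (c * (c * c)) := by ring
        _ ≤ _ := by gcongr
    · rw [indicator_of_notMem hz]; exact zero_le
  refine le_trans ?_ (lintegral_mono key)
  rw [lintegral_indicator hRm, setLIntegral_const, ENNReal.ofReal_mul (by positivity),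
    ENNReal.ofReal_pow (by positivity)]
  gcongr

lemma double_lower {P : Type*} [MeasurableSpace P] (μ : Measure P) [SFinite μ]
    {KP : Set P} {K : Set ℝ} {T : Set (P × (ℝ × ℝ))} (hT : MeasurableSet T)
    (hKP : MeasurableSet KP) (hK : MeasurableSet K) (hKP1 : μ KP ≤ 1) (hK1 : volume K ≤ 1)
    (hTs : ∀ w ∈ T, w.1 ∈ KP ∧ w.2.1 ∈ K) {lam : ℝ} (hlam : 0 < lam)
    (hl : ENNReal.ofReal lam ≤ (μ.prod volume) T) :
    ENNReal.ofReal (lam ^ 2 / 4) ≤ (μ.prod volume)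
      {w : P × (ℝ × (ℝ × ℝ)) | (w.1, (w.2.1, w.2.2.1)) ∈ T ∧ (w.1, (w.2.1, w.2.2.2)) ∈ T} := by
  set E := {w : P × (ℝ × (ℝ × ℝ)) | (w.1, (w.2.1, w.2.2.1)) ∈ T ∧ (w.1, (w.2.1, w.2.2.2)) ∈ T}
    with hE
  have hEm : MeasurableSet E := by
    have h1 : Measurable fun w : P × (ℝ × (ℝ × ℝ)) => (w.1, (w.2.1, w.2.2.1)) := by fun_prop
    have h2 : Measurable fun w : P × (ℝ × (ℝ × ℝ)) => (w.1, (w.2.1, w.2.2.2)) := by fun_prop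
    exact (h1 hT).inter (h2 hT)
  let u : P → ℝ → ℝ≥0∞ := fun p t => volume (Prod.mk t ⁻¹' (Prod.mk p ⁻¹' T))
  have hTv : (μ.prod volume) T = ∫⁻ p, ∫⁻ t, u p t ∂volume ∂μ := by
    rw [Measure.prod_apply hT]
    refine lintegral_congr fun p => ?_
    rw [Measure.volume_eq_prod, Measure.prod_apply (measurable_prodMk_left hT)]
  have hEv : (μ.prod volume) E = ∫⁻ p, ∫⁻ t, u p t * u p t ∂volume ∂μ := by
    rw [Measure.prod_apply hEm]
    refine lintegral_congr fun p => ?_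
    rw [Measure.volume_eq_prod, Measure.prod_apply (measurable_prodMk_left hEm)]
    refine lintegral_congr fun t => ?_
    have : Prod.mk t ⁻¹' (Prod.mk p ⁻¹' E) = (Prod.mk t ⁻¹' (Prod.mk p ⁻¹' T)) ×ˢ
        (Prod.mk t ⁻¹' (Prod.mk p ⁻¹' T)) := by
      ext s; rfl
    rw [this, Measure.volume_eq_prod, Measure.prod_prod]
  set c := ENNReal.ofReal (lam / 2) with hc
  have hc0 : c ≠ 0 := by simp [hc]; linarith
  have hct : c ≠ ∞ := by simp [hc]
  have hum : Measurable fun w : P × ℝ => u w.1 w.2 := by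
    have h3 : Measurable fun w : (P × ℝ) × ℝ => (w.1.1, (w.1.2, w.2)) := by fun_prop
    exact measurable_measure_prodMk_left (h3 hT)
  have hpt : ∀ p t, c * u p t ≤ KP.indicator (fun _ => K.indicator (fun _ => c * c) t) p
      + u p t * u p t := by
    intro p t
    by_cases hp : p ∈ KP ∧ t ∈ K
    · rw [indicator_of_mem hp.1, indicator_of_mem hp.2]
      rcases le_total (u p t) c with h | h
      · exact le_add_right (by gcongr)
      · exact le_add_left (by gcongr)
    · have : Prod.mk t ⁻¹' (Prod.mk p ⁻¹' T) = ∅ := by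
        ext s; simp only [mem_preimage, mem_empty_iff_false, iff_false]
        exact fun h => hp (hTs _ h)
      simp [u, this]
  have hIntg : c * (∫⁻ p, ∫⁻ t, u p t ∂volume ∂μ) ≤ c * c + ∫⁻ p, ∫⁻ t, u p t * u p t ∂volume ∂μ := by
    calc c * (∫⁻ p, ∫⁻ t, u p t ∂volume ∂μ) = ∫⁻ p, ∫⁻ t, c * u p t ∂volume ∂μ := by
          rw [← lintegral_const_mul' _ _ hct]
          refine lintegral_congr fun p => ?_
          rw [← lintegral_const_mul' _ _ hct]
      _ ≤ ∫⁻ p, ∫⁻ t, (KP.indicator (fun _ => K.indicator (fun _ => c * c) t) p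
            + u p t * u p t) ∂volume ∂μ :=
          lintegral_mono fun p => lintegral_mono fun t => hpt p t
      _ ≤ ∫⁻ p, (KP.indicator (fun _ => c * c) p + ∫⁻ t, u p t * u p t ∂volume) ∂μ := by
          refine lintegral_mono fun p => ?_
          have hup : Measurable fun t => u p t * u p t := by
            have := hum.comp (measurable_prodMk_left (x := p))
            exact this.mul this
          rw [lintegral_add_right _ hup]
          gcongr
          by_cases hp : p ∈ KP
          · simp only [indicator_of_mem hp]
            rw [lintegral_indicator hK, setLIntegral_const]
            calc c * c * volume K ≤ c * c * 1 := by gcongr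
              _ = _ := mul_one _
          · simp [indicator_of_notMem hp]
      _ = (∫⁻ p, KP.indicator (fun _ => c * c) p ∂μ) + ∫⁻ p, ∫⁻ t, u p t * u p t ∂volume ∂μ := by
          rw [lintegral_add_left (measurable_const.indicator hKP)]
      _ ≤ _ := by
          gcongr
          rw [lintegral_indicator hKP, setLIntegral_const]
          calc c * c * μ KP ≤ c * c * 1 := by gcongr
            _ = _ := mul_one _
  rw [← hTv, ← hEv] at hIntg
  have h2 : c * ENNReal.ofReal lam = c * c + ENNReal.ofReal (lam ^ 2 / 4) := by
    rw [hc, ← ENNReal.ofReal_mul (by positivity), ← ENNReal.ofReal_mul (by positivity),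
      ← ENNReal.ofReal_add (by positivity) (by positivity)]
    congr 1; ring
  have h3 : c * ENNReal.ofReal lam ≤ c * (μ.prod volume) T := by gcongr
  rw [h2] at h3
  exact (ENNReal.add_le_add_iff_left (ENNReal.mul_ne_top hct hct)).1 (h3.trans hIntg)

end Macro

namespace Macro

/-- local data in coordinates -/
structure Dat where
  U : ℝ × ℝ → ℝ
  V : ℝ × ℝ → ℝ
  P1 : ℝ × ℝ → ℝ
  P2 : ℝ × ℝ → ℝ
  Q1 : ℝ × ℝ → ℝ
  Q2 : ℝ × ℝ → ℝ
  ψ : ℝ × ℝ → ℝ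

namespace Dat
variable (Δ : Dat)

def D (x y1 y2 : ℝ) : ℝ := Δ.P1 (x, y1) * Δ.P2 (x, y2) - Δ.P1 (x, y2) * Δ.P2 (x, y1)
def D' (y x1 x2 : ℝ) : ℝ := Δ.Q1 (x1, y) * Δ.Q2 (x2, y) - Δ.Q1 (x2, y) * Δ.Q2 (x1, y)
def N1 (x y1 y2 : ℝ) (θ : Fin 8 → ℝ) : ℝ :=
  -Δ.P2 (x, y2) * (Δ.Q1 (x, y1) * θ 4 + Δ.Q2 (x, y1) * θ 5) +
    Δ.P2 (x, y1) * (Δ.Q1 (x, y2) * θ 6 + Δ.Q2 (x, y2) * θ 7)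
def N2 (y x1 x2 : ℝ) (θ : Fin 8 → ℝ) : ℝ :=
  -Δ.Q2 (x2, y) * (Δ.P1 (x1, y) * θ 0 + Δ.P2 (x1, y) * θ 1) +
    Δ.Q2 (x1, y) * (Δ.P1 (x2, y) * θ 2 + Δ.P2 (x2, y) * θ 3)

/-- `w = ((x1,x2,y1,y2),(t,x))` -/
def A (w : (ℝ × ℝ × ℝ × ℝ) × (ℝ × ℝ)) : ℝ :=
  Δ.D w.2.2 w.1.2.2.1 w.1.2.2.2 * Δ.D' (Δ.ψ w.2) w.1.1 w.1.2.1
def H (w : (ℝ × ℝ × ℝ × ℝ) × (ℝ × ℝ)) (θ : Fin 8 → ℝ) : ℝ :=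
  -(Δ.U (w.2.2, Δ.ψ w.2) * Δ.D' (Δ.ψ w.2) w.1.1 w.1.2.1 * Δ.N1 w.2.2 w.1.2.2.1 w.1.2.2.2 θ +
    Δ.V (w.2.2, Δ.ψ w.2) * Δ.D w.2.2 w.1.2.2.1 w.1.2.2.2 * Δ.N2 (Δ.ψ w.2) w.1.1 w.1.2.1 θ)

lemma H_sum (w : (ℝ × ℝ × ℝ × ℝ) × (ℝ × ℝ)) (θ : Fin 8 → ℝ) :
    (fun k => Δ.H w (Pi.single k 1)) ⬝ᵥ θ = Δ.H w θ := by
  simp only [dotProduct, Fin.sum_univ_eight, H, N1, N2]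
  simp only [Pi.single_apply, Fin.reduceEq, if_true, if_false]
  ring

def ℓ (p : ℝ × ℝ × ℝ × ℝ) (s : ℝ × (ℝ × ℝ)) (k : Fin 8) : ℝ :=
  Δ.A (p, (s.1, s.2.2)) * Δ.H (p, (s.1, s.2.1)) (Pi.single k 1) -
    Δ.A (p, (s.1, s.2.1)) * Δ.H (p, (s.1, s.2.2)) (Pi.single k 1)
def m (p : ℝ × ℝ × ℝ × ℝ) (s : ℝ × (ℝ × ℝ)) (k : Fin 8) : ℝ :=
  Δ.A (p, (s.1, s.2.1)) * Δ.H (p, (s.1, s.2.1)) (Pi.single k 1)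

lemma ℓ_dot (p : ℝ × ℝ × ℝ × ℝ) (s : ℝ × (ℝ × ℝ)) (θ : Fin 8 → ℝ) :
    Δ.ℓ p s ⬝ᵥ θ = Δ.A (p, (s.1, s.2.2)) * Δ.H (p, (s.1, s.2.1)) θ -
      Δ.A (p, (s.1, s.2.1)) * Δ.H (p, (s.1, s.2.2)) θ := by
  rw [← H_sum, ← H_sum]
  simp only [dotProduct, ℓ, Finset.mul_sum, ← Finset.sum_sub_distrib]
  exact Finset.sum_congr rfl fun k _ => by ring

lemma m_dot (p : ℝ × ℝ × ℝ × ℝ) (s : ℝ × (ℝ × ℝ)) (θ : Fin 8 → ℝ) :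
    Δ.m p s ⬝ᵥ θ = Δ.A (p, (s.1, s.2.1)) * Δ.H (p, (s.1, s.2.1)) θ := by
  rw [← H_sum]
  simp only [dotProduct, m, Finset.mul_sum]
  exact Finset.sum_congr rfl fun k _ => by ring

/-- analyticity and range hypotheses -/
structure Good (I J Jp K : Set ℝ) : Prop where
  hU : AnalyticOnNhd ℝ Δ.U (I ×ˢ Jp)
  hV : AnalyticOnNhd ℝ Δ.V (I ×ˢ Jp)
  hP1 : AnalyticOnNhd ℝ Δ.P1 (I ×ˢ Jp)
  hP2 : AnalyticOnNhd ℝ Δ.P2 (I ×ˢ Jp)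
  hQ1 : AnalyticOnNhd ℝ Δ.Q1 (I ×ˢ Jp)
  hQ2 : AnalyticOnNhd ℝ Δ.Q2 (I ×ˢ Jp)
  hψ : AnalyticOnNhd ℝ Δ.ψ (K ×ˢ I)
  hm : ∀ z ∈ K ×ˢ I, Δ.ψ z ∈ Jp
  hJ : J ⊆ Jp

variable {Δ}
variable {X : Type*} [NormedAddCommGroup X] [NormedSpace ℝ X]

lemma an_comp {F : ℝ × ℝ → ℝ} {x y : X → ℝ} {w : X} (hF : AnalyticAt ℝ F (x w, y w))
    (hx : AnalyticAt ℝ x w) (hy : AnalyticAt ℝ y w) : AnalyticAt ℝ (fun w => F (x w, y w)) w :=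
  AnalyticAt.comp (g := F) (f := fun w => (x w, y w)) hF (hx.prod hy)

variable {I J Jp K : Set ℝ}

lemma Good.an_D (h : Δ.Good I J Jp K) {x y1 y2 : X → ℝ} {w : X} (hx : AnalyticAt ℝ x w)
    (h1 : AnalyticAt ℝ y1 w) (h2 : AnalyticAt ℝ y2 w) (mx : x w ∈ I) (m1 : y1 w ∈ Jp)
    (m2 : y2 w ∈ Jp) : AnalyticAt ℝ (fun w => Δ.D (x w) (y1 w) (y2 w)) w :=
  ((an_comp (h.hP1 _ ⟨mx, m1⟩) hx h1).mul (an_comp (h.hP2 _ ⟨mx, m2⟩) hx h2)).sub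
    ((an_comp (h.hP1 _ ⟨mx, m2⟩) hx h2).mul (an_comp (h.hP2 _ ⟨mx, m1⟩) hx h1))

lemma Good.an_D' (h : Δ.Good I J Jp K) {y x1 x2 : X → ℝ} {w : X} (hy : AnalyticAt ℝ y w)
    (h1 : AnalyticAt ℝ x1 w) (h2 : AnalyticAt ℝ x2 w) (my : y w ∈ Jp) (m1 : x1 w ∈ I)
    (m2 : x2 w ∈ I) : AnalyticAt ℝ (fun w => Δ.D' (y w) (x1 w) (x2 w)) w :=
  ((an_comp (h.hQ1 _ ⟨m1, my⟩) h1 hy).mul (an_comp (h.hQ2 _ ⟨m2, my⟩) h2 hy)).sub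
    ((an_comp (h.hQ1 _ ⟨m2, my⟩) h2 hy).mul (an_comp (h.hQ2 _ ⟨m1, my⟩) h1 hy))

lemma Good.an_N1 (h : Δ.Good I J Jp K) {x y1 y2 : X → ℝ} {w : X} (hx : AnalyticAt ℝ x w)
    (h1 : AnalyticAt ℝ y1 w) (h2 : AnalyticAt ℝ y2 w) (mx : x w ∈ I) (m1 : y1 w ∈ Jp)
    (m2 : y2 w ∈ Jp) (θ : Fin 8 → ℝ) :
    AnalyticAt ℝ (fun w => Δ.N1 (x w) (y1 w) (y2 w) θ) w :=
  ((an_comp (h.hP2 _ ⟨mx, m2⟩) hx h2).neg.mul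
    (((an_comp (h.hQ1 _ ⟨mx, m1⟩) hx h1).mul analyticAt_const).add
      ((an_comp (h.hQ2 _ ⟨mx, m1⟩) hx h1).mul analyticAt_const))).add
  ((an_comp (h.hP2 _ ⟨mx, m1⟩) hx h1).mul
    (((an_comp (h.hQ1 _ ⟨mx, m2⟩) hx h2).mul analyticAt_const).add
      ((an_comp (h.hQ2 _ ⟨mx, m2⟩) hx h2).mul analyticAt_const)))

lemma Good.an_N2 (h : Δ.Good I J Jp K) {y x1 x2 : X → ℝ} {w : X} (hy : AnalyticAt ℝ y w)
    (h1 : AnalyticAt ℝ x1 w) (h2 : AnalyticAt ℝ x2 w) (my : y w ∈ Jp) (m1 : x1 w ∈ I)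
    (m2 : x2 w ∈ I) (θ : Fin 8 → ℝ) :
    AnalyticAt ℝ (fun w => Δ.N2 (y w) (x1 w) (x2 w) θ) w :=
  ((an_comp (h.hQ2 _ ⟨m2, my⟩) h2 hy).neg.mul
    (((an_comp (h.hP1 _ ⟨m1, my⟩) h1 hy).mul analyticAt_const).add
      ((an_comp (h.hP2 _ ⟨m1, my⟩) h1 hy).mul analyticAt_const))).add
  ((an_comp (h.hQ2 _ ⟨m1, my⟩) h1 hy).mul
    (((an_comp (h.hP1 _ ⟨m2, my⟩) h2 hy).mul analyticAt_const).add
      ((an_comp (h.hP2 _ ⟨m2, my⟩) h2 hy).mul analyticAt_const)))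

def KP (I J : Set ℝ) : Set (ℝ × ℝ × ℝ × ℝ) := I ×ˢ (I ×ˢ (J ×ˢ J))

lemma Good.an_ψ (h : Δ.Good I J Jp K) {t x : X → ℝ} {w : X} (ht : AnalyticAt ℝ t w)
    (hx : AnalyticAt ℝ x w) (mt : t w ∈ K) (mx : x w ∈ I) :
    AnalyticAt ℝ (fun w => Δ.ψ (t w, x w)) w :=
  an_comp (h.hψ _ ⟨mt, mx⟩) ht hx

lemma Good.an_A (h : Δ.Good I J Jp K) {p : X → ℝ × ℝ × ℝ × ℝ} {t x : X → ℝ} {w : X}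
    (hp : AnalyticAt ℝ p w) (ht : AnalyticAt ℝ t w)
    (hx : AnalyticAt ℝ x w) (mp : p w ∈ KP I J) (mt : t w ∈ K) (mx : x w ∈ I) :
    AnalyticAt ℝ (fun w => Δ.A (p w, (t w, x w))) w := by
  obtain ⟨q1, q2, q3, q4⟩ := mp
  exact (h.an_D hx (analyticAt_fst.comp (analyticAt_snd.comp (analyticAt_snd.comp hp)))
      (analyticAt_snd.comp (analyticAt_snd.comp (analyticAt_snd.comp hp))) mx (h.hJ q3) (h.hJ q4)).mul
    (h.an_D' (h.an_ψ ht hx mt mx) (analyticAt_fst.comp hp)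
      (analyticAt_fst.comp (analyticAt_snd.comp hp)) (h.hm _ ⟨mt, mx⟩) q1 q2)

lemma Good.an_H (h : Δ.Good I J Jp K) {p : X → ℝ × ℝ × ℝ × ℝ} {t x : X → ℝ} {w : X}
    (hp : AnalyticAt ℝ p w) (ht : AnalyticAt ℝ t w)
    (hx : AnalyticAt ℝ x w) (mp : p w ∈ KP I J) (mt : t w ∈ K) (mx : x w ∈ I) (θ : Fin 8 → ℝ) :
    AnalyticAt ℝ (fun w => Δ.H (p w, (t w, x w)) θ) w := by
  obtain ⟨q1, q2, q3, q4⟩ := mp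
  have hψ := h.an_ψ ht hx mt mx
  have mψ := h.hm (t w, x w) ⟨mt, mx⟩
  have a1 : AnalyticAt ℝ (fun w => (p w).1) w := analyticAt_fst.comp hp
  have a2 : AnalyticAt ℝ (fun w => (p w).2.1) w := analyticAt_fst.comp (analyticAt_snd.comp hp)
  have a3 : AnalyticAt ℝ (fun w => (p w).2.2.1) w :=
    analyticAt_fst.comp (analyticAt_snd.comp (analyticAt_snd.comp hp))
  have a4 : AnalyticAt ℝ (fun w => (p w).2.2.2) w :=
    analyticAt_snd.comp (analyticAt_snd.comp (analyticAt_snd.comp hp))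
  exact ((((an_comp (h.hU _ ⟨mx, mψ⟩) hx hψ).mul (h.an_D' hψ a1 a2 mψ q1 q2)).mul
      (h.an_N1 hx a3 a4 mx (h.hJ q3) (h.hJ q4) θ)).add
    (((an_comp (h.hV _ ⟨mx, mψ⟩) hx hψ).mul (h.an_D hx a3 a4 mx (h.hJ q3) (h.hJ q4))).mul
      (h.an_N2 hψ a1 a2 mψ q1 q2 θ))).neg

lemma approx {M η f1x g1x f2y g2y f3t : ℝ} {w : (ℝ × ℝ × ℝ × ℝ) × (ℝ × ℝ)} {θ : Fin 8 → ℝ}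
    (hM : 0 ≤ M) (hη : 0 ≤ η)
    (bU : |Δ.U (w.2.2, Δ.ψ w.2)| ≤ M) (bV : |Δ.V (w.2.2, Δ.ψ w.2)| ≤ M)
    (bP1 : |Δ.P2 (w.2.2, w.1.2.2.1)| ≤ M) (bP2 : |Δ.P2 (w.2.2, w.1.2.2.2)| ≤ M)
    (bQ1 : |Δ.Q2 (w.1.1, Δ.ψ w.2)| ≤ M) (bQ2 : |Δ.Q2 (w.1.2.1, Δ.ψ w.2)| ≤ M)
    (bD : |Δ.D w.2.2 w.1.2.2.1 w.1.2.2.2| ≤ 2 * M ^ 2)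
    (bD' : |Δ.D' (Δ.ψ w.2) w.1.1 w.1.2.1| ≤ 2 * M ^ 2)
    (e0 : |Δ.U (w.2.2, Δ.ψ w.2) * f1x + Δ.V (w.2.2, Δ.ψ w.2) * f2y + f3t| ≤ η)
    (e1 : |Δ.P1 (w.2.2, w.1.2.2.1) * f1x + Δ.P2 (w.2.2, w.1.2.2.1) * g1x +
      Δ.Q1 (w.2.2, w.1.2.2.1) * θ 4 + Δ.Q2 (w.2.2, w.1.2.2.1) * θ 5| ≤ η)
    (e2 : |Δ.P1 (w.2.2, w.1.2.2.2) * f1x + Δ.P2 (w.2.2, w.1.2.2.2) * g1x +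
      Δ.Q1 (w.2.2, w.1.2.2.2) * θ 6 + Δ.Q2 (w.2.2, w.1.2.2.2) * θ 7| ≤ η)
    (e3 : |Δ.P1 (w.1.1, Δ.ψ w.2) * θ 0 + Δ.P2 (w.1.1, Δ.ψ w.2) * θ 1 +
      Δ.Q1 (w.1.1, Δ.ψ w.2) * f2y + Δ.Q2 (w.1.1, Δ.ψ w.2) * g2y| ≤ η)
    (e4 : |Δ.P1 (w.1.2.1, Δ.ψ w.2) * θ 2 + Δ.P2 (w.1.2.1, Δ.ψ w.2) * θ 3 +
      Δ.Q1 (w.1.2.1, Δ.ψ w.2) * f2y + Δ.Q2 (w.1.2.1, Δ.ψ w.2) * g2y| ≤ η) :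
    |Δ.A w * f3t - Δ.H w θ| ≤ 12 * M ^ 4 * η := by
  obtain ⟨⟨x1, x2, y1, y2⟩, t, x⟩ := w
  simp only at *
  set y := Δ.ψ (t, x) with hy
  have s1 : |Δ.D x y1 y2 * f1x - Δ.N1 x y1 y2 θ| ≤ 2 * M * η := by
    have : Δ.D x y1 y2 * f1x - Δ.N1 x y1 y2 θ =
      Δ.P2 (x, y2) * (Δ.P1 (x, y1) * f1x + Δ.P2 (x, y1) * g1x +
      Δ.Q1 (x, y1) * θ 4 + Δ.Q2 (x, y1) * θ 5) - Δ.P2 (x, y1) * (Δ.P1 (x, y2) * f1x +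
      Δ.P2 (x, y2) * g1x + Δ.Q1 (x, y2) * θ 6 + Δ.Q2 (x, y2) * θ 7) := by
      simp only [D, N1]; ring
    rw [this]
    refine (abs_sub _ _).trans ?_
    rw [abs_mul, abs_mul]
    calc _ ≤ M * η + M * η := by gcongr
      _ = _ := by ring
  have s2 : |Δ.D' y x1 x2 * f2y - Δ.N2 y x1 x2 θ| ≤ 2 * M * η := by
    have : Δ.D' y x1 x2 * f2y - Δ.N2 y x1 x2 θ =
      Δ.Q2 (x2, y) * (Δ.P1 (x1, y) * θ 0 + Δ.P2 (x1, y) * θ 1 +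
      Δ.Q1 (x1, y) * f2y + Δ.Q2 (x1, y) * g2y) - Δ.Q2 (x1, y) * (Δ.P1 (x2, y) * θ 2 +
      Δ.P2 (x2, y) * θ 3 + Δ.Q1 (x2, y) * f2y + Δ.Q2 (x2, y) * g2y) := by
      simp only [D', N2]; ring
    rw [this]
    refine (abs_sub _ _).trans ?_
    rw [abs_mul, abs_mul]
    calc _ ≤ M * η + M * η := by gcongr
      _ = _ := by ring
  have : Δ.A ((x1, x2, y1, y2), (t, x)) * f3t - Δ.H ((x1, x2, y1, y2), (t, x)) θ =
      Δ.D x y1 y2 * Δ.D' y x1 x2 * (Δ.U (x, y) * f1x + Δ.V (x, y) * f2y + f3t) +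
      (-(Δ.U (x, y) * Δ.D' y x1 x2 * (Δ.D x y1 y2 * f1x - Δ.N1 x y1 y2 θ))) +
      (-(Δ.V (x, y) * Δ.D x y1 y2 * (Δ.D' y x1 x2 * f2y - Δ.N2 y x1 x2 θ))) := by
    simp only [A, H, ← hy]; ring
  rw [this]
  refine (abs_add_three _ _ _).trans ?_
  simp only [abs_neg, abs_mul]
  calc _ ≤ 2 * M ^ 2 * (2 * M ^ 2) * η + M * (2 * M ^ 2) * (2 * M * η) +
        M * (2 * M ^ 2) * (2 * M * η) := by gcongr
    _ = _ := by ring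

end Dat
end Macro

namespace Macro
namespace Dat
variable {Δ : Dat}

/-- local form of the main hypothesis -/
def H3 (Δ : Dat) (I K : Set ℝ) : Prop :=
  ∀ t0 x0 ε : ℝ, 0 < ε → Metric.ball t0 ε ×ˢ Metric.ball x0 ε ⊆ K ×ˢ I → ∀ f1 f2 f3 : ℝ → ℝ,
    AnalyticOnNhd ℝ f1 (Metric.ball x0 ε) →
    AnalyticOnNhd ℝ f2 (Δ.ψ '' (Metric.ball t0 ε ×ˢ Metric.ball x0 ε)) →
    AnalyticOnNhd ℝ f3 (Metric.ball t0 ε) →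
    (∀ t ∈ Metric.ball t0 ε, ∀ x ∈ Metric.ball x0 ε,
      Δ.U (x, Δ.ψ (t, x)) * f1 x + Δ.V (x, Δ.ψ (t, x)) * f2 (Δ.ψ (t, x)) + f3 t = 0) →
    f3 t0 = 0

lemma Good.ann {i0 i1 k0 k1 : ℝ} {J Jp : Set ℝ} (hi : i0 < i1) (hk : k0 < k1)
    (h : Δ.Good (Icc i0 i1) J Jp (Icc k0 k1)) (h3 : Δ.H3 (Icc i0 i1) (Icc k0 k1)) :
    ∀ p ∈ KP (Icc i0 i1) J, ∀ θ : Fin 8 → ℝ,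
      (∀ s ∈ (Icc k0 k1) ×ˢ ((Icc i0 i1) ×ˢ (Icc i0 i1)), Δ.ℓ p s ⬝ᵥ θ = 0) →
      ∀ s ∈ (Icc k0 k1) ×ˢ ((Icc i0 i1) ×ˢ (Icc i0 i1)), Δ.m p s ⬝ᵥ θ = 0 := by
  intro p hp θ hl s hs
  by_contra hne
  rw [m_dot] at hne
  have anA : AnalyticOnNhd ℝ (fun z : ℝ × ℝ => Δ.A (p, (z.1, z.2))) (Icc k0 k1 ×ˢ Icc i0 i1) :=
    fun z hz => h.an_A analyticAt_const analyticAt_fst analyticAt_snd hp hz.1 hz.2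
  have anH : AnalyticOnNhd ℝ (fun z : ℝ × ℝ => Δ.H (p, (z.1, z.2)) θ) (Icc k0 k1 ×ˢ Icc i0 i1) :=
    fun z hz => h.an_H analyticAt_const analyticAt_fst analyticAt_snd hp hz.1 hz.2 θ
  have hsub : Ioo k0 k1 ×ˢ Ioo i0 i1 ⊆ Icc k0 k1 ×ˢ Icc i0 i1 :=
    prod_mono Ioo_subset_Icc_self Ioo_subset_Icc_self
  obtain ⟨⟨t0, x0⟩, hz, hAH⟩ : ∃ z ∈ Ioo k0 k1 ×ˢ Ioo i0 i1,
      Δ.A (p, (z.1, z.2)) * Δ.H (p, (z.1, z.2)) θ ≠ 0 := by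
    by_contra hcon
    push Not at hcon
    have : EqOn (fun z : ℝ × ℝ => Δ.A (p, (z.1, z.2)) * Δ.H (p, (z.1, z.2)) θ) (fun _ => 0)
        (Icc k0 k1 ×ˢ Icc i0 i1) :=
      EqOn.of_subset_closure (s := Ioo k0 k1 ×ˢ Ioo i0 i1) hcon
        (anA.continuousOn.mul anH.continuousOn) continuousOn_const hsub
        (by rw [closure_prod_eq, closure_Ioo hk.ne, closure_Ioo hi.ne])
    exact hne (this (x := (s.1, s.2.1)) ⟨hs.1, hs.2.1⟩)
  simp only at hAH
  have hA0 : Δ.A (p, (t0, x0)) ≠ 0 := left_ne_zero_of_mul hAH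
  have hH0 : Δ.H (p, (t0, x0)) θ ≠ 0 := right_ne_zero_of_mul hAH
  have hev1 := (anA (t0, x0) (hsub hz)).continuousAt.eventually_ne hA0
  have hev2 : ∀ᶠ z in nhds (t0, x0), z ∈ Ioo k0 k1 ×ˢ Ioo i0 i1 :=
    (isOpen_Ioo.prod isOpen_Ioo).mem_nhds hz
  obtain ⟨ε, hε, hball⟩ := Metric.eventually_nhds_iff_ball.1 (hev1.and hev2)
  have hbox : ∀ t ∈ Metric.ball t0 ε, ∀ x ∈ Metric.ball x0 ε,
      Δ.A (p, (t, x)) ≠ 0 ∧ (t, x) ∈ Icc k0 k1 ×ˢ Icc i0 i1 := by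
    intro t ht x hx
    have := hball (t, x) (by rw [← ball_prod_same]; exact ⟨ht, hx⟩)
    exact ⟨this.1, hsub this.2⟩
  have ht0 : t0 ∈ Metric.ball t0 ε := Metric.mem_ball_self hε
  have hx0 : x0 ∈ Metric.ball x0 ε := Metric.mem_ball_self hε
  obtain ⟨x1, x2, y1, y2⟩ := p
  obtain ⟨q1, q2, q3, q4⟩ := id hp
  simp only at q1 q2 q3 q4
  have := h3 t0 x0 ε hε (fun z hz => (hbox z.1 hz.1 z.2 hz.2).2)
    (fun x => Δ.N1 x y1 y2 θ / Δ.D x y1 y2) (fun y => Δ.N2 y x1 x2 θ / Δ.D' y x1 x2)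
    (fun t => Δ.H ((x1, x2, y1, y2), (t, x0)) θ / Δ.A ((x1, x2, y1, y2), (t, x0))) ?_ ?_ ?_ ?_
  · exact (div_ne_zero hH0 hA0) this
  · intro x hx
    have hb := hbox t0 ht0 x hx
    have hD := left_ne_zero_of_mul hb.1
    exact (h.an_N1 analyticAt_id analyticAt_const analyticAt_const hb.2.2 (h.hJ q3) (h.hJ q4) θ).div
      (h.an_D analyticAt_id analyticAt_const analyticAt_const hb.2.2 (h.hJ q3) (h.hJ q4)) hD
  · rintro _ ⟨⟨t, x⟩, ⟨ht, hx⟩, rfl⟩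
    have hb := hbox t ht x hx
    have hD := right_ne_zero_of_mul hb.1
    have hm := h.hm _ hb.2
    exact (h.an_N2 analyticAt_id analyticAt_const analyticAt_const hm q1 q2 θ).div
      (h.an_D' analyticAt_id analyticAt_const analyticAt_const hm q1 q2) hD
  · intro t ht
    have hb := hbox t ht x0 hx0
    exact (h.an_H analyticAt_const analyticAt_id analyticAt_const hp hb.2.1 hb.2.2 θ).div
      (h.an_A analyticAt_const analyticAt_id analyticAt_const hp hb.2.1 hb.2.2) hb.1
  · intro t ht x hx
    have hb := hbox t ht x hx
    have hb0 := hbox t ht x0 hx0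
    have e := hl (t, (x, x0)) ⟨hb.2.1, hb.2.2, hb0.2.2⟩
    rw [ℓ_dot] at e
    simp only at e
    have e2 : Δ.H ((x1, x2, y1, y2), (t, x0)) θ / Δ.A ((x1, x2, y1, y2), (t, x0)) =
        Δ.H ((x1, x2, y1, y2), (t, x)) θ / Δ.A ((x1, x2, y1, y2), (t, x)) := by
      rw [div_eq_div_iff hb0.1 hb.1]; linarith
    simp only [e2]
    have d1 : Δ.D x y1 y2 ≠ 0 := left_ne_zero_of_mul hb.1
    have d2 : Δ.D' (Δ.ψ (t, x)) x1 x2 ≠ 0 := right_ne_zero_of_mul hb.1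
    simp only [H, A]
    field_simp
    ring

end Dat
end Macro

namespace Macro
namespace Dat
variable {Δ : Dat}

lemma exists_bd {X : Type*} [TopologicalSpace X] {K : Set X} (hK : IsCompact K) {F : X → ℝ}
    (hF : ContinuousOn F K) : ∃ M, 1 ≤ M ∧ ∀ x ∈ K, |F x| ≤ M := by
  obtain ⟨B, hB⟩ := hK.exists_bound_of_continuousOn hF
  exact ⟨max B 1, le_max_right _ _, fun x hx => (hB x hx).trans (le_max_left _ _)⟩

lemma Good.bd {I J Jp K : Set ℝ} (h : Δ.Good I J Jp K) (hI : IsCompact I) (hJp : IsCompact Jp) :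
    ∃ M, 1 ≤ M ∧ ∀ z ∈ I ×ˢ Jp, |Δ.U z| ≤ M ∧ |Δ.V z| ≤ M ∧ |Δ.P1 z| ≤ M ∧ |Δ.P2 z| ≤ M ∧
      |Δ.Q1 z| ≤ M ∧ |Δ.Q2 z| ≤ M := by
  obtain ⟨M1, a1, b1⟩ := exists_bd (hI.prod hJp) h.hU.continuousOn
  obtain ⟨M2, a2, b2⟩ := exists_bd (hI.prod hJp) h.hV.continuousOn
  obtain ⟨M3, a3, b3⟩ := exists_bd (hI.prod hJp) h.hP1.continuousOn
  obtain ⟨M4, a4, b4⟩ := exists_bd (hI.prod hJp) h.hP2.continuousOn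
  obtain ⟨M5, a5, b5⟩ := exists_bd (hI.prod hJp) h.hQ1.continuousOn
  obtain ⟨M6, a6, b6⟩ := exists_bd (hI.prod hJp) h.hQ2.continuousOn
  refine ⟨M1 + M2 + M3 + M4 + M5 + M6, by linarith, fun z hz => ?_⟩
  have := b1 z hz; have := b2 z hz; have := b3 z hz; have := b4 z hz; have := b5 z hz
  have := b6 z hz
  refine ⟨?_, ?_, ?_, ?_, ?_, ?_⟩ <;> linarith

lemma det_bd {M a b c d : ℝ} (ha : |a| ≤ M) (hb : |b| ≤ M) (hc : |c| ≤ M) (hd : |d| ≤ M) :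
    |a * b - c * d| ≤ 2 * M ^ 2 := by
  have hM : 0 ≤ M := (abs_nonneg a).trans ha
  refine (abs_sub _ _).trans ?_
  rw [abs_mul, abs_mul]
  calc _ ≤ M * M + M * M := by gcongr
    _ = _ := by ring

/-- deducing a power bound -/
lemma solve_pow {C5 β η lam c2 : ℝ} (hC5 : 0 < C5) (hβ : 0 < β) (hη : 0 < η) (hlam : 0 < lam)
    (hc2 : 0 < c2) (h : (c2 * lam ^ 10) ^ β ≤ C5 * η) :
    lam ≤ ((C5 ^ (1 / β) / c2) ^ (1 / 10 : ℝ)) * η ^ (1 / (10 * β)) := by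
  have h1 : c2 * lam ^ 10 ≤ (C5 * η) ^ (1 / β) := by
    have := Real.rpow_le_rpow (by positivity) h (z := 1 / β) (by positivity)
    rwa [← Real.rpow_mul (by positivity), mul_one_div_cancel hβ.ne', Real.rpow_one] at this
  have h2 : lam ^ (10 : ℕ) ≤ (C5 ^ (1 / β) / c2) * η ^ (1 / β) := by
    rw [Real.mul_rpow hC5.le hη.le] at h1
    rw [div_mul_eq_mul_div, le_div_iff₀ hc2]; linarith
  have h3 := Real.rpow_le_rpow (by positivity) h2 (z := (1 / 10 : ℝ)) (by positivity)
  rw [← Real.rpow_natCast lam 10, ← Real.rpow_mul hlam.le,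
    Real.mul_rpow (by positivity) (by positivity), ← Real.rpow_mul hη.le] at h3
  norm_num at h3
  refine h3.trans (le_of_eq ?_)
  congr 2
  · norm_num
  · ring

lemma main_lemma {i0 i1 j0 j1 p0 p1 k0 k1 L : ℝ} (hi : i0 < i1) (hj : j0 < j1) (hk : k0 < k1)
    (hi1 : i1 - i0 ≤ 1) (hj1 : j1 - j0 ≤ 1) (hk1 : k1 - k0 ≤ 1)
    (h : Δ.Good (Icc i0 i1) (Icc j0 j1) (Icc p0 p1) (Icc k0 k1))
    (h3 : Δ.H3 (Icc i0 i1) (Icc k0 k1))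
    (hD : ∃ x ∈ Icc i0 i1, ∃ y1 ∈ Icc j0 j1, ∃ y2 ∈ Icc j0 j1, Δ.D x y1 y2 ≠ 0)
    (hD' : ∃ z ∈ Icc k0 k1 ×ˢ Icc i0 i1, ∃ x1 ∈ Icc i0 i1, ∃ x2 ∈ Icc i0 i1,
      Δ.D' (Δ.ψ z) x1 x2 ≠ 0)
    (hL : 1 ≤ L)
    (hCV : ∀ A : Set (ℝ × ℝ), MeasurableSet A → A ⊆ Icc i0 i1 ×ˢ Icc j0 j1 →
      volume A ≤ ENNReal.ofReal L *
        volume {z : ℝ × ℝ | z ∈ Icc k0 k1 ×ˢ Icc i0 i1 ∧ (z.2, Δ.ψ z) ∈ A}) :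
    ∃ C c : ℝ, 0 < C ∧ 0 < c ∧ ∀ η : ℝ, 0 < η → ∀ S : Set (ℝ × ℝ), MeasurableSet S →
      S ⊆ Icc i0 i1 ×ˢ Icc j0 j1 → ∀ f1 g1 f2 g2 f3 : ℝ → ℝ,
      (∀ z ∈ Icc k0 k1 ×ˢ Icc i0 i1, (z.2, Δ.ψ z) ∈ S →
        |Δ.U (z.2, Δ.ψ z) * f1 z.2 + Δ.V (z.2, Δ.ψ z) * f2 (Δ.ψ z) + f3 z.1| ≤ η ∧
          1 ≤ |f3 z.1|) →
      (∀ z ∈ S, |Δ.P1 z * f1 z.1 + Δ.P2 z * g1 z.1 + Δ.Q1 z * f2 z.2 + Δ.Q2 z * g2 z.2| ≤ η) →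
      volume S ≤ ENNReal.ofReal (C * η ^ c) := by
  set I := Icc i0 i1 with hI
  set J := Icc j0 j1 with hJ
  set Jp := Icc p0 p1 with hJp
  set K := Icc k0 k1 with hK
  have vI : volume I ≤ 1 := by
    rw [hI, Real.volume_Icc]; exact ENNReal.ofReal_le_one.2 hi1
  have vJ : volume J ≤ 1 := by
    rw [hJ, Real.volume_Icc]; exact ENNReal.ofReal_le_one.2 hj1
  have vK : volume K ≤ 1 := by
    rw [hK, Real.volume_Icc]; exact ENNReal.ofReal_le_one.2 hk1
  set KQ : Set (ℝ × (ℝ × ℝ)) := K ×ˢ (I ×ˢ I) with hKQ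
  have cP : IsCompact (KP I J) :=
    isCompact_Icc.prod (isCompact_Icc.prod (isCompact_Icc.prod isCompact_Icc))
  have cQ : IsCompact KQ := isCompact_Icc.prod (isCompact_Icc.prod isCompact_Icc)
  have pP : IsPreconnected (KP I J) :=
    isPreconnected_Icc.prod (isPreconnected_Icc.prod (isPreconnected_Icc.prod isPreconnected_Icc))
  have pQ : IsPreconnected KQ := isPreconnected_Icc.prod (isPreconnected_Icc.prod isPreconnected_Icc)
  obtain ⟨M, hM1, hM⟩ := h.bd isCompact_Icc isCompact_Icc
  have hM0 : 0 ≤ M := by linarith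
  have hh2 : (volume : Measure (ℝ × ℝ)).IsAddHaarMeasure :=
    Measure.prod.instIsAddHaarMeasure (volume : Measure ℝ) (volume : Measure ℝ)
  have hh3 : (volume : Measure (ℝ × (ℝ × ℝ))).IsAddHaarMeasure :=
    Measure.prod.instIsAddHaarMeasure (volume : Measure ℝ) (volume : Measure (ℝ × ℝ))
  have hh4 : (volume : Measure (ℝ × (ℝ × (ℝ × ℝ)))).IsAddHaarMeasure :=
    Measure.prod.instIsAddHaarMeasure (volume : Measure ℝ) (volume : Measure (ℝ × (ℝ × ℝ)))
  have hh7 : ((volume : Measure (ℝ × ℝ × ℝ × ℝ)).prod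
      (volume : Measure (ℝ × (ℝ × ℝ)))).IsAddHaarMeasure :=
    Measure.prod.instIsAddHaarMeasure _ _
  -- generic rank
  have aa : ∀ {w : (ℝ × ℝ × ℝ × ℝ) × (ℝ × (ℝ × ℝ))}, w ∈ KP I J ×ˢ KQ →
      (∀ θ, AnalyticAt ℝ (fun w : (ℝ × ℝ × ℝ × ℝ) × (ℝ × (ℝ × ℝ)) =>
        Δ.H (w.1, (w.2.1, w.2.2.1)) θ) w) ∧ (∀ θ, AnalyticAt ℝ
        (fun w : (ℝ × ℝ × ℝ × ℝ) × (ℝ × (ℝ × ℝ)) => Δ.H (w.1, (w.2.1, w.2.2.2)) θ) w) ∧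
      AnalyticAt ℝ (fun w : (ℝ × ℝ × ℝ × ℝ) × (ℝ × (ℝ × ℝ)) => Δ.A (w.1, (w.2.1, w.2.2.1))) w ∧
      AnalyticAt ℝ (fun w : (ℝ × ℝ × ℝ × ℝ) × (ℝ × (ℝ × ℝ)) => Δ.A (w.1, (w.2.1, w.2.2.2))) w := by
    intro w hw
    have e1 : AnalyticAt ℝ (fun w : (ℝ × ℝ × ℝ × ℝ) × (ℝ × (ℝ × ℝ)) => w.2.1) w :=
      analyticAt_fst.comp analyticAt_snd
    have e2 : AnalyticAt ℝ (fun w : (ℝ × ℝ × ℝ × ℝ) × (ℝ × (ℝ × ℝ)) => w.2.2.1) w :=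
      analyticAt_fst.comp (analyticAt_snd.comp analyticAt_snd)
    have e3 : AnalyticAt ℝ (fun w : (ℝ × ℝ × ℝ × ℝ) × (ℝ × (ℝ × ℝ)) => w.2.2.2) w :=
      analyticAt_snd.comp (analyticAt_snd.comp analyticAt_snd)
    exact ⟨fun θ => h.an_H analyticAt_fst e1 e2 hw.1 hw.2.1 hw.2.2.1 θ,
      fun θ => h.an_H analyticAt_fst e1 e3 hw.1 hw.2.1 hw.2.2.2 θ,
      h.an_A analyticAt_fst e1 e2 hw.1 hw.2.1 hw.2.2.1,
      h.an_A analyticAt_fst e1 e3 hw.1 hw.2.1 hw.2.2.2⟩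
  obtain ⟨C3, N, hC3, hN, hgen⟩ := gen_rank (volume : Measure (ℝ × ℝ × ℝ × ℝ))
    (volume : Measure (ℝ × (ℝ × ℝ))) cP pP cQ pQ Δ.ℓ Δ.m
    (fun k w hw => ((aa hw).2.2.2.mul ((aa hw).1 _)).sub ((aa hw).2.2.1.mul ((aa hw).2.1 _)))
    (fun k w hw => (aa hw).2.2.1.mul ((aa hw).1 _)) (h.ann hi hk h3)
  -- sublevel sets
  obtain ⟨C1, α1, hC1, hα1, hs1⟩ := sublevel_compact
    ((volume : Measure (ℝ × ℝ × ℝ × ℝ)).prod (volume : Measure (ℝ × (ℝ × ℝ))))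
    (G := fun w => Δ.D w.2.2.1 w.1.2.2.1 w.1.2.2.2) (cP.prod cQ) (pP.prod pQ)
    (fun w hw => h.an_D (analyticAt_fst.comp (analyticAt_snd.comp analyticAt_snd))
      (analyticAt_fst.comp (analyticAt_snd.comp (analyticAt_snd.comp analyticAt_fst)))
      (analyticAt_snd.comp (analyticAt_snd.comp (analyticAt_snd.comp analyticAt_fst)))
      hw.2.2.1 (h.hJ hw.1.2.2.1) (h.hJ hw.1.2.2.2))
    (by
      obtain ⟨x, hx, y1, h1, y2, h2, hne⟩ := hD
      exact ⟨((x, x, y1, y2), (k0, x, x)), ⟨⟨hx, hx, h1, h2⟩, ⟨le_rfl, hk.le⟩, hx, hx⟩, hne⟩)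
  obtain ⟨C2, α2, hC2, hα2, hs2⟩ := sublevel_compact
    ((volume : Measure (ℝ × ℝ × ℝ × ℝ)).prod (volume : Measure (ℝ × (ℝ × ℝ))))
    (G := fun w => Δ.D' (Δ.ψ (w.2.1, w.2.2.1)) w.1.1 w.1.2.1) (cP.prod cQ) (pP.prod pQ)
    (fun w hw => h.an_D' (h.an_ψ (analyticAt_fst.comp analyticAt_snd)
      (analyticAt_fst.comp (analyticAt_snd.comp analyticAt_snd)) hw.2.1 hw.2.2.1)
      (analyticAt_fst.comp analyticAt_fst)
      (analyticAt_fst.comp (analyticAt_snd.comp analyticAt_fst))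
      (h.hm (w.2.1, w.2.2.1) ⟨hw.2.1, hw.2.2.1⟩) hw.1.1 hw.1.2.1)
    (by
      obtain ⟨⟨t, x⟩, ⟨ht, hx⟩, x1, h1, x2, h2, hne⟩ := hD'
      exact ⟨((x1, x2, j0, j0), (t, x, x)), ⟨⟨h1, h2, ⟨le_rfl, hj.le⟩, ⟨le_rfl, hj.le⟩⟩,
        ht, hx, hx⟩, hne⟩)
  set α := min α1 α2 with hα
  have hα0 : 0 < α := lt_min hα1 hα2
  set C0 := max C1 (max C2 1) with hC0
  have hC01 : 1 ≤ C0 := (le_max_right _ _).trans (le_max_right _ _)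
  set C4 := C3 * (96 * M ^ 8) + 48 * M ^ 8 with hC4
  set β := 4 / α + N with hβ
  have hβ0 : 0 < β := by positivity
  set k := (1 / (4 * C0)) ^ (4 / α) * (1 / 2) ^ N with hkdef
  have hk0 : 0 < k := by positivity
  set c2 := (1 / (4 ^ 4 * (2 * L))) ^ 2 / 4 with hc2
  have hL0 : 0 < L := by linarith
  have hc20 : 0 < c2 := by positivity
  refine ⟨(((C4 / k) ^ (1 / β) / c2) ^ (1 / 10 : ℝ)), 1 / (10 * β), by positivity, by positivity, ?_⟩
  intro η hη S hS hSs f1 g1 f2 g2 f3 hE0 hE1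
  have vS : volume S ≤ 1 := by
    refine (measure_mono hSs).trans ?_
    rw [Measure.volume_eq_prod, Measure.prod_prod]
    calc volume I * volume J ≤ 1 * 1 := by gcongr
      _ = 1 := one_mul 1
  have hfin : volume S ≠ ∞ := (vS.trans_lt ENNReal.one_lt_top).ne
  rcases eq_or_ne (volume S) 0 with h0 | h0
  · rw [h0]; exact zero_le
  set lam := (volume S).toReal with hlam
  have hlS : ENNReal.ofReal lam = volume S := ENNReal.ofReal_toReal hfin
  have hlam0 : 0 < lam := ENNReal.toReal_pos h0 hfin
  have hlam1 : lam ≤ 1 := by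
    have := ENNReal.toReal_mono ENNReal.one_ne_top vS
    simpa using this
  rw [← hlS]
  apply ENNReal.ofReal_le_ofReal
  apply solve_pow (by positivity) hβ0 hη hlam0 hc20
  have hTm := Tset_meas measurableSet_Icc measurableSet_Icc h.hψ.continuousOn hS
  have hTl := T_lower measurableSet_Icc measurableSet_Icc measurableSet_Icc vI vJ h.hψ.continuousOn
    hS hSs hL0 hlam0 hCV hlS.le
  have vKP : volume (KP I J) ≤ 1 := by
    rw [KP, Measure.volume_eq_prod, Measure.prod_prod, Measure.volume_eq_prod, Measure.prod_prod,
      Measure.volume_eq_prod, Measure.prod_prod]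
    calc volume I * (volume I * (volume J * volume J)) ≤ 1 * (1 * (1 * 1)) := by gcongr
      _ = 1 := by norm_num
  have hTs : ∀ w ∈ Tset K I Δ.ψ S, w.1 ∈ KP I J ∧ w.2.1 ∈ K := by
    rintro w ⟨q0, q1, q2, q3, q4, q5⟩
    exact ⟨⟨(hSs q2).1, (hSs q3).1, (hSs q4).2, (hSs q5).2⟩, q0.1⟩
  have hEl := double_lower volume hTm cP.measurableSet measurableSet_Icc vKP vK hTs
    (by positivity) hTl
  set lam2 := ((lam / 4) ^ 4 * (lam / (2 * L))) ^ 2 / 4 with hlam2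
  have e2 : lam2 = c2 * lam ^ 10 := by
    rw [hlam2, hc2]; field_simp
  rw [← e2]
  have hlam20 : 0 < lam2 := by positivity
  have hlam21 : lam2 ≤ 1 := by
    rw [e2]
    have u1 : c2 ≤ 1 := by
      rw [hc2]
      have : 1 / (4 ^ 4 * (2 * L)) ≤ 1 := by
        rw [div_le_one (by positivity)]; nlinarith
      have := pow_le_one₀ (by positivity) this (n := 2)
      linarith
    have u2 := pow_le_one₀ hlam0.le hlam1 (n := 10)
    exact mul_le_one₀ u1 (by positivity) u2
  set E := {w : (ℝ × ℝ × ℝ × ℝ) × (ℝ × (ℝ × ℝ)) | (w.1, (w.2.1, w.2.2.1)) ∈ Tset K I Δ.ψ S ∧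
    (w.1, (w.2.1, w.2.2.2)) ∈ Tset K I Δ.ψ S} with hE
  have hEm : MeasurableSet E := by
    have m1 : Measurable fun w : (ℝ × ℝ × ℝ × ℝ) × (ℝ × (ℝ × ℝ)) => (w.1, (w.2.1, w.2.2.1)) := by
      fun_prop
    have m2 : Measurable fun w : (ℝ × ℝ × ℝ × ℝ) × (ℝ × (ℝ × ℝ)) => (w.1, (w.2.1, w.2.2.2)) := by
      fun_prop
    exact (m1 hTm).inter (m2 hTm)
  have hEs : E ⊆ KP I J ×ˢ KQ := by
    rintro w ⟨w1, w2⟩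
    exact ⟨(hTs _ w1).1, w1.1.1, w1.1.2, w2.1.2⟩
  set μ := (lam2 / (4 * C0)) ^ (1 / α) with hμ
  have hb0 : 0 < lam2 / (4 * C0) := by positivity
  have hb1 : lam2 / (4 * C0) ≤ 1 := by
    rw [div_le_one (by positivity)]; linarith
  have hμ0 : 0 < μ := by positivity
  have hμ1 : μ ≤ 1 := Real.rpow_le_one hb0.le hb1 (by positivity)
  have hμα : C0 * μ ^ α = lam2 / 4 := by
    rw [hμ, ← Real.rpow_mul hb0.le, one_div_mul_cancel hα0.ne', Real.rpow_one]; field_simp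
  set B1 := {w : (ℝ × ℝ × ℝ × ℝ) × (ℝ × (ℝ × ℝ)) | w ∈ KP I J ×ˢ KQ ∧
    |Δ.D w.2.2.1 w.1.2.2.1 w.1.2.2.2| < μ} with hB1
  set B2 := {w : (ℝ × ℝ × ℝ × ℝ) × (ℝ × (ℝ × ℝ)) | w ∈ KP I J ×ˢ KQ ∧
    |Δ.D' (Δ.ψ (w.2.1, w.2.2.1)) w.1.1 w.1.2.1| < μ} with hB2
  have vB1 : (volume.prod volume) B1 ≤ ENNReal.ofReal (lam2 / 4) := by
    refine (hs1 μ hμ0 hμ1).trans (ENNReal.ofReal_le_ofReal ?_)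
    rw [← hμα]
    exact mul_le_mul (le_max_left _ _) (Real.rpow_le_rpow_of_exponent_ge hμ0 hμ1 (min_le_left _ _))
      (by positivity) (by positivity)
  have vB2 : (volume.prod volume) B2 ≤ ENNReal.ofReal (lam2 / 4) := by
    refine (hs2 μ hμ0 hμ1).trans (ENNReal.ofReal_le_ofReal ?_)
    rw [← hμα]
    exact mul_le_mul ((le_max_left _ _).trans (le_max_right _ _))
      (Real.rpow_le_rpow_of_exponent_ge hμ0 hμ1 (min_le_right _ _))
      (by positivity) (by positivity)
  have mB1 : MeasurableSet B1 := meas_inter_preimage (A := {r : ℝ | |r| < μ})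
    (cP.prod cQ).measurableSet (f := fun w : (ℝ × ℝ × ℝ × ℝ) × (ℝ × (ℝ × ℝ)) =>
      Δ.D w.2.2.1 w.1.2.2.1 w.1.2.2.2)
    (fun w hw => (h.an_D (analyticAt_fst.comp (analyticAt_snd.comp analyticAt_snd))
      (analyticAt_fst.comp (analyticAt_snd.comp (analyticAt_snd.comp analyticAt_fst)))
      (analyticAt_snd.comp (analyticAt_snd.comp (analyticAt_snd.comp analyticAt_fst)))
      hw.2.2.1 (h.hJ hw.1.2.2.1) (h.hJ hw.1.2.2.2)).continuousAt.continuousWithinAt)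
    (measurableSet_lt (by fun_prop) measurable_const)
  have mB2 : MeasurableSet B2 := meas_inter_preimage (A := {r : ℝ | |r| < μ})
    (cP.prod cQ).measurableSet (f := fun w : (ℝ × ℝ × ℝ × ℝ) × (ℝ × (ℝ × ℝ)) =>
      Δ.D' (Δ.ψ (w.2.1, w.2.2.1)) w.1.1 w.1.2.1)
    (fun w hw => (h.an_D' (h.an_ψ (analyticAt_fst.comp analyticAt_snd)
      (analyticAt_fst.comp (analyticAt_snd.comp analyticAt_snd)) hw.2.1 hw.2.2.1)
      (analyticAt_fst.comp analyticAt_fst)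
      (analyticAt_fst.comp (analyticAt_snd.comp analyticAt_fst))
      (h.hm (w.2.1, w.2.2.1) ⟨hw.2.1, hw.2.2.1⟩) hw.1.1 hw.1.2.1).continuousAt.continuousWithinAt)
    (measurableSet_lt (by fun_prop) measurable_const)
  have hE'l : ENNReal.ofReal (lam2 / 2) ≤ (volume.prod volume) (E \ (B1 ∪ B2)) := by
    have u1 : (volume.prod volume) E ≤ (volume.prod volume) (E \ (B1 ∪ B2)) +
        ENNReal.ofReal (lam2 / 2) := by
      have : E ⊆ (E \ (B1 ∪ B2)) ∪ (B1 ∪ B2) := by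
        intro w hw
        by_cases hb : w ∈ B1 ∪ B2
        · exact Or.inr hb
        · exact Or.inl ⟨hw, hb⟩
      refine (measure_mono this).trans ((measure_union_le _ _).trans ?_)
      gcongr
      refine (measure_union_le _ _).trans ((add_le_add vB1 vB2).trans (le_of_eq ?_))
      rw [← ENNReal.ofReal_add (by positivity) (by positivity)]
      congr 1; ring
    have u2 : ENNReal.ofReal lam2 = ENNReal.ofReal (lam2 / 2) + ENNReal.ofReal (lam2 / 2) := by
      rw [← ENNReal.ofReal_add (by positivity) (by positivity)]
      congr 1; ring
    rw [u2] at hEl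
    exact (ENNReal.add_le_add_iff_right (by simp)).1 (hEl.trans u1)
  -- the vector θ
  set θ : (ℝ × ℝ × ℝ × ℝ) → Fin 8 → ℝ := fun p =>
    ![f1 p.1, g1 p.1, f1 p.2.1, g1 p.2.1, f2 p.2.2.1, g2 p.2.2.1, f2 p.2.2.2, g2 p.2.2.2] with hθ
  have happ : ∀ w ∈ Tset K I Δ.ψ S, |Δ.A w * f3 w.2.1 - Δ.H w (θ w.1)| ≤ 12 * M ^ 4 * η ∧
      |Δ.A w| ≤ 4 * M ^ 4 ∧ 1 ≤ |f3 w.2.1| := by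
    rintro w ⟨q0, q1, q2, q3, q4, q5⟩
    have mem : ∀ z ∈ S, z ∈ I ×ˢ Jp := fun z hz => ⟨(hSs hz).1, h.hJ (hSs hz).2⟩
    obtain ⟨a1, a2, a3, a4, a5, a6⟩ := hM _ (mem _ q1)
    obtain ⟨b1, b2, b3, b4, b5, b6⟩ := hM _ (mem _ q2)
    obtain ⟨c1, c2, c3, c4, c5, c6⟩ := hM _ (mem _ q3)
    obtain ⟨d1, d2, d3, d4, d5, d6⟩ := hM _ (mem _ q4)
    obtain ⟨e1, e2, e3, e4, e5, e6⟩ := hM _ (mem _ q5)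
    have bD : |Δ.D w.2.2 w.1.2.2.1 w.1.2.2.2| ≤ 2 * M ^ 2 := det_bd d3 e4 e3 d4
    have bD' : |Δ.D' (Δ.ψ w.2) w.1.1 w.1.2.1| ≤ 2 * M ^ 2 := det_bd b5 c6 c5 b6
    obtain ⟨z1, z2⟩ := hE0 w.2 q0 q1
    refine ⟨approx (g1x := g1 w.2.2) (g2y := g2 (Δ.ψ w.2)) hM0 hη.le a1 a2 d4 e4 b6 c6 bD bD' z1
      (hE1 _ q4) (hE1 _ q5) (hE1 _ q2) (hE1 _ q3), ?_, z2⟩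
    rw [A, abs_mul]
    calc _ ≤ 2 * M ^ 2 * (2 * M ^ 2) := by gcongr
      _ = _ := by ring
  obtain ⟨w, hw, hwm⟩ := hgen (lam2 / 2) (by positivity) (by linarith) (E \ (B1 ∪ B2))
    (hEm.diff (mB1.union mB2)) (fun w hw => hEs hw.1) hE'l θ (96 * M ^ 8 * η) (by positivity) (by
      rintro w ⟨⟨w1, w2⟩, -⟩
      obtain ⟨r1, r2, -⟩ := happ _ w1
      obtain ⟨r3, r4, -⟩ := happ _ w2
      rw [ℓ_dot]
      simp only at r1 r2 r3 r4
      have : Δ.A (w.1, (w.2.1, w.2.2.2)) * Δ.H (w.1, (w.2.1, w.2.2.1)) (θ w.1) -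
          Δ.A (w.1, (w.2.1, w.2.2.1)) * Δ.H (w.1, (w.2.1, w.2.2.2)) (θ w.1) =
          Δ.A (w.1, (w.2.1, w.2.2.1)) * (Δ.A (w.1, (w.2.1, w.2.2.2)) * f3 w.2.1 -
            Δ.H (w.1, (w.2.1, w.2.2.2)) (θ w.1)) -
          Δ.A (w.1, (w.2.1, w.2.2.2)) * (Δ.A (w.1, (w.2.1, w.2.2.1)) * f3 w.2.1 -
            Δ.H (w.1, (w.2.1, w.2.2.1)) (θ w.1)) := by ring
      rw [this]
      refine (abs_sub _ _).trans ?_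
      rw [abs_mul, abs_mul]
      calc _ ≤ 4 * M ^ 4 * (12 * M ^ 4 * η) + 4 * M ^ 4 * (12 * M ^ 4 * η) := by gcongr
        _ = _ := by ring)
  obtain ⟨⟨w1, w2⟩, hwB⟩ := hw
  obtain ⟨r1, r2, r3⟩ := happ _ w1
  rw [m_dot] at hwm
  simp only at r1 r2 r3
  set Aw := Δ.A (w.1, (w.2.1, w.2.2.1)) with hAw
  have hwE : w ∈ KP I J ×ˢ KQ := hEs ⟨w1, w2⟩
  have g1 : μ ≤ |Δ.D w.2.2.1 w.1.2.2.1 w.1.2.2.2| := by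
    by_contra hcon
    exact hwB (Or.inl ⟨hwE, not_le.1 hcon⟩)
  have g2 : μ ≤ |Δ.D' (Δ.ψ (w.2.1, w.2.2.1)) w.1.1 w.1.2.1| := by
    by_contra hcon
    exact hwB (Or.inr ⟨hwE, not_le.1 hcon⟩)
  have g3 : μ * μ ≤ |Aw| := by
    rw [hAw, A, abs_mul]
    gcongr
  have g4 : |Aw| * |Aw| ≤ C3 * (96 * M ^ 8 * η) * (lam2 / 2) ^ (-N) + 48 * M ^ 8 * η := by
    have v1 : |Aw * (Aw * f3 w.2.1)| ≤ |Aw * Δ.H (w.1, (w.2.1, w.2.2.1)) (θ w.1)| +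
        |Aw * (Aw * f3 w.2.1 - Δ.H (w.1, (w.2.1, w.2.2.1)) (θ w.1))| := by
      refine le_trans (le_of_eq ?_) (abs_add_le _ _)
      congr 1; ring
    have v2 : |Aw * (Aw * f3 w.2.1 - Δ.H (w.1, (w.2.1, w.2.2.1)) (θ w.1))| ≤
        4 * M ^ 4 * (12 * M ^ 4 * η) := by
      rw [abs_mul]; gcongr
    have v3 : |Aw| * |Aw| ≤ |Aw * (Aw * f3 w.2.1)| := by
      rw [abs_mul, abs_mul, ← mul_assoc]
      exact le_mul_of_one_le_right (by positivity) r3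
    have v4 : 4 * M ^ 4 * (12 * M ^ 4 * η) = 48 * M ^ 8 * η := by ring
    linarith
  have g5 : (1 : ℝ) ≤ (lam2 / 2) ^ (-N) := by
    apply Real.one_le_rpow_of_pos_of_le_one_of_nonpos <;> linarith
  have g6 : μ ^ 4 ≤ C4 * η * (lam2 / 2) ^ (-N) := by
    calc μ ^ 4 = (μ * μ) * (μ * μ) := by ring
      _ ≤ |Aw| * |Aw| := by gcongr
      _ ≤ _ := g4
      _ ≤ C3 * (96 * M ^ 8 * η) * (lam2 / 2) ^ (-N) + 48 * M ^ 8 * η * (lam2 / 2) ^ (-N) := by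
          exact add_le_add le_rfl (le_mul_of_one_le_right (by positivity) g5)
      _ = _ := by rw [hC4]; ring
  have g7 : μ ^ 4 * (lam2 / 2) ^ N = k * lam2 ^ β := by
    have w1 : μ ^ 4 = (1 / (4 * C0)) ^ (4 / α) * lam2 ^ (4 / α) := by
      rw [hμ, ← Real.rpow_natCast, ← Real.rpow_mul hb0.le, ← Real.mul_rpow (by positivity)
        (by positivity)]
      congr 1
      · field_simp
      · push_cast; ring
    have w2 : (lam2 / 2) ^ N = (1 / 2) ^ N * lam2 ^ N := by
      rw [← Real.mul_rpow (by positivity) (by positivity)]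
      congr 1; ring
    rw [w1, w2, hβ, Real.rpow_add hlam20, hkdef]; ring
  have g8 : k * lam2 ^ β ≤ C4 * η := by
    rw [← g7]
    calc μ ^ 4 * (lam2 / 2) ^ N ≤ C4 * η * (lam2 / 2) ^ (-N) * (lam2 / 2) ^ N := by gcongr
      _ = C4 * η := by
        rw [mul_assoc, ← Real.rpow_add (by positivity), neg_add_cancel, Real.rpow_zero, mul_one]
  rw [div_mul_eq_mul_div, le_div_iff₀ hk0]
  linarith

end Dat
end Macro

namespace Macro

/-- explicit representation of a piecewise affine function -/
structure Rep (f : ℝ → ℝ) (b : ℝ) (m q : ℤ → ℝ) (δ M : ℝ) : Prop where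
  hm : ∀ n, |m n| ≤ M
  hf : ∀ y, f y = m ⌊(y - b) / δ⌋ * y + q ⌊(y - b) / δ⌋
  hb : ∀ y, |f y| ≤ 3

lemma exists_rep {f : ℝ → ℝ} {δ M : ℝ} (h : AffineOnIntervals f δ M) (hδ : 0 < δ)
    (hM : M * δ ≤ 1) (hae : ∀ᵐ y ∂(volume : Measure ℝ), |f y| ≤ 2) :
    ∃ b m q, Rep f b m q δ M := by
  obtain ⟨b, hb⟩ := h
  choose m q hm hq using hb
  have hmem : ∀ y : ℝ, y ∈ Ico (b + (⌊(y - b) / δ⌋ : ℝ) * δ) (b + ((⌊(y - b) / δ⌋ : ℝ) + 1) * δ) := by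
    intro y
    have h1 := Int.floor_le ((y - b) / δ)
    have h2 := Int.lt_floor_add_one ((y - b) / δ)
    rw [le_div_iff₀ hδ] at h1
    rw [div_lt_iff₀ hδ] at h2
    constructor <;> linarith
  refine ⟨b, m, q, hm, fun y => hq _ y (hmem y), fun y => ?_⟩
  set n := ⌊(y - b) / δ⌋ with hn
  set A := Ico (b + (n : ℝ) * δ) (b + ((n : ℝ) + 1) * δ) with hA
  have hpos : volume A ≠ 0 := by
    rw [hA, Real.volume_Ico]
    simp only [ne_eq, ENNReal.ofReal_eq_zero, not_le]
    linarith
  obtain ⟨y', hy', hy2⟩ : ∃ y' ∈ A, |f y'| ≤ 2 := by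
    by_contra hcon
    push Not at hcon
    apply hpos
    refine measure_mono_null ?_ (ae_iff.1 hae)
    intro z hz
    exact not_le.2 (hcon z hz)
  have e1 := hq n y (hmem y)
  have e2 := hq n y' hy'
  have e3 : |y - y'| ≤ δ := by
    have h1 := hmem y
    have h2 := hy'
    simp only [hA, mem_Ico, ← hn] at h1 h2
    rw [abs_le]; constructor <;> linarith
  have e4 : f y = f y' + m n * (y - y') := by rw [e1, e2]; ring
  rw [e4]
  refine (abs_add_le _ _).trans ?_
  rw [abs_mul]
  have : |m n| * |y - y'| ≤ M * δ := mul_le_mul (hm n) e3 (abs_nonneg _) ((abs_nonneg _).trans (hm n))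
  linarith

lemma floor_eq_of_parity {u v δ b : ℝ} (hδ : 0 < δ) (h : |u - v| < δ)
    (hp : Even ⌊(u - b) / δ⌋ ↔ Even ⌊(v - b) / δ⌋) : ⌊(u - b) / δ⌋ = ⌊(v - b) / δ⌋ := by
  have h1 : |(u - b) / δ - (v - b) / δ| < 1 := by
    rw [← sub_div, abs_div, abs_of_pos hδ, div_lt_one hδ]
    have : u - b - (v - b) = u - v := by ring
    rw [this]; exact h
  set a := (u - b) / δ
  set c := (v - b) / δ
  have a1 := Int.floor_le a
  have a2 := Int.lt_floor_add_one a
  have c1 := Int.floor_le c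
  have c2 := Int.lt_floor_add_one c
  rw [abs_lt] at h1
  have d1 : (⌊a⌋ : ℝ) - ⌊c⌋ < 2 := by linarith
  have d2 : -2 < (⌊a⌋ : ℝ) - ⌊c⌋ := by linarith
  have d1' : ⌊a⌋ - ⌊c⌋ < 2 := by exact_mod_cast d1
  have d2' : -2 < ⌊a⌋ - ⌊c⌋ := by exact_mod_cast d2
  rw [Int.even_iff, Int.even_iff] at hp
  omega

/-- bounds for one-dimensional data along a fibre -/
structure Fib (u u' v v' ps w : ℝ → ℝ) (I : Set ℝ) (Λ : ℝ) : Prop where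
  du : ∀ x ∈ I, HasDerivAt u (u' x) x
  dv : ∀ x ∈ I, HasDerivAt v (v' x) x
  dp : ∀ x ∈ I, ∃ p', HasDerivAt ps p' x ∧ w x = v x * p'
  bu' : ∀ x ∈ I, |u' x| ≤ Λ
  bv' : ∀ x ∈ I, |v' x| ≤ Λ
  lu : ∀ x ∈ I, ∀ y ∈ I, |u x - u y| ≤ Λ * |x - y|
  lu' : ∀ x ∈ I, ∀ y ∈ I, |u' x - u' y| ≤ Λ * |x - y|
  lv' : ∀ x ∈ I, ∀ y ∈ I, |v' x - v' y| ≤ Λ * |x - y|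
  lp : ∀ x ∈ I, ∀ y ∈ I, |ps x - ps y| ≤ Λ * |x - y|
  lw : ∀ x ∈ I, ∀ y ∈ I, |w x - w y| ≤ Λ * |x - y|

lemma Fib.lip {u u' v v' ps w : ℝ → ℝ} {I : Set ℝ} {Λ : ℝ} (h : Fib u u' v v' ps w I Λ)
    (hΛ : 1 ≤ Λ) {M m1 q1 m2 q2 : ℝ} (hM : 1 ≤ M) (h1 : |m1| ≤ M) (h2 : |m2| ≤ M)
    (hI : ∀ x ∈ I, ∀ y ∈ I, |x - y| ≤ 1) {xs : ℝ} (hxs : xs ∈ I) (b1 : |m1 * xs + q1| ≤ 3)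
    (b2 : |m2 * ps xs + q2| ≤ 3) :
    ∀ x ∈ I, ∀ y ∈ I, |(u' x * (m1 * x + q1) + u x * m1 + v' x * (m2 * ps x + q2) + w x * m2) -
      (u' y * (m1 * y + q1) + u y * m1 + v' y * (m2 * ps y + q2) + w y * m2)| ≤
      12 * Λ ^ 2 * M * |x - y| := by
  intro x hx y hy
  have hΛ0 : 0 ≤ Λ := by linarith
  have hM0 : 0 ≤ M := by linarith
  have c1 : |m1 * x + q1| ≤ 3 + M := by
    have : m1 * x + q1 = (m1 * xs + q1) + m1 * (x - xs) := by ring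
    rw [this]
    refine (abs_add_le _ _).trans ?_
    rw [abs_mul]
    have := mul_le_mul h1 (hI x hx xs hxs) (abs_nonneg _) hM0
    linarith
  have c2 : |m2 * ps x + q2| ≤ 3 + M * Λ := by
    have : m2 * ps x + q2 = (m2 * ps xs + q2) + m2 * (ps x - ps xs) := by ring
    rw [this]
    refine (abs_add_le _ _).trans ?_
    rw [abs_mul]
    have h5 : |ps x - ps xs| ≤ Λ := (h.lp x hx xs hxs).trans (by
      have := hI x hx xs hxs
      nlinarith)
    have := mul_le_mul h2 h5 (abs_nonneg _) hM0
    linarith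
  have e : (u' x * (m1 * x + q1) + u x * m1 + v' x * (m2 * ps x + q2) + w x * m2) -
      (u' y * (m1 * y + q1) + u y * m1 + v' y * (m2 * ps y + q2) + w y * m2) =
      ((u' x - u' y) * (m1 * x + q1) + u' y * (m1 * (x - y))) + (u x - u y) * m1 +
      ((v' x - v' y) * (m2 * ps x + q2) + v' y * (m2 * (ps x - ps y))) + (w x - w y) * m2 := by ring
  rw [e]
  set d := |x - y| with hd
  have hd0 : 0 ≤ d := abs_nonneg _
  have t1 : |(u' x - u' y) * (m1 * x + q1)| ≤ Λ * d * (3 + M) := by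
    rw [abs_mul]; exact mul_le_mul (h.lu' x hx y hy) c1 (abs_nonneg _) (by positivity)
  have t2 : |u' y * (m1 * (x - y))| ≤ Λ * (M * d) := by
    rw [abs_mul, abs_mul]
    exact mul_le_mul (h.bu' y hy) (mul_le_mul_of_nonneg_right h1 hd0) (by positivity) hΛ0
  have t3 : |(u x - u y) * m1| ≤ Λ * d * M := by
    rw [abs_mul]; exact mul_le_mul (h.lu x hx y hy) h1 (abs_nonneg _) (by positivity)
  have t4 : |(v' x - v' y) * (m2 * ps x + q2)| ≤ Λ * d * (3 + M * Λ) := by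
    rw [abs_mul]; exact mul_le_mul (h.lv' x hx y hy) c2 (abs_nonneg _) (by positivity)
  have t5 : |v' y * (m2 * (ps x - ps y))| ≤ Λ * (M * (Λ * d)) := by
    rw [abs_mul, abs_mul]
    exact mul_le_mul (h.bv' y hy) (mul_le_mul h2 (h.lp x hx y hy) (abs_nonneg _) hM0)
      (by positivity) hΛ0
  have t6 : |(w x - w y) * m2| ≤ Λ * d * M := by
    rw [abs_mul]; exact mul_le_mul (h.lw x hx y hy) h2 (abs_nonneg _) (by positivity)
  have tot : Λ * d * (3 + M) + Λ * (M * d) + Λ * d * M + (Λ * d * (3 + M * Λ) +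
      Λ * (M * (Λ * d))) + Λ * d * M ≤ 12 * Λ ^ 2 * M * d := by
    have k1 : Λ * d ≤ Λ * M * d := by
      have : 0 ≤ Λ * d := by positivity
      nlinarith
    have k2 : Λ * M * d ≤ Λ ^ 2 * M * d := by
      have : 0 ≤ Λ * M * d := by positivity
      nlinarith
    nlinarith
  have := abs_add_le ((u' x - u' y) * (m1 * x + q1) + u' y * (m1 * (x - y)) + (u x - u y) * m1 +
      ((v' x - v' y) * (m2 * ps x + q2) + v' y * (m2 * (ps x - ps y)))) ((w x - w y) * m2)
  have := abs_add_le ((u' x - u' y) * (m1 * x + q1) + u' y * (m1 * (x - y)) + (u x - u y) * m1)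
      ((v' x - v' y) * (m2 * ps x + q2) + v' y * (m2 * (ps x - ps y)))
  have := abs_add_le ((u' x - u' y) * (m1 * x + q1) + u' y * (m1 * (x - y))) ((u x - u y) * m1)
  have := abs_add_le ((u' x - u' y) * (m1 * x + q1)) (u' y * (m1 * (x - y)))
  have := abs_add_le ((v' x - v' y) * (m2 * ps x + q2)) (v' y * (m2 * (ps x - ps y)))
  linarith

lemma Fib.bad {u u' v v' ps w : ℝ → ℝ} {i0 i1 Λ : ℝ} (hi : i0 ≤ i1) (hi1 : i1 - i0 ≤ 1)
    (h : Fib u u' v v' ps w (Icc i0 i1) Λ)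
    (hΛ : 1 ≤ Λ) {δ M : ℝ} (hM : 1 ≤ M) (hδ : 0 < δ) (hδ1 : δ ≤ 1)
    {f1 f2 : ℝ → ℝ} {b1 b2 : ℝ} {m1 q1 m2 q2 : ℤ → ℝ} (r1 : Rep f1 b1 m1 q1 δ M)
    (r2 : Rep f2 b2 m2 q2 δ M) (c : ℝ) {ε η : ℝ} (hε : 0 ≤ ε) (hη : 0 < η)
    (hMη : M * δ ≤ η) {B : Set ℝ} (hB : B ⊆ Icc i0 i1)
    (hB1 : ∀ x ∈ B, |u x * f1 x + v x * f2 (ps x) + c| ≤ ε)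
    (hB2 : ∀ x ∈ B, η ≤ |u' x * f1 x + u x * m1 ⌊(x - b1) / δ⌋ + v' x * f2 (ps x) +
      w x * m2 ⌊(ps x - b2) / δ⌋|) :
    volume B ≤ ENNReal.ofReal (768 * Λ ^ 2 * ε / (η * δ)) := by
  set s := δ / (24 * Λ ^ 2) with hs
  have hΛ0 : 0 < Λ := by linarith
  have hs0 : 0 < s := by positivity
  have hΛ2 : 1 ≤ Λ ^ 2 := one_le_pow₀ hΛ
  have hs1 : s ≤ δ / 24 := by
    rw [hs]; gcongr; linarith
  have hsΛ : Λ * s < δ := by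
    have : Λ * s = δ / (24 * Λ) := by rw [hs]; field_simp
    rw [this, div_lt_iff₀ (by positivity)]
    nlinarith
  let cl : Prop × Prop → Set ℝ := fun k => {x | x ∈ B ∧ (Even ⌊(x - b1) / δ⌋ ↔ k.1) ∧
    (Even ⌊(ps x - b2) / δ⌋ ↔ k.2)}
  have hcl : ∀ k, volume (cl k) ≤ ENNReal.ofReal (((i1 - i0) / s + 1) * (4 * ε / η)) := by
    intro k
    refine vol_local_diam hi hs0 (by positivity) (fun x hx => hB hx.1) ?_
    intro x hx y hy hxy
    have hxI := hB hx.1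
    have hyI := hB hy.1
    have n1 : ⌊(x - b1) / δ⌋ = ⌊(y - b1) / δ⌋ :=
      floor_eq_of_parity hδ (by linarith) (hx.2.1.trans hy.2.1.symm)
    have n2 : ⌊(ps x - b2) / δ⌋ = ⌊(ps y - b2) / δ⌋ :=
      floor_eq_of_parity hδ ((h.lp x hxI y hyI).trans_lt
        ((mul_le_mul_of_nonneg_left hxy hΛ0.le).trans_lt hsΛ)) (hx.2.2.trans hy.2.2.symm)
    set k1 := ⌊(x - b1) / δ⌋ with hk1
    set k2 := ⌊(ps x - b2) / δ⌋ with hk2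
    have fx1 : f1 x = m1 k1 * x + q1 k1 := r1.hf x
    have fx2 : f2 (ps x) = m2 k2 * ps x + q2 k2 := r2.hf (ps x)
    have fy1 : f1 y = m1 k1 * y + q1 k1 := by rw [r1.hf y, ← n1]
    have fy2 : f2 (ps y) = m2 k2 * ps y + q2 k2 := by rw [r2.hf (ps y), ← n2]
    have lip := h.lip hΛ hM (r1.hm k1) (r2.hm k2) (q1 := q1 k1) (q2 := q2 k2) (by
      intro a ha b hb
      rw [abs_le]; constructor <;> linarith [ha.1, ha.2, hb.1, hb.2]) hxI
      (by rw [← fx1]; exact r1.hb x) (by rw [← fx2]; exact r2.hb _)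
    refine close_of_deriv (g := fun x => u x * (m1 k1 * x + q1 k1) +
        v x * (m2 k2 * ps x + q2 k2) + c)
      (g' := fun x => u' x * (m1 k1 * x + q1 k1) + u x * m1 k1 + v' x * (m2 k2 * ps x + q2 k2) +
        w x * m2 k2) (convex_Icc i0 i1) (M := 12 * Λ ^ 2 * M) (η := η) ?_ lip hη (by positivity) ?_
      hxI hyI hxy ?_ ?_ ?_
    · intro z hz
      obtain ⟨p', dp, hw⟩ := h.dp z hz
      have d1 : HasDerivAt (fun x => m1 k1 * x + q1 k1) (m1 k1) z := by
        simpa using ((hasDerivAt_id z).const_mul (m1 k1)).add_const (q1 k1)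
      have d2 : HasDerivAt (fun x => m2 k2 * ps x + q2 k2) (m2 k2 * p') z :=
        (dp.const_mul (m2 k2)).add_const (q2 k2)
      have d3 := (((h.du z hz).mul d1).add ((h.dv z hz).mul d2)).add_const c
      refine HasDerivAt.hasDerivWithinAt (d3.congr_deriv ?_)
      rw [hw]; ring
    · have : 12 * Λ ^ 2 * M * s = M * δ / 2 := by rw [hs]; field_simp; norm_num
      rw [this]; linarith
    · have := hB1 x hx.1
      rwa [fx1, fx2] at this
    · have := hB1 y hy.1
      rwa [fy1, fy2] at this
    · have := hB2 x hx.1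
      rwa [fx1, fx2] at this
  have hBu : B ⊆ (cl (True, True) ∪ cl (True, False)) ∪ (cl (False, True) ∪ cl (False, False)) := by
    intro x hx
    by_cases p1 : Even ⌊(x - b1) / δ⌋ <;> by_cases p2 : Even ⌊(ps x - b2) / δ⌋
    · exact Or.inl (Or.inl ⟨hx, by simpa using p1, by simpa using p2⟩)
    · exact Or.inl (Or.inr ⟨hx, by simpa using p1, by simpa using p2⟩)
    · exact Or.inr (Or.inl ⟨hx, by simpa using p1, by simpa using p2⟩)
    · exact Or.inr (Or.inr ⟨hx, by simpa using p1, by simpa using p2⟩)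
  set X := ((i1 - i0) / s + 1) * (4 * ε / η) with hX
  have hX0 : 0 ≤ X := by
    have : 0 ≤ i1 - i0 := by linarith
    positivity
  have hvol : volume B ≤ ENNReal.ofReal (4 * X) := by
    calc volume B ≤ _ := measure_mono hBu
      _ ≤ (ENNReal.ofReal X + ENNReal.ofReal X) + (ENNReal.ofReal X + ENNReal.ofReal X) :=
        (measure_union_le _ _).trans (add_le_add
          ((measure_union_le _ _).trans (add_le_add (hcl _) (hcl _)))
          ((measure_union_le _ _).trans (add_le_add (hcl _) (hcl _))))
      _ = ENNReal.ofReal (4 * X) := by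
        rw [← ENNReal.ofReal_add hX0 hX0, ← ENNReal.ofReal_add (by positivity) (by positivity)]
        congr 1; ring
  refine hvol.trans (ENNReal.ofReal_le_ofReal ?_)
  have h6 : (i1 - i0) / s + 1 ≤ 48 * Λ ^ 2 / δ := by
    have a1 : (i1 - i0) / s ≤ 1 / s := by gcongr
    have a2 : (1 : ℝ) ≤ 1 / s := by rw [le_div_iff₀ hs0]; linarith
    have a3 : 1 / s = 24 * Λ ^ 2 / δ := by rw [hs]; field_simp
    have a4 : 48 * Λ ^ 2 / δ = 24 * Λ ^ 2 / δ + 24 * Λ ^ 2 / δ := by ring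
    linarith
  calc 4 * X ≤ 4 * ((48 * Λ ^ 2 / δ) * (4 * ε / η)) := by rw [hX]; gcongr
    _ = _ := by field_simp; ring

end Macro

namespace Macro

lemma lip_of_an {G : ℝ × ℝ → ℝ} {s : Set (ℝ × ℝ)} (hs : IsCompact s) (hc : Convex ℝ s)
    (hG : AnalyticOnNhd ℝ G s) : ∃ Λ, 1 ≤ Λ ∧ (∀ z ∈ s, |G z| ≤ Λ) ∧
      ∀ z ∈ s, ∀ w ∈ s, |G z - G w| ≤ Λ * ‖z - w‖ := by
  obtain ⟨A, hA1, hA⟩ := Dat.exists_bd hs hG.continuousOn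
  obtain ⟨B, hB1, hB⟩ := Dat.exists_bd hs hG.fderiv.continuousOn.norm
  refine ⟨A + B, by linarith, fun z hz => (hA z hz).trans (by linarith), fun z hz w hw => ?_⟩
  have := hc.norm_image_sub_le_of_norm_hasFDerivWithin_le (f := G) (f' := fderiv ℝ G) (C := B)
    (fun x hx => (hG x hx).differentiableAt.hasFDerivAt.hasFDerivWithinAt)
    (fun x hx => (le_abs_self _).trans (hB x hx)) hw hz
  rw [Real.norm_eq_abs] at this
  refine this.trans ?_
  gcongr; linarith

namespace Dat
variable {Δ : Dat}

/-- derivative identities along the fibres -/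
structure Der (Δ : Dat) (I K : Set ℝ) (R : ℝ × ℝ → ℝ) : Prop where
  dU : ∀ z ∈ K ×ˢ I, HasDerivAt (fun x => Δ.U (x, Δ.ψ (z.1, x))) (Δ.P1 (z.2, Δ.ψ z)) z.2
  dV : ∀ z ∈ K ×ˢ I, HasDerivAt (fun x => Δ.V (x, Δ.ψ (z.1, x))) (Δ.Q1 (z.2, Δ.ψ z)) z.2
  dψ : ∀ z ∈ K ×ˢ I, HasDerivAt (fun x => Δ.ψ (z.1, x)) (R (z.2, Δ.ψ z)) z.2
  hP2 : ∀ z, Δ.P2 z = Δ.U z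
  hQ2 : ∀ z, Δ.Q2 z = Δ.V z * R z

lemma Good.fib {i0 i1 k0 k1 : ℝ} {J Jp : Set ℝ} {R : ℝ × ℝ → ℝ}
    (h : Δ.Good (Icc i0 i1) J Jp (Icc k0 k1)) (hd : Δ.Der (Icc i0 i1) (Icc k0 k1) R) :
    ∃ Λ, 1 ≤ Λ ∧ ∀ t ∈ Icc k0 k1, Fib (fun x => Δ.U (x, Δ.ψ (t, x)))
      (fun x => Δ.P1 (x, Δ.ψ (t, x))) (fun x => Δ.V (x, Δ.ψ (t, x)))
      (fun x => Δ.Q1 (x, Δ.ψ (t, x))) (fun x => Δ.ψ (t, x)) (fun x => Δ.Q2 (x, Δ.ψ (t, x)))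
      (Icc i0 i1) Λ := by
  set s := Icc k0 k1 ×ˢ Icc i0 i1 with hs
  have cs : IsCompact s := isCompact_Icc.prod isCompact_Icc
  have cc : Convex ℝ s := (convex_Icc _ _).prod (convex_Icc _ _)
  have key : ∀ F : ℝ × ℝ → ℝ, AnalyticOnNhd ℝ F (Icc i0 i1 ×ˢ Jp) →
      AnalyticOnNhd ℝ (fun z : ℝ × ℝ => F (z.2, Δ.ψ z)) s := fun F hF z hz =>
    an_comp (hF _ ⟨hz.2, h.hm z hz⟩) analyticAt_snd (h.hψ z hz)
  obtain ⟨L1, a1, b1, c1⟩ := lip_of_an cs cc (key _ h.hU)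
  obtain ⟨L2, a2, b2, c2⟩ := lip_of_an cs cc (key _ h.hP1)
  obtain ⟨L3, a3, b3, c3⟩ := lip_of_an cs cc (key _ h.hQ1)
  obtain ⟨L4, a4, b4, c4⟩ := lip_of_an cs cc (key _ h.hQ2)
  obtain ⟨L5, a5, b5, c5⟩ := lip_of_an cs cc h.hψ
  have nrm : ∀ t x y : ℝ, ‖((t, x) : ℝ × ℝ) - (t, y)‖ = |x - y| := by
    intro t x y
    simp [Prod.norm_def]
  have li : ∀ {G : ℝ × ℝ → ℝ} {Λ0 : ℝ}, (∀ z ∈ s, ∀ w ∈ s, |G z - G w| ≤ Λ0 * ‖z - w‖) →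
      Λ0 ≤ L1 + L2 + L3 + L4 + L5 → ∀ t ∈ Icc k0 k1, ∀ x ∈ Icc i0 i1, ∀ y ∈ Icc i0 i1,
      |G (t, x) - G (t, y)| ≤ (L1 + L2 + L3 + L4 + L5) * |x - y| := by
    intro G Λ0 hG hle t ht x hx y hy
    refine (hG (t, x) ⟨ht, hx⟩ (t, y) ⟨ht, hy⟩).trans ?_
    rw [nrm]
    gcongr
  refine ⟨L1 + L2 + L3 + L4 + L5, by linarith, fun t ht => ⟨?_, ?_, ?_, ?_, ?_, ?_, ?_, ?_, ?_, ?_⟩⟩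
  · exact fun x hx => hd.dU (t, x) ⟨ht, hx⟩
  · exact fun x hx => hd.dV (t, x) ⟨ht, hx⟩
  · exact fun x hx => ⟨_, hd.dψ (t, x) ⟨ht, hx⟩, hd.hQ2 _⟩
  · exact fun x hx => (b2 (t, x) ⟨ht, hx⟩).trans (by linarith)
  · exact fun x hx => (b3 (t, x) ⟨ht, hx⟩).trans (by linarith)
  · exact li c1 (by linarith) t ht
  · exact li c2 (by linarith) t ht
  · exact li c3 (by linarith) t ht
  · exact li c5 (by linarith) t ht
  · exact li c4 (by linarith) t ht

lemma bad_est {i0 i1 k0 k1 L Λ : ℝ} {J Jp : Set ℝ} (hi : i0 < i1)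
    (hi1 : i1 - i0 ≤ 1) (hk1 : k1 - k0 ≤ 1)
    (h : Δ.Good (Icc i0 i1) J Jp (Icc k0 k1)) (hP2 : ∀ z, Δ.P2 z = Δ.U z)
    (hΛ : 1 ≤ Λ) (hfib : ∀ t ∈ Icc k0 k1, Fib (fun x => Δ.U (x, Δ.ψ (t, x)))
      (fun x => Δ.P1 (x, Δ.ψ (t, x))) (fun x => Δ.V (x, Δ.ψ (t, x)))
      (fun x => Δ.Q1 (x, Δ.ψ (t, x))) (fun x => Δ.ψ (t, x)) (fun x => Δ.Q2 (x, Δ.ψ (t, x)))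
      (Icc i0 i1) Λ) (hL : 1 ≤ L)
    (hCV : ∀ A : Set (ℝ × ℝ), MeasurableSet A → A ⊆ Icc i0 i1 ×ˢ J →
      volume A ≤ ENNReal.ofReal L *
        volume {z : ℝ × ℝ | z ∈ Icc k0 k1 ×ˢ Icc i0 i1 ∧ (z.2, Δ.ψ z) ∈ A})
    {δ M ε η : ℝ} (hM : 1 ≤ M) (hδ : 0 < δ) (hδ1 : δ ≤ 1) (hε : 0 ≤ ε) (hη : 0 < η)
    (hMη : M * δ ≤ η) {f1 f2 f3 : ℝ → ℝ} {b1 b2 : ℝ} {m1 q1 m2 q2 : ℤ → ℝ}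
    (r1 : Rep f1 b1 m1 q1 δ M) (r2 : Rep f2 b2 m2 q2 δ M) {S : Set (ℝ × ℝ)}
    (hS : MeasurableSet S) (hSI : S ⊆ Icc i0 i1 ×ˢ J)
    (hS1 : ∀ z ∈ Icc k0 k1 ×ˢ Icc i0 i1, (z.2, Δ.ψ z) ∈ S →
        |Δ.U (z.2, Δ.ψ z) * f1 z.2 + Δ.V (z.2, Δ.ψ z) * f2 (Δ.ψ z) + f3 z.1| ≤ ε)
    (hS2 : ∀ z ∈ S, η ≤ |Δ.P1 z * f1 z.1 + Δ.P2 z * m1 ⌊(z.1 - b1) / δ⌋ + Δ.Q1 z * f2 z.2 +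
      Δ.Q2 z * m2 ⌊(z.2 - b2) / δ⌋|) :
    volume S ≤ ENNReal.ofReal (L * (768 * Λ ^ 2 * ε / (η * δ))) := by
  rw [ENNReal.ofReal_mul (by linarith)]
  refine (hCV S hS hSI).trans ?_
  gcongr
  set X := ENNReal.ofReal (768 * Λ ^ 2 * ε / (η * δ)) with hX
  set T := {z : ℝ × ℝ | z ∈ Icc k0 k1 ×ˢ Icc i0 i1 ∧ (z.2, Δ.ψ z) ∈ S} with hT
  have mT : MeasurableSet T :=
    meas_inter_preimage (f := fun z : ℝ × ℝ => (z.2, Δ.ψ z)) (measurableSet_Icc.prod measurableSet_Icc)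
      (continuousOn_snd.prodMk h.hψ.continuousOn) hS
  rw [Measure.volume_eq_prod, Measure.prod_apply mT]
  calc ∫⁻ t, volume (Prod.mk t ⁻¹' T) ≤ ∫⁻ t, (Icc k0 k1).indicator (fun _ => X) t := by
        refine lintegral_mono fun t => ?_
        by_cases ht : t ∈ Icc k0 k1
        · rw [indicator_of_mem ht]
          refine (hfib t ht).bad hi.le hi1 hΛ hM hδ hδ1 r1 r2 (f3 t) hε hη hMη ?_ ?_ ?_
          · exact fun x hx => hx.1.2
          · exact fun x hx => hS1 (t, x) hx.1 hx.2
          · intro x hx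
            have := hS2 _ hx.2
            simpa only [hP2] using this
        · have : Prod.mk t ⁻¹' T = ∅ := by
            ext x
            simp only [mem_preimage, mem_empty_iff_false, iff_false]
            exact fun hx => ht hx.1.1
          rw [this]; simp
    _ = X * volume (Icc k0 k1) := lintegral_indicator_const measurableSet_Icc X
    _ ≤ X * 1 := by
        gcongr
        rw [Real.volume_Icc]; exact ENNReal.ofReal_le_one.2 hk1
    _ = X := mul_one X

lemma meas_ind {F : ℝ × ℝ → ℝ} {s : Set (ℝ × ℝ)} (hs : MeasurableSet s) (hF : ContinuousOn F s) :
    Measurable (s.indicator F) := by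
  classical
  rw [← piecewise_eq_indicator]
  exact hF.measurable_piecewise continuousOn_const hs

lemma Rep_meas_m (m : ℤ → ℝ) (b δ : ℝ) : Measurable (fun y : ℝ => m ⌊(y - b) / δ⌋) :=
  (measurable_from_top (f := m)).comp (Int.measurable_floor.comp (by fun_prop))

lemma Rep_meas {f : ℝ → ℝ} {b : ℝ} {m q : ℤ → ℝ} {δ M : ℝ} (r : Rep f b m q δ M) :
    Measurable f := by
  have : f = fun y => m ⌊(y - b) / δ⌋ * y + q ⌊(y - b) / δ⌋ := funext r.hf
  rw [this]
  exact ((Rep_meas_m m b δ).mul measurable_id).add (Rep_meas_m q b δ)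

lemma local_est {i0 i1 j0 j1 p0 p1 k0 k1 L : ℝ} {R : ℝ × ℝ → ℝ}
    (hi : i0 < i1) (hj : j0 < j1) (hk : k0 < k1)
    (hi1 : i1 - i0 ≤ 1) (hj1 : j1 - j0 ≤ 1) (hk1 : k1 - k0 ≤ 1)
    (h : Δ.Good (Icc i0 i1) (Icc j0 j1) (Icc p0 p1) (Icc k0 k1))
    (hd : Δ.Der (Icc i0 i1) (Icc k0 k1) R)
    (h3 : Δ.H3 (Icc i0 i1) (Icc k0 k1))
    (hD : ∃ x ∈ Icc i0 i1, ∃ y1 ∈ Icc j0 j1, ∃ y2 ∈ Icc j0 j1, Δ.D x y1 y2 ≠ 0)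
    (hD' : ∃ z ∈ Icc k0 k1 ×ˢ Icc i0 i1, ∃ x1 ∈ Icc i0 i1, ∃ x2 ∈ Icc i0 i1,
      Δ.D' (Δ.ψ z) x1 x2 ≠ 0)
    (hL : 1 ≤ L)
    (hCV : ∀ A : Set (ℝ × ℝ), MeasurableSet A → A ⊆ Icc i0 i1 ×ˢ Icc j0 j1 →
      volume A ≤ ENNReal.ofReal L *
        volume {z : ℝ × ℝ | z ∈ Icc k0 k1 ×ˢ Icc i0 i1 ∧ (z.2, Δ.ψ z) ∈ A})
    {ϱ C0 : ℝ} (hϱ : 0 < ϱ) (hC0 : 1 ≤ C0) :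
    ∃ C c : ℝ, 0 < C ∧ 0 < c ∧ ∀ δ : ℝ, 0 < δ → δ ≤ 1 → ∀ f1 f2 f3 : ℝ → ℝ,
      (∃ b m q, Rep f1 b m q δ (δ ^ (-(1 / 2 : ℝ)))) →
      (∃ b m q, Rep f2 b m q δ (δ ^ (-(1 / 2 : ℝ)))) → ∀ S : Set (ℝ × ℝ), MeasurableSet S →
      S ⊆ Icc i0 i1 ×ˢ Icc j0 j1 →
      (∀ z ∈ Icc k0 k1 ×ˢ Icc i0 i1, (z.2, Δ.ψ z) ∈ S →
        |Δ.U (z.2, Δ.ψ z) * f1 z.2 + Δ.V (z.2, Δ.ψ z) * f2 (Δ.ψ z) + f3 z.1| ≤ C0 * δ ^ (1 + ϱ) ∧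
          1 ≤ |f3 z.1|) →
      volume S ≤ ENNReal.ofReal (C * δ ^ c) := by
  obtain ⟨C1, c1, hC1, hc1, hmain⟩ := main_lemma hi hj hk hi1 hj1 hk1 h h3 hD hD' hL hCV
  obtain ⟨Λ, hΛ, hfib⟩ := h.fib hd
  set κ := min (ϱ / 2) (1 / 2 : ℝ) with hκ
  have κ0 : 0 < κ := lt_min (by linarith) (by norm_num)
  have κ1 : κ ≤ ϱ / 2 := min_le_left _ _
  have κ2 : κ ≤ 1 / 2 := min_le_right _ _
  set c := min (ϱ / 2) (κ * c1) with hc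
  have cpos : 0 < c := lt_min (by linarith) (by positivity)
  refine ⟨C1 * C0 ^ c1 + L * (768 * Λ ^ 2 * C0), c, by positivity, cpos, ?_⟩
  rintro δ hδ hδ1 f1 f2 f3 ⟨b1, m1, q1, r1⟩ ⟨b2, m2, q2, r2⟩ S hS hSI hS1
  set M := δ ^ (-(1 / 2 : ℝ)) with hMdef
  have hM : 1 ≤ M := Real.one_le_rpow_of_pos_of_le_one_of_nonpos hδ hδ1 (by norm_num)
  set η := δ ^ κ with hηdef
  have hη : 0 < η := by positivity
  have hη1 : η ≤ 1 := Real.rpow_le_one hδ.le hδ1 κ0.le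
  have hMη : M * δ ≤ η := by
    have : M * δ = δ ^ (1 / 2 : ℝ) := by
      rw [hMdef]
      nth_rewrite 2 [← Real.rpow_one δ]
      rw [← Real.rpow_add hδ]; norm_num
    rw [this]
    exact Real.rpow_le_rpow_of_exponent_ge hδ hδ1 κ2
  set s := Icc i0 i1 ×ˢ Icc p0 p1 with hs
  have ms : MeasurableSet s := measurableSet_Icc.prod measurableSet_Icc
  have hSs : S ⊆ s := fun z hz => ⟨(hSI hz).1, h.hJ (hSI hz).2⟩
  let E : ℝ × ℝ → ℝ := fun z => s.indicator Δ.P1 z * f1 z.1 +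
    s.indicator Δ.P2 z * m1 ⌊(z.1 - b1) / δ⌋ + s.indicator Δ.Q1 z * f2 z.2 +
      s.indicator Δ.Q2 z * m2 ⌊(z.2 - b2) / δ⌋
  have mE : Measurable E :=
    ((((meas_ind ms h.hP1.continuousOn).mul ((Rep_meas r1).comp measurable_fst)).add
    ((meas_ind ms h.hP2.continuousOn).mul ((Rep_meas_m m1 b1 δ).comp measurable_fst))).add
    ((meas_ind ms h.hQ1.continuousOn).mul ((Rep_meas r2).comp measurable_snd))).add
    ((meas_ind ms h.hQ2.continuousOn).mul ((Rep_meas_m m2 b2 δ).comp measurable_snd))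
  have eE : ∀ z ∈ S, E z = Δ.P1 z * f1 z.1 + Δ.P2 z * m1 ⌊(z.1 - b1) / δ⌋ + Δ.Q1 z * f2 z.2 +
      Δ.Q2 z * m2 ⌊(z.2 - b2) / δ⌋ := by
    intro z hz
    simp only [E, indicator_of_mem (hSs hz)]
  set S1 := S ∩ {z | η ≤ |E z|} with hS1d
  set S2 := S ∩ {z | |E z| < η} with hS2d
  have mS1 : MeasurableSet S1 := hS.inter (measurableSet_le measurable_const mE.abs)
  have mS2 : MeasurableSet S2 := hS.inter (measurableSet_lt mE.abs measurable_const)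
  have hcov : S ⊆ S1 ∪ S2 := by
    intro z hz
    rcases le_or_gt η |E z| with h' | h'
    · exact Or.inl ⟨hz, h'⟩
    · exact Or.inr ⟨hz, h'⟩
  have hε : C0 * δ ^ (1 + ϱ) ≤ C0 * η := by
    gcongr
    exact Real.rpow_le_rpow_of_exponent_ge hδ hδ1 (by linarith)
  have v1 := bad_est hi hi1 hk1 h hd.hP2 hΛ hfib hL hCV hM hδ hδ1
    (ε := C0 * δ ^ (1 + ϱ)) (by positivity) hη hMη r1 r2 mS1 (inter_subset_left.trans hSI) (f3 := f3)
    (fun z hz hz' => (hS1 z hz hz'.1).1) (fun z hz => by rw [← eE z hz.1]; exact hz.2)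
  have v2 := hmain (C0 * η) (by positivity) S2 mS2 (inter_subset_left.trans hSI) f1
    (fun y => m1 ⌊(y - b1) / δ⌋) f2 (fun y => m2 ⌊(y - b2) / δ⌋) f3
    (fun z hz hz' => ⟨(hS1 z hz hz'.1).1.trans hε, (hS1 z hz hz'.1).2⟩)
    (fun z hz => by
      rw [← eE z hz.1]
      exact hz.2.le.trans (by nlinarith))
  refine ((measure_mono hcov).trans (measure_union_le _ _)).trans ((add_le_add v1 v2).trans ?_)
  rw [← ENNReal.ofReal_add (by positivity) (by positivity)]
  refine ENNReal.ofReal_le_ofReal ?_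
  have w1 : L * (768 * Λ ^ 2 * (C0 * δ ^ (1 + ϱ)) / (η * δ)) ≤ L * (768 * Λ ^ 2 * C0) * δ ^ c := by
    have e1 : δ ^ (1 + ϱ) / (η * δ) = δ ^ (ϱ - κ) := by
      rw [hηdef, Real.rpow_add hδ, Real.rpow_sub hδ, Real.rpow_one]
      field_simp
    have e2 : δ ^ (ϱ - κ) ≤ δ ^ c :=
      Real.rpow_le_rpow_of_exponent_ge hδ hδ1 (by have := min_le_left (ϱ / 2) (κ * c1); linarith)
    have e3 : L * (768 * Λ ^ 2 * (C0 * δ ^ (1 + ϱ)) / (η * δ)) =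
      L * (768 * Λ ^ 2 * C0) * (δ ^ (1 + ϱ) / (η * δ)) := by ring
    rw [e3, e1]
    gcongr
  have w2 : C1 * (C0 * η) ^ c1 ≤ C1 * C0 ^ c1 * δ ^ c := by
    rw [Real.mul_rpow (by linarith) hη.le, hηdef, ← Real.rpow_mul hδ.le, ← mul_assoc]
    gcongr ?_ * ?_
    exact Real.rpow_le_rpow_of_exponent_ge hδ hδ1 (min_le_right _ _)
  linarith

end Dat
end Macro

namespace Macro

/-- analytic inverse function theorem -/
lemma inv_an {E F : Type*} [NormedAddCommGroup E] [NormedSpace ℝ E] [FiniteDimensional ℝ E]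
    [NormedAddCommGroup F] [NormedSpace ℝ F] [FiniteDimensional ℝ F]
    (hEF : Module.finrank ℝ E = Module.finrank ℝ F) {Φ : E → F} {a : E} {O : Set E} (hO : IsOpen O)
    (haO : a ∈ O) (hΦ : AnalyticAt ℝ Φ a) (hinj : ∀ v, fderiv ℝ Φ a v = 0 → v = 0) :
    ∃ e : OpenPartialHomeomorph E F, a ∈ e.source ∧ e.source ⊆ O ∧ ⇑e = Φ ∧
      AnalyticOnNhd ℝ e.symm e.target := by
  haveI : CompleteSpace E := FiniteDimensional.complete ℝ E
  haveI : CompleteSpace F := FiniteDimensional.complete ℝ F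
  let i : E ≃L[ℝ] F := (LinearMap.linearEquivOfInjective (fderiv ℝ Φ a : E →ₗ[ℝ] F)
    (by rw [← LinearMap.ker_eq_bot, LinearMap.ker_eq_bot']; exact hinj) hEF).toContinuousLinearEquiv
  have hi : (i : E →L[ℝ] F) = fderiv ℝ Φ a := by ext v; rfl
  have hs : HasStrictFDerivAt Φ (i : E →L[ℝ] F) a := hi ▸ hΦ.hasStrictFDerivAt
  let e0 := hs.toOpenPartialHomeomorph Φ
  have ha0 : a ∈ e0.source := hs.mem_toOpenPartialHomeomorph_source
  have hc0 : ⇑e0 = Φ := hs.toOpenPartialHomeomorph_coe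
  have han : AnalyticAt ℝ e0.symm (e0 a) := e0.analyticAt_symm' (i := i) ha0 (hc0 ▸ hΦ) (by rw [hc0, hi])
  obtain ⟨W, hW, hWo, haW⟩ := mem_nhds_iff.1 han.eventually_analyticAt
  let e1 := (e0.symm.restrOpen W hWo).symm.restrOpen O hO
  refine ⟨e1, ⟨?_, haO⟩, fun z hz => hz.2, hc0, ?_⟩
  · show a ∈ (e0.symm.restrOpen W hWo).target
    rw [← (e0.symm.restrOpen W hWo).symm_source]
    have : e0 a ∈ (e0.symm.restrOpen W hWo).source := ⟨e0.map_source ha0, haW⟩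
    have := (e0.symm.restrOpen W hWo).map_source this
    simpa [e0.left_inv ha0] using this
  · intro w hw
    have : w ∈ (e0.symm.restrOpen W hWo).source := hw.1
    exact hW this.2

end Macro

namespace Macro

/-- chart solving `φ (x, y) = t` for `y = ψ (t, x)` -/
structure Ch (φ : ℝ × ℝ → ℝ) (O : Set (ℝ × ℝ)) (ψ : ℝ × ℝ → ℝ) (Ω T : Set (ℝ × ℝ)) : Prop where
  oΩ : IsOpen Ω
  oT : IsOpen T
  sub : Ω ⊆ O
  an : AnalyticOnNhd ℝ ψ T
  mapT : ∀ w ∈ T, (w.2, ψ w) ∈ Ω ∧ φ (w.2, ψ w) = w.1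
  mapΩ : ∀ z ∈ Ω, (φ z, z.1) ∈ T ∧ ψ (φ z, z.1) = z.2

lemma clm_pair (l : ℝ × ℝ →L[ℝ] ℝ) (a b : ℝ) : l (a, b) = a * l (1, 0) + b * l (0, 1) := by
  have : ((a, b) : ℝ × ℝ) = a • (1, 0) + b • (0, 1) := by simp
  rw [this, map_add, map_smul, map_smul]; simp

lemma exists_ch {φ : ℝ × ℝ → ℝ} {O : Set (ℝ × ℝ)} (hO : IsOpen O) (hφ : AnalyticOnNhd ℝ φ O)
    {z0 : ℝ × ℝ} (hz0 : z0 ∈ O) (hy : fderiv ℝ φ z0 (0, 1) ≠ 0) :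
    ∃ ψ Ω T, Ch φ O ψ Ω T ∧ z0 ∈ Ω := by
  obtain ⟨e, h1, h2, h3, h4⟩ := inv_an (Φ := fun z : ℝ × ℝ => (φ z, z.1)) rfl hO hz0
    ((hφ z0 hz0).prod analyticAt_fst) (by
      intro v hv
      have hd : HasFDerivAt (fun z : ℝ × ℝ => (φ z, z.1))
        ((fderiv ℝ φ z0).prod (ContinuousLinearMap.fst ℝ ℝ ℝ)) z0 :=
        (hφ z0 hz0).differentiableAt.hasFDerivAt.prodMk hasFDerivAt_fst
      rw [hd.fderiv] at hv
      obtain ⟨a, b⟩ := v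
      simp only [ContinuousLinearMap.prod_apply, Prod.mk_eq_zero, ContinuousLinearMap.coe_fst'] at hv
      obtain ⟨hv1, rfl⟩ := hv
      rw [clm_pair] at hv1
      simp only [zero_mul, zero_add, mul_eq_zero] at hv1
      rcases hv1 with rfl | h
      · rfl
      · exact absurd h hy)
  have key : ∀ w ∈ e.target, e.symm w = (w.2, (e.symm w).2) ∧ φ (e.symm w) = w.1 := by
    intro w hw
    have := e.right_inv hw
    rw [h3] at this
    simp only at this
    rw [Prod.ext_iff] at this
    exact ⟨Prod.ext this.2 rfl, this.1⟩
  refine ⟨fun w => (e.symm w).2, e.source, e.target, ⟨e.open_source, e.open_target, h2, ?_, ?_, ?_⟩, h1⟩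
  · intro w hw
    exact analyticAt_snd.comp (h4 w hw)
  · intro w hw
    rw [← (key w hw).1]
    exact ⟨e.map_target hw, (key w hw).2⟩
  · intro z hz
    have h5 := e.map_source hz
    have h6 := e.left_inv hz
    rw [h3] at h5 h6
    exact ⟨h5, congrArg Prod.snd h6⟩

/-- slope of the level curves -/
def Rs (φ : ℝ × ℝ → ℝ) (z : ℝ × ℝ) : ℝ := -(fderiv ℝ φ z (1, 0)) / (fderiv ℝ φ z (0, 1))
/-- derivative along the level curves -/
def Dl (φ F : ℝ × ℝ → ℝ) (z : ℝ × ℝ) : ℝ := fderiv ℝ F z (1, 0) + Rs φ z * fderiv ℝ F z (0, 1)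

lemma an_partial {F : ℝ × ℝ → ℝ} {O : Set (ℝ × ℝ)} (hF : AnalyticOnNhd ℝ F O) (v : ℝ × ℝ) :
    AnalyticOnNhd ℝ (fun z => fderiv ℝ F z v) O := fun z hz =>
  ((ContinuousLinearMap.apply ℝ ℝ v).analyticAt _).comp (hF.fderiv z hz)

lemma an_Rs {φ : ℝ × ℝ → ℝ} {O : Set (ℝ × ℝ)} (hφ : AnalyticOnNhd ℝ φ O)
    (hy : ∀ z ∈ O, fderiv ℝ φ z (0, 1) ≠ 0) : AnalyticOnNhd ℝ (Rs φ) O := fun z hz =>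
  ((an_partial hφ _ z hz).neg).div (an_partial hφ _ z hz) (hy z hz)

lemma an_Dl {φ F : ℝ × ℝ → ℝ} {O : Set (ℝ × ℝ)} (hφ : AnalyticOnNhd ℝ φ O)
    (hy : ∀ z ∈ O, fderiv ℝ φ z (0, 1) ≠ 0) (hF : AnalyticOnNhd ℝ F O) :
    AnalyticOnNhd ℝ (Dl φ F) O := fun z hz =>
  (an_partial hF _ z hz).add ((an_Rs hφ hy z hz).mul (an_partial hF _ z hz))

lemma der_along {F : ℝ × ℝ → ℝ} {g : ℝ → ℝ} {x r : ℝ} (hF : DifferentiableAt ℝ F (x, g x))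
    (hg : HasDerivAt g r x) : HasDerivAt (fun x => F (x, g x))
      (fderiv ℝ F (x, g x) (1, 0) + r * fderiv ℝ F (x, g x) (0, 1)) x := by
  have h1 : HasDerivAt (fun x => ((x, g x) : ℝ × ℝ)) (1, r) x := (hasDerivAt_id x).prodMk hg
  have := hF.hasFDerivAt.comp_hasDerivAt x h1
  rw [clm_pair, one_mul] at this
  exact this

variable {φ ψ : ℝ × ℝ → ℝ} {O Ω T : Set (ℝ × ℝ)}

lemma Ch.dψ (h : Ch φ O ψ Ω T) (hφ : AnalyticOnNhd ℝ φ O)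
    (hy : ∀ z ∈ O, fderiv ℝ φ z (0, 1) ≠ 0) : ∀ w ∈ T,
    HasDerivAt (fun x => ψ (w.1, x)) (Rs φ (w.2, ψ w)) w.2 := by
  rintro ⟨t, x⟩ hw
  simp only
  have hz := h.sub (h.mapT _ hw).1
  have d1 : DifferentiableAt ℝ (fun x => ψ (t, x)) x :=
    DifferentiableAt.comp (g := ψ) (f := fun x : ℝ => ((t, x) : ℝ × ℝ)) x
      (h.an _ hw).differentiableAt (by fun_prop)
  have d2 := d1.hasDerivAt
  set r := deriv (fun x => ψ (t, x)) x with hr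
  have d3 := der_along (F := φ) (hφ _ hz).differentiableAt d2
  have d4 : (fun x => φ (x, ψ (t, x))) =ᶠ[nhds x] fun _ => t := by
    have hc : ContinuousAt (fun x : ℝ => ((t, x) : ℝ × ℝ)) x := by fun_prop
    filter_upwards [hc (h.oT.mem_nhds hw)] with x' hx'
    exact (h.mapT _ hx').2
  have d5 := d3.unique ((hasDerivAt_const x t).congr_of_eventuallyEq d4)
  have : r = Rs φ (x, ψ (t, x)) := by
    rw [Rs, eq_div_iff (hy _ hz)]
    linarith
  rw [← this]; exact d2

lemma Ch.dF (h : Ch φ O ψ Ω T) (hφ : AnalyticOnNhd ℝ φ O)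
    (hy : ∀ z ∈ O, fderiv ℝ φ z (0, 1) ≠ 0) {F : ℝ × ℝ → ℝ} (hF : AnalyticOnNhd ℝ F O) : ∀ w ∈ T,
    HasDerivAt (fun x => F (x, ψ (w.1, x))) (Dl φ F (w.2, ψ w)) w.2 := fun w hw =>
  der_along (hF _ (h.sub (h.mapT _ hw).1)).differentiableAt (h.dψ hφ hy w hw)

lemma Ch.open_pre (h : Ch φ O ψ Ω T) (hφ : AnalyticOnNhd ℝ φ O) {B : Set (ℝ × ℝ)} (hB : IsOpen B) :
    IsOpen (Ω ∩ (fun z : ℝ × ℝ => (φ z, z.1)) ⁻¹' B) :=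
  ContinuousOn.isOpen_inter_preimage
    ((hφ.mono h.sub).continuousOn.prodMk continuousOn_fst) h.oΩ hB

/-- nonvanishing of the determinant -/
lemma nonvan {U : ℝ × ℝ → ℝ} {W : Set (ℝ × ℝ)} (hO : IsOpen O) (hφ : AnalyticOnNhd ℝ φ O)
    (hy : ∀ z ∈ O, fderiv ℝ φ z (0, 1) ≠ 0) (hU : AnalyticOnNhd ℝ U O) (hU0 : ∀ z ∈ O, U z ≠ 0)
    (hW : IsOpen W) (hWn : W.Nonempty) (hWO : W ⊆ O)
    (hA : ∀ Ω : Set (ℝ × ℝ), Ω ⊆ W → IsOpen Ω → Ω.Nonempty → ∀ k g : ℝ → ℝ,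
      AnalyticOnNhd ℝ k (Prod.fst '' Ω) → AnalyticOnNhd ℝ g (φ '' Ω) →
      (∀ z ∈ Ω, U z * k z.1 + g (φ z) = 0) → ∀ z ∈ Ω, k z.1 = 0) :
    ∃ x y1 y2, (x, y1) ∈ W ∧ (x, y2) ∈ W ∧
      Dl φ U (x, y1) * U (x, y2) - Dl φ U (x, y2) * U (x, y1) ≠ 0 := by
  by_contra hcon
  push Not at hcon
  obtain ⟨z1, hz1⟩ := hWn
  have hφW := hφ.mono hWO
  have hUW := hU.mono hWO
  have hyW : ∀ z ∈ W, fderiv ℝ φ z (0, 1) ≠ 0 := fun z hz => hy z (hWO hz)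
  obtain ⟨ψ, Ω, T, ch, hzΩ⟩ := exists_ch hW hφW hz1 (hyW z1 hz1)
  obtain ⟨hw, -⟩ := ch.mapΩ z1 hzΩ
  set t1 := φ z1
  set x1 := z1.1
  obtain ⟨ε, hε, hb⟩ := Metric.isOpen_iff.1 ch.oT (t1, x1) hw
  rw [← ball_prod_same] at hb
  have ht1 : t1 ∈ Metric.ball t1 ε := Metric.mem_ball_self hε
  have hx1 : x1 ∈ Metric.ball x1 ε := Metric.mem_ball_self hε
  set B := Metric.ball t1 ε ×ˢ Metric.ball x1 ε with hB
  have mem : ∀ t ∈ Metric.ball t1 ε, ∀ x ∈ Metric.ball x1 ε, (x, ψ (t, x)) ∈ W := fun t ht x hx =>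
    ch.sub (ch.mapT (t, x) (hb ⟨ht, hx⟩)).1
  have U0 : ∀ t ∈ Metric.ball t1 ε, ∀ x ∈ Metric.ball x1 ε, U (x, ψ (t, x)) ≠ 0 := fun t ht x hx =>
    hU0 _ (hWO (mem t ht x hx))
  have cst : ∀ t ∈ Metric.ball t1 ε, ∀ x ∈ Metric.ball x1 ε,
      U (x, ψ (t, x)) / U (x, ψ (t1, x)) = U (x1, ψ (t, x1)) / U (x1, ψ (t1, x1)) := by
    intro t ht x hx
    have hdv : ∀ x ∈ Metric.ball x1 ε,
        HasDerivAt (fun x => U (x, ψ (t, x)) / U (x, ψ (t1, x))) 0 x := by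
      intro x hx
      have d := (ch.dF hφW hyW hUW (t, x) (hb ⟨ht, hx⟩)).fun_div
        (ch.dF hφW hyW hUW (t1, x) (hb ⟨ht1, hx⟩)) (U0 t1 ht1 x hx)
      refine d.congr_deriv ?_
      have := hcon x (ψ (t, x)) (ψ (t1, x)) (mem t ht x hx) (mem t1 ht1 x hx)
      simp only
      rw [div_eq_zero_iff]; left; linarith
    refine (convex_ball x1 ε).is_const_of_fderivWithin_eq_zero (𝕜 := ℝ)
      (f := fun x => U (x, ψ (t, x)) / U (x, ψ (t1, x)))
      (fun x hx => (hdv x hx).differentiableAt.differentiableWithinAt) ?_ hx hx1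
    intro x hx
    rw [fderivWithin_of_isOpen Metric.isOpen_ball hx]
    ext
    simp [(hdv x hx).deriv]
  set Ω' := Ω ∩ (fun z : ℝ × ℝ => (φ z, z.1)) ⁻¹' B with hΩ'
  have hz1' : z1 ∈ Ω' := ⟨hzΩ, ht1, hx1⟩
  have anU : ∀ t ∈ Metric.ball t1 ε, ∀ x ∈ Metric.ball x1 ε,
      AnalyticAt ℝ (fun w : ℝ × ℝ => U (w.2, ψ w)) (t, x) := fun t ht x hx =>
    Dat.an_comp (hUW _ (mem t ht x hx)) analyticAt_snd (ch.an _ (hb ⟨ht, hx⟩))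
  have := hA Ω' (inter_subset_left.trans ch.sub) (ch.open_pre hφW (Metric.isOpen_ball.prod
    Metric.isOpen_ball)) ⟨z1, hz1'⟩ (fun x => 1 / U (x, ψ (t1, x)))
    (fun t => -(U (x1, ψ (t, x1)) / U (x1, ψ (t1, x1)))) ?_ ?_ ?_ z1 hz1'
  · exact one_div_ne_zero (U0 t1 ht1 x1 hx1) this
  · rintro _ ⟨z, hz, rfl⟩
    refine AnalyticAt.div analyticAt_const ?_ (U0 t1 ht1 _ hz.2.2)
    exact AnalyticAt.comp (g := fun w : ℝ × ℝ => U (w.2, ψ w)) (f := fun x : ℝ => (t1, x))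
      (anU t1 ht1 _ hz.2.2) (analyticAt_const.prod analyticAt_id)
  · rintro _ ⟨z, hz, rfl⟩
    refine (AnalyticAt.div ?_ analyticAt_const (U0 t1 ht1 _ hx1)).neg
    exact AnalyticAt.comp (g := fun w : ℝ × ℝ => U (w.2, ψ w)) (f := fun t : ℝ => (t, x1))
      (anU _ hz.2.1 _ hx1) (analyticAt_id.prod analyticAt_const)
  · intro z hz
    have e1 := cst (φ z) hz.2.1 z.1 hz.2.2
    have e2 := (ch.mapΩ z hz.1).2
    rw [e2] at e1
    simp only [Prod.mk.eta] at e1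
    rw [← e1]; ring

end Macro

namespace Macro

variable {φ ψ : ℝ × ℝ → ℝ} {O Ω T : Set (ℝ × ℝ)}

lemma fderiv_swap {F : ℝ × ℝ → ℝ} {z : ℝ × ℝ} (hF : DifferentiableAt ℝ F z.swap) (v : ℝ × ℝ) :
    fderiv ℝ (F ∘ Prod.swap) z v = fderiv ℝ F z.swap v.swap := by
  have h1 : HasFDerivAt (Prod.swap : ℝ × ℝ → ℝ × ℝ)
      ((ContinuousLinearMap.snd ℝ ℝ ℝ).prod (ContinuousLinearMap.fst ℝ ℝ ℝ)) z :=
    hasFDerivAt_snd.prodMk hasFDerivAt_fst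
  have := hF.hasFDerivAt.comp z h1
  rw [this.fderiv]
  rfl

lemma an_swap {F : ℝ × ℝ → ℝ} (hF : AnalyticOnNhd ℝ F O) :
    AnalyticOnNhd ℝ (F ∘ Prod.swap) (Prod.swap ⁻¹' O) := fun z hz =>
  AnalyticAt.comp (g := F) (f := Prod.swap) (hF _ hz) (analyticAt_snd.prod analyticAt_fst)

/-- nonvanishing of the second determinant -/
lemma nonvan' {V : ℝ × ℝ → ℝ} {W : Set (ℝ × ℝ)} (hO : IsOpen O) (hφ : AnalyticOnNhd ℝ φ O)
    (hx : ∀ z ∈ O, fderiv ℝ φ z (1, 0) ≠ 0)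
    (hy : ∀ z ∈ O, fderiv ℝ φ z (0, 1) ≠ 0) (hV : AnalyticOnNhd ℝ V O) (hV0 : ∀ z ∈ O, V z ≠ 0)
    (hW : IsOpen W) (hWn : W.Nonempty) (hWO : W ⊆ O)
    (hA : ∀ Ω : Set (ℝ × ℝ), Ω ⊆ W → IsOpen Ω → Ω.Nonempty → ∀ k g : ℝ → ℝ,
      AnalyticOnNhd ℝ k (Prod.snd '' Ω) → AnalyticOnNhd ℝ g (φ '' Ω) →
      (∀ z ∈ Ω, V z * k z.2 + g (φ z) = 0) → ∀ z ∈ Ω, k z.2 = 0) :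
    ∃ y x1 x2, (x1, y) ∈ W ∧ (x2, y) ∈ W ∧
      Dl φ V (x1, y) * (V (x2, y) * Rs φ (x2, y)) -
        Dl φ V (x2, y) * (V (x1, y) * Rs φ (x1, y)) ≠ 0 := by
  have cs : Continuous (Prod.swap : ℝ × ℝ → ℝ × ℝ) := continuous_swap
  have hnv := nonvan (φ := φ ∘ Prod.swap) (U := V ∘ Prod.swap)
    (O := Prod.swap ⁻¹' O) (W := Prod.swap ⁻¹' W) (hO.preimage cs) (an_swap hφ) ?_ (an_swap hV)
    (fun z hz => hV0 _ hz) (hW.preimage cs) (hWn.preimage Prod.swap_surjective)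
    (preimage_mono hWO) ?_
  · obtain ⟨y, x1, x2, h1, h2, h3⟩ := hnv
    have h1' : (x1, y) ∈ O := hWO h1
    have h2' : (x2, y) ∈ O := hWO h2
    refine ⟨y, x1, x2, h1, h2, ?_⟩
    have key : ∀ x, (x, y) ∈ O → Dl (φ ∘ Prod.swap) (V ∘ Prod.swap) (y, x) * Rs φ (x, y) =
        Dl φ V (x, y) := by
      intro x h
      have a1 := hx _ h
      have a2 := hy _ h
      simp only [Dl, Rs]
      rw [fderiv_swap (z := (y, x)) (hφ _ h).differentiableAt,
        fderiv_swap (z := (y, x)) (hφ _ h).differentiableAt,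
        fderiv_swap (z := (y, x)) (hV _ h).differentiableAt,
        fderiv_swap (z := (y, x)) (hV _ h).differentiableAt]
      simp only [Prod.swap_prod_mk]
      field_simp
      ring
    have r1 : Rs φ (x1, y) ≠ 0 := div_ne_zero (neg_ne_zero.2 (hx _ h1')) (hy _ h1')
    have r2 : Rs φ (x2, y) ≠ 0 := div_ne_zero (neg_ne_zero.2 (hx _ h2')) (hy _ h2')
    rw [← key x1 h1', ← key x2 h2']
    intro h0
    refine mul_ne_zero (mul_ne_zero h3 r1) r2 ?_
    simp only [Function.comp, Prod.swap_prod_mk] at h0 ⊢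
    linarith
  · intro z hz
    rw [fderiv_swap (hφ _ hz).differentiableAt]
    exact hx _ hz
  · intro Ω' hΩ' oΩ' nΩ' k g hk hg heq z hz
    have := hA (Prod.swap ⁻¹' Ω') (fun w hw => by simpa using hΩ' hw) (oΩ'.preimage cs)
      (nΩ'.preimage Prod.swap_surjective) k g ?_ ?_ ?_ z.swap (by simpa using hz)
    · simpa using this
    · refine hk.mono ?_
      rintro _ ⟨w, hw, rfl⟩
      exact ⟨w.swap, hw, rfl⟩
    · refine hg.mono ?_
      rintro _ ⟨w, hw, rfl⟩
      exact ⟨w.swap, hw, by simp⟩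
    · intro w hw
      have := heq w.swap hw
      simpa using this

/-- measure of images under analytic maps -/
lemma vol_image {G1 G2 : ℝ × ℝ → ℝ} {s : Set (ℝ × ℝ)} (hs : IsCompact s) (hc : Convex ℝ s)
    (h1 : AnalyticOnNhd ℝ G1 s) (h2 : AnalyticOnNhd ℝ G2 s) : ∃ L, 1 ≤ L ∧ ∀ T ⊆ s,
      volume ((fun z => (G1 z, G2 z)) '' T) ≤ ENNReal.ofReal L * volume T := by
  obtain ⟨L1, a1, -, b1⟩ := lip_of_an hs hc h1
  obtain ⟨L2, a2, -, b2⟩ := lip_of_an hs hc h2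
  set L : NNReal := Real.toNNReal (L1 + L2) with hL
  have hLc : (L : ℝ) = L1 + L2 := Real.coe_toNNReal _ (by linarith)
  have lip : LipschitzOnWith L (fun z => (G1 z, G2 z)) s := by
    refine LipschitzOnWith.of_dist_le_mul fun z hz w hw => ?_
    rw [Prod.dist_eq, hLc, dist_eq_norm z w, max_le_iff]
    constructor
    · rw [Real.dist_eq]
      refine (b1 z hz w hw).trans ?_
      gcongr; linarith
    · rw [Real.dist_eq]
      refine (b2 z hz w hw).trans ?_
      gcongr; linarith
  refine ⟨(L1 + L2) ^ 2, one_le_pow₀ (by linarith), fun T hT => ?_⟩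
  have := (lip.mono hT).hausdorffMeasure_image_le (d := 2) (by norm_num)
  rw [hausdorffMeasure_prod_real] at this
  refine this.trans (le_of_eq ?_)
  congr 1
  rw [ENNReal.ofReal_pow (by linarith)]
  norm_cast

/-- Local estimate near a point of the chart. -/
lemma chart_est {U V : ℝ × ℝ → ℝ} {G : Set (ℝ × ℝ)} {z0 : ℝ × ℝ} (hO : IsOpen O) (hz0 : z0 ∈ O)
    (hφ : AnalyticOnNhd ℝ φ O)
    (hx : ∀ z ∈ O, fderiv ℝ φ z (1, 0) ≠ 0) (hy : ∀ z ∈ O, fderiv ℝ φ z (0, 1) ≠ 0)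
    (hU : AnalyticOnNhd ℝ U O) (hU0 : ∀ z ∈ O, U z ≠ 0)
    (hV : AnalyticOnNhd ℝ V O) (hV0 : ∀ z ∈ O, V z ≠ 0)
    (hG : IsOpen G) (hz0G : z0 ∈ closure G)
    (hM : ∀ Ω : Set (ℝ × ℝ), Ω ⊆ O → IsOpen Ω → Ω.Nonempty → IsConnected Ω → ∀ f1 f2 f3 : ℝ → ℝ,
      AnalyticOnNhd ℝ f1 (Prod.fst '' Ω) → AnalyticOnNhd ℝ f2 (Prod.snd '' Ω) →
      AnalyticOnNhd ℝ f3 (φ '' Ω) →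
      (∀ z ∈ Ω, U z * f1 z.1 + V z * f2 z.2 + f3 (φ z) = 0) → ∀ z ∈ Ω, f3 (φ z) = 0)
    (hA1 : ∀ Ω : Set (ℝ × ℝ), Ω ⊆ O ∩ G → IsOpen Ω → Ω.Nonempty → ∀ k g : ℝ → ℝ,
      AnalyticOnNhd ℝ k (Prod.fst '' Ω) → AnalyticOnNhd ℝ g (φ '' Ω) →
      (∀ z ∈ Ω, U z * k z.1 + g (φ z) = 0) → ∀ z ∈ Ω, k z.1 = 0)
    (hA2 : ∀ Ω : Set (ℝ × ℝ), Ω ⊆ O ∩ G → IsOpen Ω → Ω.Nonempty → ∀ k g : ℝ → ℝ,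
      AnalyticOnNhd ℝ k (Prod.snd '' Ω) → AnalyticOnNhd ℝ g (φ '' Ω) →
      (∀ z ∈ Ω, V z * k z.2 + g (φ z) = 0) → ∀ z ∈ Ω, k z.2 = 0) :
    ∃ r : ℝ, 0 < r ∧ Metric.closedBall z0 r ⊆ O ∧ ∀ ϱ C0 : ℝ, 0 < ϱ → 1 ≤ C0 →
    ∃ C c : ℝ, 0 < C ∧ 0 < c ∧ ∀ δ : ℝ, 0 < δ → δ ≤ 1 → ∀ f1 f2 f3 : ℝ → ℝ,
      (∃ b m q, Rep f1 b m q δ (δ ^ (-(1 / 2 : ℝ)))) →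
      (∃ b m q, Rep f2 b m q δ (δ ^ (-(1 / 2 : ℝ)))) → ∀ S : Set (ℝ × ℝ), MeasurableSet S →
      S ⊆ Metric.closedBall z0 r →
      (∀ z ∈ S, |U z * f1 z.1 + V z * f2 z.2 + f3 (φ z)| ≤ C0 * δ ^ (1 + ϱ) ∧
          1 ≤ |f3 (φ z)|) →
      volume S ≤ ENNReal.ofReal (C * δ ^ c) := by
  obtain ⟨ψ, Ω, T, ch, hzΩ⟩ := exists_ch hO hφ hz0 (hy z0 hz0)
  obtain ⟨hwT, hψ0⟩ := ch.mapΩ z0 hzΩ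
  obtain ⟨x0, y0⟩ := z0
  set t0 := φ (x0, y0) with ht0
  simp only at hwT hψ0
  obtain ⟨r1, hr1, hb1⟩ := Metric.nhds_basis_closedBall.mem_iff.1 (hO.mem_nhds hz0)
  have hψc : ContinuousAt ψ (t0, x0) := (ch.an _ hwT).continuousAt
  have n2 : T ∩ ψ ⁻¹' (Metric.closedBall y0 r1) ∈ nhds (t0, x0) :=
    Filter.inter_mem (ch.oT.mem_nhds hwT) (hψc (by rw [hψ0]; exact Metric.closedBall_mem_nhds _ hr1))
  obtain ⟨r2', hr2', hb2'⟩ := Metric.nhds_basis_closedBall.mem_iff.1 n2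
  set r2 := min (min r2' r1) (1 / 2) with hr2d
  have hr2 : 0 < r2 := lt_min (lt_min hr2' hr1) (by norm_num)
  have r2a : r2 ≤ r2' := (min_le_left _ _).trans (min_le_left _ _)
  have r2b : r2 ≤ r1 := (min_le_left _ _).trans (min_le_right _ _)
  have r2c : r2 ≤ 1 / 2 := min_le_right _ _
  have hb2 := (Metric.closedBall_subset_closedBall r2a).trans hb2'
  have n3 : Ω ∩ φ ⁻¹' (Metric.closedBall t0 r2) ∈ nhds (x0, y0) :=
    Filter.inter_mem (ch.oΩ.mem_nhds hzΩ)
      ((hφ _ hz0).continuousAt (Metric.closedBall_mem_nhds _ hr2))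
  obtain ⟨r3', hr3', hb3'⟩ := Metric.nhds_basis_closedBall.mem_iff.1 n3
  set r3 := min r3' r2 with hr3d
  have hr3 : 0 < r3 := lt_min hr3' hr2
  have r3a : r3 ≤ r3' := min_le_left _ _
  have r3b : r3 ≤ r2 := min_le_right _ _
  have hb3 := (Metric.closedBall_subset_closedBall r3a).trans hb3'
  refine ⟨r3, hr3, (Metric.closedBall_subset_closedBall (r3b.trans r2b)).trans hb1, ?_⟩
  rw [← closedBall_prod_same, Real.closedBall_eq_Icc, Real.closedBall_eq_Icc] at hb1 hb2 hb3
  rw [Real.closedBall_eq_Icc] at hb2 hb3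
  rw [← closedBall_prod_same, Real.closedBall_eq_Icc, Real.closedBall_eq_Icc]
  have sI : Icc (x0 - r3) (x0 + r3) ⊆ Icc (x0 - r2) (x0 + r2) :=
    Icc_subset_Icc (by linarith) (by linarith)
  have sI1 : Icc (x0 - r3) (x0 + r3) ⊆ Icc (x0 - r1) (x0 + r1) :=
    Icc_subset_Icc (by linarith) (by linarith)
  have sJ : Icc (y0 - r3) (y0 + r3) ⊆ Icc (y0 - r1) (y0 + r1) :=
    Icc_subset_Icc (by linarith) (by linarith)
  set I := Icc (x0 - r3) (x0 + r3) with hI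
  set J := Icc (y0 - r3) (y0 + r3) with hJ
  set K := Icc (t0 - r2) (t0 + r2) with hK
  set Jp := Icc (y0 - r1) (y0 + r1) with hJp
  have IJO : I ×ˢ Jp ⊆ O := fun z hz => hb1 ⟨sI1 hz.1, hz.2⟩
  have KIT : K ×ˢ I ⊆ T := fun z hz => (hb2 ⟨hz.1, sI hz.2⟩).1
  let Δ : Dat := ⟨U, V, Dl φ U, U, Dl φ V, fun z => V z * Rs φ z, ψ⟩
  have good : Δ.Good I J Jp K :=
    { hU := hU.mono IJO
      hV := hV.mono IJO
      hP1 := (an_Dl hφ hy hU).mono IJO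
      hP2 := hU.mono IJO
      hQ1 := (an_Dl hφ hy hV).mono IJO
      hQ2 := (hV.mul (an_Rs hφ hy)).mono IJO
      hψ := ch.an.mono KIT
      hm := fun z hz => (hb2 ⟨hz.1, sI hz.2⟩).2
      hJ := sJ }
  have der : Δ.Der I K (Rs φ) :=
    { dU := fun z hz => ch.dF hφ hy hU z (KIT hz)
      dV := fun z hz => ch.dF hφ hy hV z (KIT hz)
      dψ := fun z hz => ch.dψ hφ hy z (KIT hz)
      hP2 := fun z => rfl
      hQ2 := fun z => rfl }
  have h3 : Δ.H3 I K := by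
    intro t1 x1 ε hε hsub f1 f2 f3 a1 a2 a3 heq
    set B := Metric.ball t1 ε ×ˢ Metric.ball x1 ε with hB
    have hBT : B ⊆ T := hsub.trans KIT
    set Ω' := Ω ∩ (fun z : ℝ × ℝ => (φ z, z.1)) ⁻¹' B with hΩ'
    have him : Ω' = (fun w : ℝ × ℝ => (w.2, ψ w)) '' B := by
      ext z
      constructor
      · rintro ⟨hz1, hz2⟩
        exact ⟨_, hz2, Prod.ext rfl (ch.mapΩ z hz1).2⟩
      · rintro ⟨w, hw, rfl⟩
        obtain ⟨c1, c2⟩ := ch.mapT w (hBT hw)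
        refine ⟨c1, ?_⟩
        simp only [mem_preimage, c2]
        exact hw
    have hc : (t1, x1) ∈ B := ⟨Metric.mem_ball_self hε, Metric.mem_ball_self hε⟩
    have conn : IsConnected Ω' := by
      rw [him]
      refine IsConnected.image ⟨⟨_, hc⟩, ?_⟩ _ (continuousOn_snd.prodMk (ch.an.mono hBT).continuousOn)
      exact ((convex_ball _ _).prod (convex_ball _ _)).isPreconnected
    have := hM Ω' (inter_subset_left.trans ch.sub)
      (ch.open_pre hφ (Metric.isOpen_ball.prod Metric.isOpen_ball)) conn.1 conn f1 f2 f3 ?_ ?_ ?_ ?_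
      (x1, ψ (t1, x1)) (by rw [him]; exact ⟨_, hc, rfl⟩)
    · rwa [(ch.mapT _ (hBT hc)).2] at this
    · refine a1.mono ?_
      rintro _ ⟨z, hz, rfl⟩
      exact hz.2.2
    · refine a2.mono ?_
      rw [him]
      rintro _ ⟨_, ⟨w, hw, rfl⟩, rfl⟩
      exact ⟨w, hw, rfl⟩
    · refine a3.mono ?_
      rintro _ ⟨z, hz, rfl⟩
      exact hz.2.1
    · rw [him]
      rintro _ ⟨w, hw, rfl⟩
      have := heq w.1 hw.1 w.2 hw.2
      rw [(ch.mapT _ (hBT hw)).2]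
      exact this
  set W := (Ioo (x0 - r3) (x0 + r3) ×ˢ Ioo (y0 - r3) (y0 + r3)) ∩ G with hW
  have Wo : IsOpen W := (isOpen_Ioo.prod isOpen_Ioo).inter hG
  have Wn : W.Nonempty := by
    refine mem_closure_iff.1 hz0G _ (isOpen_Ioo.prod isOpen_Ioo) ?_
    exact ⟨⟨by linarith, by linarith⟩, ⟨by linarith, by linarith⟩⟩
  have WIJ : W ⊆ I ×ˢ J := fun z hz => ⟨Ioo_subset_Icc_self hz.1.1, Ioo_subset_Icc_self hz.1.2⟩
  have WO : W ⊆ O := fun z hz => IJO ⟨(WIJ hz).1, sJ (WIJ hz).2⟩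
  have WOG : W ⊆ O ∩ G := fun z hz => ⟨WO hz, hz.2⟩
  have hD : ∃ x ∈ I, ∃ y1 ∈ J, ∃ y2 ∈ J, Δ.D x y1 y2 ≠ 0 := by
    obtain ⟨x, y1, y2, m1, m2, hne⟩ := nonvan hO hφ hy hU hU0 Wo Wn WO
      (fun Ω hΩ => hA1 Ω (hΩ.trans WOG))
    exact ⟨x, (WIJ m1).1, y1, (WIJ m1).2, y2, (WIJ m2).2, hne⟩
  have hD' : ∃ z ∈ K ×ˢ I, ∃ x1 ∈ I, ∃ x2 ∈ I, Δ.D' (Δ.ψ z) x1 x2 ≠ 0 := by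
    obtain ⟨y, x1, x2, m1, m2, hne⟩ := nonvan' hO hφ hx hy hV hV0 Wo Wn WO
      (fun Ω hΩ => hA2 Ω (hΩ.trans WOG))
    obtain ⟨b1, b2⟩ := hb3 (WIJ m1)
    refine ⟨(φ (x1, y), x1), ⟨b2, (WIJ m1).1⟩, x1, (WIJ m1).1, x2, (WIJ m2).1, ?_⟩
    have : Δ.ψ (φ (x1, y), x1) = y := (ch.mapΩ _ b1).2
    rw [this]
    exact hne
  obtain ⟨L, hL, hvol⟩ := vol_image (s := K ×ˢ I) (isCompact_Icc.prod isCompact_Icc)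
    ((convex_Icc _ _).prod (convex_Icc _ _)) (G1 := fun w => w.2) (G2 := ψ)
    (fun w _ => analyticAt_snd) (ch.an.mono KIT)
  have hCV : ∀ A : Set (ℝ × ℝ), MeasurableSet A → A ⊆ I ×ˢ J →
      volume A ≤ ENNReal.ofReal L * volume {z : ℝ × ℝ | z ∈ K ×ˢ I ∧ (z.2, Δ.ψ z) ∈ A} := by
    intro A _ hA
    refine le_trans (measure_mono ?_) (hvol {z : ℝ × ℝ | z ∈ K ×ˢ I ∧ (z.2, Δ.ψ z) ∈ A}
      (fun z hz => hz.1))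
    intro z hz
    obtain ⟨b1, b2⟩ := hb3 (hA hz)
    have e : ψ (φ z, z.1) = z.2 := (ch.mapΩ _ b1).2
    refine ⟨(φ z, z.1), ⟨⟨b2, (hA hz).1⟩, ?_⟩, ?_⟩
    · show (z.1, ψ (φ z, z.1)) ∈ A
      rw [e]; exact hz
    · simp only [e]
  intro ϱ C0 hϱ hC0
  obtain ⟨C, c, hC, hc, hest⟩ := Dat.local_est (Δ := Δ) (by linarith) (by linarith) (by linarith)
    (by linarith) (by linarith) (by linarith) good der h3 hD hD' hL hCV hϱ hC0
  refine ⟨C, c, hC, hc, ?_⟩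
  intro δ hδ hδ1 f1 f2 f3 R1 R2 S mS hS hS1
  refine hest δ hδ hδ1 f1 f2 f3 R1 R2 S mS hS ?_
  intro z hz hzS
  have := hS1 _ hzS
  have e : φ (z.2, ψ z) = z.1 := (ch.mapT z (KIT hz)).2
  have e' : φ (z.2, Δ.ψ z) = z.1 := e
  rw [e'] at this
  exact this

end Macro

namespace Macro

/-- the plane -/
abbrev Pl : Type := EuclideanSpace ℝ (Fin 2)

lemma eq_zero_of_indep {l1 l2 : Pl →L[ℝ] ℝ} (h : LinearIndependent ℝ ![l1, l2]) {v : Pl}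
    (h1 : l1 v = 0) (h2 : l2 v = 0) : v = 0 := by
  have hfin : Module.finrank ℝ (Pl →L[ℝ] ℝ) = 2 := by
    rw [← (LinearMap.toContinuousLinearMap (𝕜 := ℝ) (E := Pl) (F' := ℝ)).finrank_eq]
    have : Module.finrank ℝ (Module.Dual ℝ Pl) = Module.finrank ℝ Pl := Subspace.dual_finrank_eq
    rw [finrank_euclideanSpace_fin] at this
    exact this
  haveI : FiniteDimensional ℝ (Pl →L[ℝ] ℝ) := Module.finite_of_finrank_pos (by rw [hfin]; norm_num)
  have htop := h.span_eq_top_of_card_eq_finrank' (by rw [hfin]; rfl)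
  have hall : ∀ l : Pl →L[ℝ] ℝ, l v = 0 := by
    intro l
    have hl : l ∈ Submodule.span ℝ (Set.range ![l1, l2]) := by rw [htop]; trivial
    refine Submodule.span_induction (p := fun l _ => l v = 0) ?_ ?_ ?_ ?_ hl
    · rintro _ ⟨i, rfl⟩
      fin_cases i
      · exact h1
      · exact h2
    · rfl
    · intro x y _ _ hx hy
      simp [hx, hy]
    · intro c x _ hx
      simp [hx]
  ext i
  exact hall (EuclideanSpace.proj i)

lemma vol_plane {σ : ℝ × ℝ → Pl} {s : Set (ℝ × ℝ)} (hs : IsCompact s) (hc : Convex ℝ s)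
    (h : AnalyticOnNhd ℝ σ s) : ∃ L, 1 ≤ L ∧ ∀ T ⊆ s,
      volume (σ '' T) ≤ ENNReal.ofReal L * volume T := by
  have hi : ∀ i : Fin 2, AnalyticOnNhd ℝ (fun z => σ z i) s := fun i z hz =>
    ((EuclideanSpace.proj i : Pl →L[ℝ] ℝ).analyticAt (σ z)).comp (h z hz)
  obtain ⟨L, hL, hvol⟩ := vol_image hs hc (hi 0) (hi 1)
  refine ⟨L, hL, fun T hT => le_trans ?_ (hvol T hT)⟩
  let ι : Pl ≃ᵐ ℝ × ℝ := (MeasurableEquiv.toLp 2 (Fin 2 → ℝ)).symm.trans MeasurableEquiv.finTwoArrow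
  have hι : MeasurePreserving ι volume volume :=
    (volume_preserving_finTwoArrow ℝ).comp
      (EuclideanSpace.volume_preserving_symm_measurableEquiv_toLp (Fin 2))
  rw [← hι.measure_preimage_equiv]
  refine measure_mono ?_
  rintro _ ⟨z, hz, rfl⟩
  exact ⟨z, hz, rfl⟩

/-- The part of the hypotheses that is used. -/
structure Hyp (x₀ : Pl) (r : ℝ) (Bt : Set Pl) (a φ : Fin 3 → Pl → ℝ) : Prop where
  hr : 0 < r
  hBtOpen : IsOpen Bt
  hBBt : Metric.closedBall x₀ r ⊆ Bt
  ha : ∀ j, AnalyticOnNhd ℝ (a j) Bt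
  hφ : ∀ j, AnalyticOnNhd ℝ (φ j) Bt
  haNz : ∀ j, ∀ x ∈ Bt, a j x ≠ 0
  hInd : ∀ i j : Fin 3, i ≠ j → ∀ x ∈ Bt,
      LinearIndependent ℝ ![fderiv ℝ (φ i) x, fderiv ℝ (φ j) x]
  hMain : ∀ U : Set Pl, U ⊆ Bt → IsOpen U → U.Nonempty →
      IsConnected U → ∀ f : Fin 3 → ℝ → ℝ,
      (∀ j, AnalyticOnNhd ℝ (f j) (φ j '' U)) →
      (∀ x ∈ U, ∑ j, a j x * f j (φ j x) = 0) →
      ∀ j, ∀ y ∈ φ j '' U, f j y = 0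
  hAux : ∀ k : Fin 3, ∀ U : Set Pl, U ⊆ Metric.closedBall x₀ r → IsOpen U → U.Nonempty →
      ∀ g : Fin 3 → ℝ → ℝ, (∀ i, i ≠ k → AnalyticOnNhd ℝ (g i) (φ i '' U)) →
      (∀ x ∈ U, ∑ i ∈ Finset.univ.filter (fun i => i ≠ k), a i x * g i (φ i x) = 0) →
      ∀ i, i ≠ k → ∀ y ∈ φ i '' U, g i y = 0

/-- the conclusion restricted to a set `A` -/
def Concl (x₀ : Pl) (r : ℝ) (a φ : Fin 3 → Pl → ℝ) (ϱ : ℝ) (A : Set Pl) : Prop :=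
  ∃ C c : ℝ, 0 < C ∧ 0 < c ∧ ∀ δ : ℝ, 0 < δ → δ ≤ 1 → ∀ f : Fin 3 → ℝ → ℝ,
    (∀ j, ∃ b m q, Rep (f j) b m q δ (δ ^ (-(1 / 2 : ℝ)))) →
    (∀ y ∈ φ 2 '' Metric.closedBall x₀ r, 1 ≤ |f 2 y|) →
    volume {x | x ∈ Metric.closedBall x₀ r ∧ x ∈ A ∧
      |∑ j, a j x * f j (φ j x)| < δ ^ (1 + ϱ)} ≤ ENNReal.ofReal (C * δ ^ c)

lemma Hyp.point {x₀ : Pl} {r : ℝ} {Bt : Set Pl} {a φ : Fin 3 → Pl → ℝ} (H : Hyp x₀ r Bt a φ)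
    {ϱ : ℝ} (hϱ : 0 < ϱ) {p : Pl} (hp : p ∈ Metric.closedBall x₀ r) :
    ∃ N ∈ nhds p, Concl x₀ r a φ ϱ N := by
  have hpB := H.hBBt hp
  have dφ : ∀ j, ∀ x ∈ Bt, DifferentiableAt ℝ (φ j) x := fun j x hx => (H.hφ j x hx).differentiableAt
  obtain ⟨e, he1, he2, he3, he4⟩ := inv_an (Φ := fun z : Pl => (φ 0 z, φ 1 z)) (by simp) H.hBtOpen hpB
    ((H.hφ 0 p hpB).prod (H.hφ 1 p hpB)) (by
      intro v hv
      have hd : HasFDerivAt (fun z : Pl => (φ 0 z, φ 1 z))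
        ((fderiv ℝ (φ 0) p).prod (fderiv ℝ (φ 1) p)) p :=
        (dφ 0 p hpB).hasFDerivAt.prodMk (dφ 1 p hpB).hasFDerivAt
      rw [hd.fderiv] at hv
      simp only [ContinuousLinearMap.prod_apply, Prod.mk_eq_zero] at hv
      exact eq_zero_of_indep (H.hInd 0 1 (by decide) p hpB) hv.1 hv.2)
  set σ : ℝ × ℝ → Pl := ⇑e.symm with hσ
  set O := e.target with hO
  have Oo : IsOpen O := e.open_target
  have σB : ∀ z ∈ O, σ z ∈ Bt := fun z hz => he2 (e.map_target hz)
  have σ01 : ∀ z ∈ O, φ 0 (σ z) = z.1 ∧ φ 1 (σ z) = z.2 := by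
    intro z hz
    have := e.right_inv hz
    rw [he3] at this
    rw [Prod.ext_iff] at this
    exact this
  have anc : ∀ {F : Pl → ℝ}, AnalyticOnNhd ℝ F Bt → AnalyticOnNhd ℝ (fun z => F (σ z)) O :=
    fun hF z hz => (hF _ (σB z hz)).comp (he4 z hz)
  have dsig : ∀ z ∈ O, DifferentiableAt ℝ σ z := fun z hz => (he4 z hz).differentiableAt
  have chain : ∀ j, ∀ z ∈ O, ∀ v, fderiv ℝ (fun z => φ j (σ z)) z v =
      fderiv ℝ (φ j) (σ z) (fderiv ℝ σ z v) := by
    intro j z hz v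
    have := ((dφ j _ (σB z hz)).hasFDerivAt.comp z (dsig z hz).hasFDerivAt).fderiv
    have e2 : fderiv ℝ (fun z => φ j (σ z)) z = fderiv ℝ (φ j ∘ σ) z := rfl
    rw [e2, this]; rfl
  have c0 : ∀ z ∈ O, ∀ v, fderiv ℝ (φ 0) (σ z) (fderiv ℝ σ z v) = v.1 := by
    intro z hz v
    rw [← chain 0 z hz]
    have : (fun z => φ 0 (σ z)) =ᶠ[nhds z] Prod.fst := by
      filter_upwards [Oo.mem_nhds hz] with w hw using (σ01 w hw).1
    rw [this.fderiv_eq, fderiv_fst]; rfl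
  have c1 : ∀ z ∈ O, ∀ v, fderiv ℝ (φ 1) (σ z) (fderiv ℝ σ z v) = v.2 := by
    intro z hz v
    rw [← chain 1 z hz]
    have : (fun z => φ 1 (σ z)) =ᶠ[nhds z] Prod.snd := by
      filter_upwards [Oo.mem_nhds hz] with w hw using (σ01 w hw).2
    rw [this.fderiv_eq, fderiv_snd]; rfl
  have px : ∀ z ∈ O, fderiv ℝ (fun z => φ 2 (σ z)) z (1, 0) ≠ 0 := by
    intro z hz h0
    rw [chain 2 z hz] at h0
    have h1 := c1 z hz (1, 0)
    have := eq_zero_of_indep (H.hInd 1 2 (by decide) _ (σB z hz)) h1 h0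
    have h2 := c0 z hz (1, 0)
    rw [this, map_zero] at h2
    norm_num at h2
  have py : ∀ z ∈ O, fderiv ℝ (fun z => φ 2 (σ z)) z (0, 1) ≠ 0 := by
    intro z hz h0
    rw [chain 2 z hz] at h0
    have h1 := c0 z hz (0, 1)
    have := eq_zero_of_indep (H.hInd 0 2 (by decide) _ (σB z hz)) h1 h0
    have h2 := c1 z hz (0, 1)
    rw [this, map_zero] at h2
    norm_num at h2
  have nz : ∀ j, ∀ z ∈ O, a j (σ z) ≠ 0 := fun j z hz => H.haNz j _ (σB z hz)
  -- images of open sets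
  have imo : ∀ Ω : Set (ℝ × ℝ), Ω ⊆ O → IsOpen Ω → IsOpen (σ '' Ω) := by
    intro Ω hΩ oΩ
    exact e.symm.isOpen_image_of_subset_source oΩ hΩ
  have im0 : ∀ Ω : Set (ℝ × ℝ), Ω ⊆ O → φ 0 '' (σ '' Ω) ⊆ Prod.fst '' Ω := by
    rintro Ω hΩ _ ⟨_, ⟨z, hz, rfl⟩, rfl⟩
    exact ⟨z, hz, (σ01 z (hΩ hz)).1.symm⟩
  have im1 : ∀ Ω : Set (ℝ × ℝ), Ω ⊆ O → φ 1 '' (σ '' Ω) ⊆ Prod.snd '' Ω := by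
    rintro Ω hΩ _ ⟨_, ⟨z, hz, rfl⟩, rfl⟩
    exact ⟨z, hz, (σ01 z (hΩ hz)).2.symm⟩
  have im2 : ∀ Ω : Set (ℝ × ℝ), φ 2 '' (σ '' Ω) ⊆ (fun z => φ 2 (σ z)) '' Ω := by
    rintro Ω _ ⟨_, ⟨z, hz, rfl⟩, rfl⟩
    exact ⟨z, hz, rfl⟩
  set G := O ∩ σ ⁻¹' Metric.ball x₀ r with hG
  have Go : IsOpen G := he4.continuousOn.isOpen_inter_preimage Oo Metric.isOpen_ball
  set z0 := e p with hz0d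
  have hz0 : z0 ∈ O := e.map_source he1
  have hz0G : z0 ∈ closure G := by
    rw [mem_closure_iff]
    intro N hN hzN
    have o1 : IsOpen (e.source ∩ e ⁻¹' N) := e.isOpen_inter_preimage hN
    have hcl : p ∈ closure (Metric.ball x₀ r) := by rw [closure_ball x₀ H.hr.ne']; exact hp
    obtain ⟨q, hq1, hq2⟩ := mem_closure_iff.1 hcl _ o1 ⟨he1, hzN⟩
    refine ⟨e q, hq1.2, e.map_source hq1.1, ?_⟩
    show σ (e q) ∈ Metric.ball x₀ r
    rw [hσ, e.left_inv hq1.1]; exact hq2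
  obtain ⟨r3, hr3, hcb, hest⟩ := chart_est (φ := fun z => φ 2 (σ z)) (O := O)
    (U := fun z => a 0 (σ z) / a 2 (σ z)) (V := fun z => a 1 (σ z) / a 2 (σ z)) (G := G) (z0 := z0)
    Oo hz0 (anc (H.hφ 2)) px py
    (fun z hz => (anc (H.ha 0) z hz).div (anc (H.ha 2) z hz) (nz 2 z hz))
    (fun z hz => div_ne_zero (nz 0 z hz) (nz 2 z hz))
    (fun z hz => (anc (H.ha 1) z hz).div (anc (H.ha 2) z hz) (nz 2 z hz))
    (fun z hz => div_ne_zero (nz 1 z hz) (nz 2 z hz)) Go hz0G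
    (by
      intro Ω hΩ oΩ nΩ cΩ f1 f2 f3 a1 a2 a3 heq z hz
      refine H.hMain (σ '' Ω) ?_ (imo Ω hΩ oΩ) (nΩ.image _)
        (cΩ.image _ (he4.mono hΩ).continuousOn) ![f1, f2, f3] ?_ ?_ 2 (φ 2 (σ z)) ⟨_, ⟨z, hz, rfl⟩, rfl⟩
      · rintro _ ⟨z, hz, rfl⟩
        exact σB z (hΩ hz)
      · intro j
        fin_cases j
        · exact a1.mono (im0 Ω hΩ)
        · exact a2.mono (im1 Ω hΩ)
        · exact a3.mono (im2 Ω)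
      · rintro _ ⟨z, hz, rfl⟩
        have h2 := nz 2 z (hΩ hz)
        have := heq z hz
        simp only [Fin.sum_univ_three, Matrix.cons_val_zero, Matrix.cons_val_one, Matrix.cons_val]
        rw [(σ01 z (hΩ hz)).1, (σ01 z (hΩ hz)).2]
        field_simp at this
        linarith)
    (by
      intro Ω hΩ oΩ nΩ k g hk hg heq z hz
      have hΩO : Ω ⊆ O := fun z hz => (hΩ hz).1
      have := H.hAux 1 (σ '' Ω) ?_ (imo Ω hΩO oΩ) (nΩ.image _) ![k, 0, g] ?_ ?_ 0 (by decide)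
        (φ 0 (σ z)) ⟨_, ⟨z, hz, rfl⟩, rfl⟩
      · rwa [(σ01 z (hΩO hz)).1] at this
      · rintro _ ⟨z, hz, rfl⟩
        exact Metric.ball_subset_closedBall (hΩ hz).2.2
      · intro j hj
        fin_cases j
        · exact hk.mono (im0 Ω hΩO)
        · exact absurd rfl hj
        · exact hg.mono (im2 Ω)
      · rintro _ ⟨z, hz, rfl⟩
        have h2 := nz 2 z (hΩO hz)
        have := heq z hz
        rw [Finset.sum_filter, Fin.sum_univ_three]
        simp only [Matrix.cons_val_zero, Matrix.cons_val_one, Matrix.cons_val]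
        rw [(σ01 z (hΩO hz)).1]
        field_simp at this
        simpa using this)
    (by
      intro Ω hΩ oΩ nΩ k g hk hg heq z hz
      have hΩO : Ω ⊆ O := fun z hz => (hΩ hz).1
      have := H.hAux 0 (σ '' Ω) ?_ (imo Ω hΩO oΩ) (nΩ.image _) ![0, k, g] ?_ ?_ 1 (by decide)
        (φ 1 (σ z)) ⟨_, ⟨z, hz, rfl⟩, rfl⟩
      · rwa [(σ01 z (hΩO hz)).2] at this
      · rintro _ ⟨z, hz, rfl⟩
        exact Metric.ball_subset_closedBall (hΩ hz).2.2
      · intro j hj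
        fin_cases j
        · exact absurd rfl hj
        · exact hk.mono (im1 Ω hΩO)
        · exact hg.mono (im2 Ω)
      · rintro _ ⟨z, hz, rfl⟩
        have h2 := nz 2 z (hΩO hz)
        have := heq z hz
        rw [Finset.sum_filter, Fin.sum_univ_three]
        simp only [Matrix.cons_val_zero, Matrix.cons_val_one, Matrix.cons_val]
        rw [(σ01 z (hΩO hz)).2]
        field_simp at this
        simpa using this)
  set s := Metric.closedBall z0 r3 with hs
  have sc : IsCompact s := isCompact_closedBall _ _
  have ms : MeasurableSet s := Metric.isClosed_closedBall.measurableSet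
  have anU : AnalyticOnNhd ℝ (fun z => a 0 (σ z) / a 2 (σ z)) O :=
    fun z hz => (anc (H.ha 0) z hz).div (anc (H.ha 2) z hz) (nz 2 z hz)
  have anV : AnalyticOnNhd ℝ (fun z => a 1 (σ z) / a 2 (σ z)) O :=
    fun z hz => (anc (H.ha 1) z hz).div (anc (H.ha 2) z hz) (nz 2 z hz)
  obtain ⟨C0, hC0, hC0b⟩ := Dat.exists_bd sc (F := fun z => 1 / a 2 (σ z))
    (fun z hz => ((analyticAt_const.div (anc (H.ha 2) z (hcb hz))
      (nz 2 z (hcb hz))).continuousAt.continuousWithinAt))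
  obtain ⟨L, hL, hvol⟩ := vol_plane sc (convex_closedBall _ _) (he4.mono hcb)
  obtain ⟨C, c, hC, hc, hfin⟩ := hest ϱ C0 hϱ hC0
  refine ⟨e.source ∩ e ⁻¹' s, ?_, L * C, c, by positivity, hc, ?_⟩
  · exact Filter.inter_mem (e.open_source.mem_nhds he1)
      ((e.continuousAt he1) (Metric.closedBall_mem_nhds _ hr3))
  intro δ hδ hδ1 f hf hf2
  obtain ⟨b0, m0, q0, R0⟩ := hf 0
  obtain ⟨b1, m1, q1, R1⟩ := hf 1
  obtain ⟨b2, m2, q2, R2⟩ := hf 2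
  let E : ℝ × ℝ → ℝ := fun z => s.indicator (fun z => a 0 (σ z) / a 2 (σ z)) z * f 0 z.1 +
    s.indicator (fun z => a 1 (σ z) / a 2 (σ z)) z * f 1 z.2 +
    f 2 (s.indicator (fun z => φ 2 (σ z)) z)
  have mE : Measurable E :=
    (((Dat.meas_ind ms (anU.mono hcb).continuousOn).mul ((Dat.Rep_meas R0).comp measurable_fst)).add
      ((Dat.meas_ind ms (anV.mono hcb).continuousOn).mul ((Dat.Rep_meas R1).comp measurable_snd))).add
      ((Dat.Rep_meas R2).comp (Dat.meas_ind ms ((anc (H.hφ 2)).mono hcb).continuousOn))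
  have eE : ∀ z ∈ s, E z = a 0 (σ z) / a 2 (σ z) * f 0 z.1 + a 1 (σ z) / a 2 (σ z) * f 1 z.2 +
      f 2 (φ 2 (σ z)) := by
    intro z hz
    simp only [E, indicator_of_mem hz]
  set S : Set (ℝ × ℝ) := {z | z ∈ s ∧ σ z ∈ Metric.closedBall x₀ r} ∩ {z | |E z| ≤ C0 * δ ^ (1 + ϱ)}
    with hS
  have mS : MeasurableSet S :=
    (meas_inter_preimage ms (he4.mono hcb).continuousOn Metric.isClosed_closedBall.measurableSet).inter
      (measurableSet_le mE.abs measurable_const)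
  have hSs : S ⊆ s := fun z hz => hz.1.1
  have vS := hfin δ hδ hδ1 (f 0) (f 1) (f 2) (hf 0) (hf 1) S mS hSs (fun z hz => by
    refine ⟨?_, hf2 _ ⟨_, hz.1.2, rfl⟩⟩
    have := hz.2
    rw [mem_ofPred_eq, eE z hz.1.1] at this
    exact this)
  calc _ ≤ volume (σ '' S) := by
        refine measure_mono ?_
        rintro x ⟨hx1, ⟨hx2, hx3⟩, hx4⟩
        have hx5 : σ (e x) = x := e.left_inv hx2
        have hx6 := σ01 (e x) (e.map_source hx2)
        have hx7 := nz 2 (e x) (e.map_source hx2)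
        rw [hx5] at hx6 hx7
        have hx8 := hC0b (e x) hx3
        simp only [hx5] at hx8
        refine ⟨e x, ⟨⟨hx3, by rw [hx5]; exact hx1⟩, ?_⟩, hx5⟩
        rw [mem_ofPred_eq, eE _ hx3, hx5, ← hx6.1, ← hx6.2]
        have e1 : a 0 x / a 2 x * f 0 (φ 0 x) + a 1 x / a 2 x * f 1 (φ 1 x) + f 2 (φ 2 x) =
            (1 / a 2 x) * ∑ j, a j x * f j (φ j x) := by
          rw [Fin.sum_univ_three]; field_simp
        rw [e1, abs_mul]
        exact mul_le_mul hx8 hx4.le (abs_nonneg _) (by linarith)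
    _ ≤ ENNReal.ofReal L * volume S := hvol S hSs
    _ ≤ ENNReal.ofReal L * ENNReal.ofReal (C * δ ^ c) := by gcongr
    _ = ENNReal.ofReal (L * C * δ ^ c) := by
        rw [← ENNReal.ofReal_mul (by linarith), mul_assoc]

lemma Hyp.all {x₀ : Pl} {r : ℝ} {Bt : Set Pl} {a φ : Fin 3 → Pl → ℝ} (H : Hyp x₀ r Bt a φ)
    {ϱ : ℝ} (hϱ : 0 < ϱ) : Concl x₀ r a φ ϱ (Metric.closedBall x₀ r) := by
  refine IsCompact.induction_on (p := Concl x₀ r a φ ϱ) (isCompact_closedBall x₀ r) ?_ ?_ ?_ ?_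
  · refine ⟨1, 1, one_pos, one_pos, fun δ _ _ f _ _ => ?_⟩
    simp
  · rintro A B hAB ⟨C, c, hC, hc, h⟩
    refine ⟨C, c, hC, hc, fun δ h1 h2 f h3 h4 => le_trans (measure_mono ?_) (h δ h1 h2 f h3 h4)⟩
    rintro x ⟨a1, a2, a3⟩
    exact ⟨a1, hAB a2, a3⟩
  · rintro A B ⟨C1, c1, hC1, hc1, h1⟩ ⟨C2, c2, hC2, hc2, h2⟩
    refine ⟨C1 + C2, min c1 c2, by positivity, lt_min hc1 hc2, fun δ hδ hδ1 f h3 h4 => ?_⟩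
    have v1 := h1 δ hδ hδ1 f h3 h4
    have v2 := h2 δ hδ hδ1 f h3 h4
    have e1 : δ ^ c1 ≤ δ ^ (min c1 c2) :=
      Real.rpow_le_rpow_of_exponent_ge hδ hδ1 (min_le_left _ _)
    have e2 : δ ^ c2 ≤ δ ^ (min c1 c2) :=
      Real.rpow_le_rpow_of_exponent_ge hδ hδ1 (min_le_right _ _)
    calc _ ≤ volume ({x | x ∈ Metric.closedBall x₀ r ∧ x ∈ A ∧
              |∑ j, a j x * f j (φ j x)| < δ ^ (1 + ϱ)} ∪
            {x | x ∈ Metric.closedBall x₀ r ∧ x ∈ B ∧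
              |∑ j, a j x * f j (φ j x)| < δ ^ (1 + ϱ)}) := by
            refine measure_mono ?_
            rintro x ⟨a1, a2 | a2, a3⟩
            · exact Or.inl ⟨a1, a2, a3⟩
            · exact Or.inr ⟨a1, a2, a3⟩
      _ ≤ _ := (measure_union_le _ _).trans (add_le_add v1 v2)
      _ = ENNReal.ofReal (C1 * δ ^ c1 + C2 * δ ^ c2) :=
        (ENNReal.ofReal_add (by positivity) (by positivity)).symm
      _ ≤ _ := by
        refine ENNReal.ofReal_le_ofReal ?_
        rw [add_mul]
        gcongr
  · intro p hp
    obtain ⟨N, hN, h⟩ := H.point hϱ hp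
    exact ⟨N, mem_nhdsWithin_of_mem_nhds hN, h⟩

lemma Hyp.final {x₀ : Pl} {r : ℝ} {Bt : Set Pl} {a φ : Fin 3 → Pl → ℝ} (H : Hyp x₀ r Bt a φ) :
    ∀ ϱ : ℝ, 0 < ϱ → ∃ ρ c C : ℝ, 0 < ρ ∧ 0 < c ∧ 0 < C ∧
      ∀ δ : ℝ, 0 < δ → ∀ f : Fin 3 → ℝ → ℝ,
        (∀ j, AffineOnIntervals (f j) δ (δ ^ (-ρ))) →
        (∀ j, ∀ᵐ y ∂(volume : Measure ℝ), |f j y| ≤ 2) →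
        (∀ y ∈ φ 2 '' Metric.closedBall x₀ r, 1 ≤ |f 2 y|) →
        volume {x ∈ Metric.closedBall x₀ r |
            |∑ j, a j x * f j (φ j x)| < δ ^ (1 + ϱ)} ≤
          ENNReal.ofReal (C * δ ^ c) := by
  intro ϱ hϱ
  obtain ⟨C, c, hC, hc, h⟩ := H.all hϱ
  set v := (volume (Metric.closedBall x₀ r)).toReal with hv
  have hv0 : 0 ≤ v := ENNReal.toReal_nonneg
  refine ⟨1 / 2, c, C + v, by norm_num, hc, by positivity, ?_⟩
  intro δ hδ f h1 h2 h3
  rcases le_or_gt δ 1 with hδ1 | hδ1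
  · have hMδ : δ ^ (-(1 / 2 : ℝ)) * δ ≤ 1 := by
      have : δ ^ (-(1 / 2 : ℝ)) * δ = δ ^ (1 / 2 : ℝ) := by
        nth_rewrite 2 [← Real.rpow_one δ]
        rw [← Real.rpow_add hδ]; norm_num
      rw [this]
      exact Real.rpow_le_one hδ.le hδ1 (by norm_num)
    have := h δ hδ hδ1 f (fun j => exists_rep (h1 j) hδ hMδ (h2 j)) h3
    refine le_trans (measure_mono ?_) (this.trans (ENNReal.ofReal_le_ofReal ?_))
    · rintro x ⟨a1, a2⟩
      exact ⟨a1, a1, a2⟩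
    · gcongr; linarith
  · have hfin : volume (Metric.closedBall x₀ r) ≠ ⊤ := measure_closedBall_lt_top.ne
    calc _ ≤ volume (Metric.closedBall x₀ r) := measure_mono fun x hx => hx.1
      _ = ENNReal.ofReal v := (ENNReal.ofReal_toReal hfin).symm
      _ ≤ _ := by
        refine ENNReal.ofReal_le_ofReal ?_
        have : 1 ≤ δ ^ c := Real.one_le_rpow hδ1.le hc.le
        nlinarith

end Macro

/-- Proposition 9.1 (Macroscale): for triples of piecewise affine functions at scale `δ`
with slopes `O(δ^{-ρ})`, bounded by `2`, and with `|f₃| ≥ 1` on `φ₃(B)`, the sublevel set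
`S(f, δ^{1+ϱ})` has measure `O(δ^c)`. -/
theorem macroscale_proposition
    (x₀ : EuclideanSpace ℝ (Fin 2)) (r : ℝ) (hr : 0 < r)
    (Bt : Set (EuclideanSpace ℝ (Fin 2))) (hBtOpen : IsOpen Bt) (hBtConn : IsConnected Bt)
    (hBBt : Metric.closedBall x₀ r ⊆ Bt)
    (a φ : Fin 3 → EuclideanSpace ℝ (Fin 2) → ℝ)
    (ha : ∀ j, AnalyticOnNhd ℝ (a j) Bt)
    (hφ : ∀ j, AnalyticOnNhd ℝ (φ j) Bt)
    -- nondegeneracy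
    (haNz : ∀ j, ∀ x ∈ Bt, a j x ≠ 0)
    (hInd : ∀ i j : Fin 3, i ≠ j → ∀ x ∈ Bt,
      LinearIndependent ℝ ![fderiv ℝ (φ i) x, fderiv ℝ (φ j) x])
    -- the curvature of the web defined by Φ does not vanish identically
    (hcurv : ¬ ∃ V : Set (EuclideanSpace ℝ (Fin 2)),
      V ⊆ Metric.closedBall x₀ r ∧ IsOpen V ∧ V.Nonempty ∧ IsConnected V ∧
      ∃ (Φ : EuclideanSpace ℝ (Fin 2) → EuclideanSpace ℝ (Fin 2)) (ψ : Fin 3 → ℝ → ℝ)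
        (L : Fin 3 → (EuclideanSpace ℝ (Fin 2) →L[ℝ] ℝ)) (c : Fin 3 → ℝ),
        AnalyticOnNhd ℝ Φ V ∧ Set.InjOn Φ V ∧ IsOpen (Φ '' V) ∧
        (∀ j, AnalyticOnNhd ℝ (ψ j) (φ j '' V) ∧ Set.InjOn (ψ j) (φ j '' V)) ∧
        ∀ j, ∀ x ∈ V, ψ j (φ j x) = L j (Φ x) + c j)
    -- Main hypothesis
    (hMain : ∀ U : Set (EuclideanSpace ℝ (Fin 2)), U ⊆ Bt → IsOpen U → U.Nonempty →
      IsConnected U → ∀ f : Fin 3 → ℝ → ℝ,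
      (∀ j, AnalyticOnNhd ℝ (f j) (φ j '' U)) →
      (∀ x ∈ U, ∑ j, a j x * f j (φ j x) = 0) →
      ∀ j, ∀ y ∈ φ j '' U, f j y = 0)
    -- the vector fields Wⱼ
    (W : Fin 3 → EuclideanSpace ℝ (Fin 2) → EuclideanSpace ℝ (Fin 2))
    (hWanalytic : ∀ j, AnalyticOnNhd ℝ (W j) Bt)
    (hWnz : ∀ j, ∃ x ∈ Bt, W j x ≠ 0)
    (hWφ : ∀ j, ∀ x ∈ Bt, fderiv ℝ (φ j) x (W j x) = 0)
    -- auxiliary hypothesis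
    (hAux : ∀ k : Fin 3, ∀ U : Set (EuclideanSpace ℝ (Fin 2)),
      U ⊆ Metric.closedBall x₀ r → IsOpen U → U.Nonempty → ∀ τ : ℝ,
      ∀ g : Fin 3 → ℝ → ℝ, (∀ i, i ≠ k → AnalyticOnNhd ℝ (g i) (φ i '' U)) →
      (∀ x ∈ U, ∑ i ∈ Finset.univ.filter (fun i => i ≠ k),
          a i x * |fderiv ℝ (φ i) x (W k x)| ^ τ * g i (φ i x) = 0) →
      ∀ i, i ≠ k → ∀ y ∈ φ i '' U, g i y = 0) :
    ∀ ϱ : ℝ, 0 < ϱ → ∃ ρ c C : ℝ, 0 < ρ ∧ 0 < c ∧ 0 < C ∧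
      ∀ δ : ℝ, 0 < δ → ∀ f : Fin 3 → ℝ → ℝ,
        (∀ j, AffineOnIntervals (f j) δ (δ ^ (-ρ))) →
        (∀ j, ∀ᵐ y ∂(volume : Measure ℝ), |f j y| ≤ 2) →
        (∀ y ∈ φ 2 '' Metric.closedBall x₀ r, 1 ≤ |f 2 y|) →
        volume {x ∈ Metric.closedBall x₀ r |
            |∑ j, a j x * f j (φ j x)| < δ ^ (1 + ϱ)} ≤
          ENNReal.ofReal (C * δ ^ c) := by
  exact Macro.Hyp.final (x₀ := x₀) (r := r) (Bt := Bt) (a := a) (φ := φ)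
    ⟨hr, hBtOpen, hBBt, ha, hφ, haNz, hInd, hMain, fun k U hU hUo hUn g hg h =>
      hAux k U hU hUo hUn 0 g hg (by
        intro x hx
        simpa only [Real.rpow_zero, mul_one] using h x hx)⟩
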